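/- There exists an absolute constant c > 0 such that for X sufficiently large and every y with 2 ≤ y ≤ (log X)^{1/5}, there exist at least X^{1 − 1/log log X} values x ∈ [X, 2X] such that S(x+y) − S(x) ≥ c · y^{1/2}·(log y)^{−1/4}, i.e. the interval (x, x+y] contains at least c·y^{1/2}(log y)^{−1/4} integers expressible as a sum of two squares. -/

import Mathlib

/-- `n` is a positive integer expressible as a sum of two squares. -/
def IsSumTwoSquares (n : ℕ) : Prop := 0 < n ∧ ∃ a b : ℕ, n = a ^ 2 + b ^ 2

/-- `Scount x` counts the positive integers `n ≤ x` expressible as a sum of two squares. -/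
noncomputable def Scount (x : ℝ) : ℕ := {n : ℕ | (n : ℝ) ≤ x ∧ IsSumTwoSquares n}.ncard

open Finset
namespace VS

/-- odd primes (or all) up to `u` in a residue class mod 4 -/
def Q (r u : ℕ) : Finset ℕ := (range (u + 1)).filter (fun p => p.Prime ∧ p % 4 = r)
def PP (u : ℕ) : Finset ℕ := (range (u + 1)).filter (fun p => p.Prime)

lemma mem_Q {r u p : ℕ} : p ∈ Q r u ↔ p ≤ u ∧ p.Prime ∧ p % 4 = r := by
  simp [Q]
lemma mem_PP {u p : ℕ} : p ∈ PP u ↔ p ≤ u ∧ p.Prime := by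
  simp [PP]

lemma prod_PP_pow_dvd (n : ℕ) : ∏ p ∈ PP n, p ^ (n / p) ∣ n.factorial := by
  apply Finset.prod_dvd_of_isRelPrime
  · intro p hp q hq hpq
    have hp' := (mem_PP.1 hp).2
    have hq' := (mem_PP.1 hq).2
    exact Nat.coprime_iff_isRelPrime.1 (Nat.Coprime.pow _ _ ((Nat.coprime_primes hp' hq').2 hpq))
  · intro p hp
    have hp' := (mem_PP.1 hp).2
    rw [hp'.pow_dvd_factorial_iff (b := Nat.log p n + 2) (by omega)]
    have : n / p = n / p ^ 1 := by simp
    rw [this]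
    exact Finset.single_le_sum (f := fun i => n / p ^ i) (fun _ _ => Nat.zero_le _)
      (by simp)

lemma sum_log_div_le (n : ℕ) (hn : 1 ≤ n) :
    ∑ p ∈ PP n, Real.log p / p ≤ Real.log n + Real.log 4 := by
  have h1 : ∏ p ∈ PP n, p ^ (n / p) ≤ n ^ n :=
    (Nat.le_of_dvd (Nat.factorial_pos _) (prod_PP_pow_dvd n)).trans (Nat.factorial_le_pow n)
  have h2 : ∑ p ∈ PP n, ((n / p : ℕ) : ℝ) * Real.log p ≤ n * Real.log n := by
    have h3 : ((∏ p ∈ PP n, p ^ (n / p) : ℕ) : ℝ) ≤ ((n ^ n : ℕ) : ℝ) := by exact_mod_cast h1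
    have h4 := Real.log_le_log (by
      have : 0 < ∏ p ∈ PP n, p ^ (n / p) := Finset.prod_pos (fun p hp => pow_pos (mem_PP.1 hp).2.pos _)
      exact_mod_cast this) h3
    push_cast at h4
    rw [Real.log_pow, Real.log_prod] at h4
    · simpa [Real.log_pow] using h4
    · intro p hp
      have := (mem_PP.1 hp).2.ne_zero
      positivity
  have h5 : ∑ p ∈ PP n, Real.log p ≤ Real.log 4 * n := by
    have h6 := Chebyshev.theta_le_log4_mul_x (x := (n : ℝ)) (by positivity)
    rw [Chebyshev.theta_eq_log_primorial] at h6
    simp only [Nat.floor_natCast, primorial] at h6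
    push_cast at h6
    rw [Real.log_prod] at h6
    · exact h6
    · intro p hp
      have := (Finset.mem_filter.1 hp).2.ne_zero
      positivity
  have hn' : (0 : ℝ) < n := by exact_mod_cast hn
  have h7 : ∑ p ∈ PP n, (n * (Real.log p / p)) ≤
      ∑ p ∈ PP n, (((n / p : ℕ) : ℝ) * Real.log p + Real.log p) := by
    apply Finset.sum_le_sum
    intro p hp
    have hp' := (mem_PP.1 hp).2
    have hp0 : (0 : ℝ) < p := by exact_mod_cast hp'.pos
    have hl : 0 ≤ Real.log p := Real.log_nonneg (by exact_mod_cast hp'.one_le)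
    have : (n : ℝ) / p ≤ ((n / p : ℕ) : ℝ) + 1 := by
      rw [← Nat.floor_div_eq_div (K := ℝ)]
      exact (Nat.lt_floor_add_one _).le
    calc n * (Real.log p / p) = (n / p) * Real.log p := by ring
      _ ≤ (((n / p : ℕ) : ℝ) + 1) * Real.log p := by gcongr
      _ = _ := by ring
  rw [← Finset.mul_sum, Finset.sum_add_distrib] at h7
  have : (n : ℝ) * ∑ p ∈ PP n, Real.log p / p ≤ n * (Real.log n + Real.log 4) := by linarith
  exact le_of_mul_le_mul_left this hn'

/-- primes in the `i`-th doubly exponential block -/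
def Bk (i : ℕ) : Finset ℕ := (PP (2 ^ 2 ^ (i + 1))).filter (fun p => 2 ^ 2 ^ i < p)

lemma mem_Bk {i p : ℕ} : p ∈ Bk i ↔ (p ≤ 2 ^ 2 ^ (i + 1) ∧ p.Prime) ∧ 2 ^ 2 ^ i < p := by
  simp [Bk, mem_PP]

lemma sum_Bk_le (i : ℕ) : ∑ p ∈ Bk i, (1 : ℝ) / p ≤ 4 := by
  have h1 := sum_log_div_le (2 ^ 2 ^ (i + 1)) Nat.one_le_two_pow
  have hl2 := Real.log_pos (show (1 : ℝ) < 2 by norm_num)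
  have h2 : ∑ p ∈ Bk i, (2 ^ i * Real.log 2) * ((1 : ℝ) / p) ≤ ∑ p ∈ PP (2 ^ 2 ^ (i + 1)), Real.log p / p := by
    refine le_trans (Finset.sum_le_sum (g := fun p : ℕ => Real.log p / p) ?_)
      (Finset.sum_le_sum_of_subset_of_nonneg (Finset.filter_subset _ _) ?_)
    · intro p hp
      have hp' := mem_Bk.1 hp
      have hp0 : (0 : ℝ) < p := by exact_mod_cast hp'.1.2.pos
      rw [mul_one_div]
      gcongr
      have : Real.log ((2 ^ 2 ^ i : ℕ) : ℝ) ≤ Real.log p := by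
        apply Real.log_le_log (by positivity)
        exact_mod_cast hp'.2.le
      push_cast at this
      rw [Real.log_pow] at this
      simpa using this
    · intro p hp _
      have hp' := (mem_PP.1 hp).2
      exact div_nonneg (Real.log_nonneg (by exact_mod_cast hp'.one_le)) (by positivity)
  rw [← Finset.mul_sum] at h2
  have h4 : Real.log 4 = 2 * Real.log 2 := by
    rw [show (4 : ℝ) = 2 ^ 2 by norm_num, Real.log_pow]; norm_num
  have h3 := h2.trans h1
  push_cast at h3
  rw [Real.log_pow, h4] at h3
  push_cast at h3
  have h5 : (1 : ℝ) ≤ 2 ^ i := one_le_pow₀ (by norm_num)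
  have : (2 ^ i * Real.log 2) * ∑ p ∈ Bk i, (1 : ℝ) / p ≤ (2 ^ i * Real.log 2) * 4 := by
    refine h3.trans ?_
    rw [pow_succ]; nlinarith
  exact le_of_mul_le_mul_left this (by positivity)

/-- removing primes from a harmonic sum -/
lemma harm_coprime (v : ℕ) (s : Finset ℕ) (hs : ∀ p ∈ s, p.Prime) :
    (∑ m ∈ Icc 1 v, (1 : ℝ) / m) * ∏ p ∈ s, (1 - 1 / (p : ℝ)) ≤
      ∑ m ∈ (Icc 1 v).filter (fun m => ∀ p ∈ s, ¬ p ∣ m), (1 : ℝ) / m := by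
  induction s using Finset.induction_on with
  | empty => simp
  | insert q s hq ih =>
    have ih' := ih (fun p hp => hs p (Finset.mem_insert_of_mem hp))
    have hqp := hs q (Finset.mem_insert_self _ _)
    have hq0 : (0 : ℝ) < q := by exact_mod_cast hqp.pos
    rw [Finset.prod_insert hq]
    set F := ∑ m ∈ (Icc 1 v).filter (fun m => ∀ p ∈ s, ¬ p ∣ m), (1 : ℝ) / m with hF
    have hsplit : F = ∑ m ∈ ((Icc 1 v).filter (fun m => ∀ p ∈ s, ¬ p ∣ m)).filter (fun m => q ∣ m), (1 : ℝ) / m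
        + ∑ m ∈ ((Icc 1 v).filter (fun m => ∀ p ∈ s, ¬ p ∣ m)).filter (fun m => ¬ q ∣ m), (1 : ℝ) / m :=
      (Finset.sum_filter_add_sum_filter_not _ _ _).symm
    have h1 : ∑ m ∈ ((Icc 1 v).filter (fun m => ∀ p ∈ s, ¬ p ∣ m)).filter (fun m => q ∣ m), (1 : ℝ) / m
        ≤ 1 / q * F := by
      rw [hF, Finset.mul_sum]
      have himg : ((Icc 1 v).filter (fun m => ∀ p ∈ s, ¬ p ∣ m)).filter (fun m => q ∣ m) ⊆
          ((Icc 1 v).filter (fun m => ∀ p ∈ s, ¬ p ∣ m)).image (fun m => q * m) := by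
        intro m hm
        simp only [Finset.mem_filter, Finset.mem_Icc, Finset.mem_image] at hm ⊢
        obtain ⟨⟨⟨hm1, hm2⟩, hm3⟩, t, rfl⟩ := hm
        refine ⟨t, ⟨⟨?_, ?_⟩, ?_⟩, rfl⟩
        · rcases Nat.eq_zero_or_pos t with h | h
          · subst h; simp at hm1
          · exact h
        · exact (Nat.le_mul_of_pos_left t hqp.pos).trans hm2
        · intro p hp hpt
          exact hm3 p hp (hpt.mul_left q)
      refine (Finset.sum_le_sum_of_subset_of_nonneg himg (fun _ _ _ => by positivity)).trans ?_
      rw [Finset.sum_image (fun a _ b _ h => Nat.eq_of_mul_eq_mul_left hqp.pos h)]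
      apply le_of_eq
      apply Finset.sum_congr rfl
      intro m _
      push_cast
      rw [one_div_mul_one_div]
    have h2 : ∑ m ∈ ((Icc 1 v).filter (fun m => ∀ p ∈ s, ¬ p ∣ m)).filter (fun m => ¬ q ∣ m), (1 : ℝ) / m
        = ∑ m ∈ (Icc 1 v).filter (fun m => ∀ p ∈ insert q s, ¬ p ∣ m), (1 : ℝ) / m := by
      congr 1
      ext m
      simp only [Finset.mem_filter, Finset.mem_insert, forall_eq_or_imp]
      tauto
    rw [← h2]
    have h3 : 0 ≤ 1 - 1 / (q : ℝ) := by
      rw [sub_nonneg, div_le_one hq0]; exact_mod_cast hqp.one_le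
    calc _ = (1 - 1 / (q : ℝ)) * ((∑ m ∈ Icc 1 v, (1 : ℝ) / m) * ∏ p ∈ s, (1 - 1 / (p : ℝ))) := by ring
      _ ≤ (1 - 1 / (q : ℝ)) * F := by gcongr
      _ ≤ _ := by linarith

lemma log_le_harm (v : ℕ) (hv : 1 ≤ v) : Real.log v ≤ ∑ m ∈ Icc 1 v, (1 : ℝ) / m := by
  have h := log_add_one_le_harmonic v
  have h2 : ((harmonic v : ℚ) : ℝ) = ∑ m ∈ Icc 1 v, (1 : ℝ) / m := by
    rw [harmonic_eq_sum_Icc]; push_cast; simp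
  rw [h2] at h
  refine le_trans (Real.log_le_log (by exact_mod_cast hv) ?_) h
  push_cast; linarith

lemma log_mul_prod_le_one (u : ℕ) (hu : 1 ≤ u) :
    Real.log u * ∏ p ∈ PP u, (1 - 1 / (p : ℝ)) ≤ 1 := by
  have h := harm_coprime u (PP u) (fun p hp => (mem_PP.1 hp).2)
  have h2 : (Icc 1 u).filter (fun m => ∀ p ∈ PP u, ¬ p ∣ m) = {1} := by
    ext m
    simp only [Finset.mem_filter, Finset.mem_Icc, Finset.mem_singleton]
    constructor
    · rintro ⟨⟨h1, h2⟩, h3⟩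
      by_contra hne
      obtain ⟨p, hp, hpm⟩ := Nat.exists_prime_and_dvd hne
      exact h3 p (mem_PP.2 ⟨(Nat.le_of_dvd h1 hpm).trans h2, hp⟩) hpm
    · rintro rfl
      refine ⟨⟨le_rfl, hu⟩, fun p hp hd => (mem_PP.1 hp).2.one_lt.ne' (Nat.dvd_one.1 hd)⟩
  rw [h2] at h
  simp only [Finset.sum_singleton, Nat.cast_one, div_one] at h
  refine le_trans (mul_le_mul_of_nonneg_right (log_le_harm u hu) ?_) h
  apply Finset.prod_nonneg
  intro p hp
  have hp' := (mem_PP.1 hp).2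
  have hp0 : (0 : ℝ) < p := by exact_mod_cast hp'.pos
  rw [sub_nonneg, div_le_one hp0]; exact_mod_cast hp'.one_le

end VS

open Finset Filter Topology
namespace VS

lemma rpow_neg_diff (d : ℝ) (hd : 0 < d) (n : ℕ) (hn : 1 ≤ n) :
    d * ((n + 1 : ℕ) : ℝ) ^ (-(1 + d)) ≤ (n : ℝ) ^ (-d) - ((n + 1 : ℕ) : ℝ) ^ (-d) := by
  have hn0 : (0 : ℝ) < n := by exact_mod_cast hn
  have hn1 : (0 : ℝ) < ((n + 1 : ℕ) : ℝ) := by positivity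
  have h1 : (n : ℝ) ^ (-d) = ((n + 1 : ℕ) : ℝ) ^ (-d) * (((n + 1 : ℕ) : ℝ) / n) ^ d := by
    rw [Real.div_rpow hn1.le hn0.le, Real.rpow_neg hn1.le, Real.rpow_neg hn0.le]
    have := (Real.rpow_pos_of_pos hn1 d).ne'
    field_simp
  have h2 : 1 + d / ((n + 1 : ℕ) : ℝ) ≤ (((n + 1 : ℕ) : ℝ) / n) ^ d := by
    rw [Real.rpow_def_of_pos (by positivity)]
    have h3 : 1 / ((n + 1 : ℕ) : ℝ) ≤ Real.log (((n + 1 : ℕ) : ℝ) / n) := by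
      have := Real.one_sub_inv_le_log_of_pos (show 0 < ((n + 1 : ℕ) : ℝ) / n by positivity)
      refine le_trans (le_of_eq ?_) this
      push_cast
      field_simp
      ring
    have h4 := Real.add_one_le_exp (Real.log (((n + 1 : ℕ) : ℝ) / n) * d)
    have h5 : d / ((n + 1 : ℕ) : ℝ) ≤ Real.log (((n + 1 : ℕ) : ℝ) / n) * d := by
      calc d / ((n + 1 : ℕ) : ℝ) = 1 / ((n + 1 : ℕ) : ℝ) * d := by ring
        _ ≤ _ := by gcongr
    linarith
  have h6 : ((n + 1 : ℕ) : ℝ) ^ (-(1 + d)) = ((n + 1 : ℕ) : ℝ) ^ (-d) / ((n + 1 : ℕ) : ℝ) := by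
    rw [show -(1 + d) = -d - 1 by ring, Real.rpow_sub_one hn1.ne']
  rw [h1, h6]
  have h7 := Real.rpow_pos_of_pos hn1 (-d)
  have := mul_le_mul_of_nonneg_left h2 h7.le
  have e : d * (((n + 1 : ℕ) : ℝ) ^ (-d) / ((n + 1 : ℕ) : ℝ)) =
    ((n + 1 : ℕ) : ℝ) ^ (-d) * (1 + d / ((n + 1 : ℕ) : ℝ)) - ((n + 1 : ℕ) : ℝ) ^ (-d) := by ring
  rw [e]; linarith

lemma zeta_partial (d : ℝ) (hd : 0 < d) (N : ℕ) :
    ∑ n ∈ range N, (n : ℝ) ^ (-(1 + d)) ≤ 1 + 1 / d := by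
  have key : ∀ M : ℕ, ∑ n ∈ range (M + 2), (n : ℝ) ^ (-(1 + d)) ≤
      1 + 1 / d - 1 / d * ((M + 1 : ℕ) : ℝ) ^ (-d) := by
    intro M
    induction M with
    | zero =>
      rw [Finset.sum_range_succ, Finset.sum_range_one]
      simp [add_comm]
      rw [Real.zero_rpow (by linarith)]
    | succ M ih =>
      rw [Finset.sum_range_succ]
      have := rpow_neg_diff d hd (M + 1) (by omega)
      have h2 : ((M + 1 + 1 : ℕ) : ℝ) ^ (-(1 + d)) ≤
        1 / d * (((M + 1 : ℕ) : ℝ) ^ (-d) - ((M + 1 + 1 : ℕ) : ℝ) ^ (-d)) := by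
        rw [one_div, ← div_eq_inv_mul, le_div_iff₀ hd]; linarith
      have e : M + 2 = M + 1 + 1 := rfl
      rw [e] at ih ⊢
      linarith
  refine le_trans (Finset.sum_le_sum_of_subset_of_nonneg
    (Finset.range_subset_range.2 (show N ≤ N + 2 by omega)) (fun n _ _ => by positivity)) ((key N).trans ?_)
  have : 0 ≤ 1 / d * ((N + 1 : ℕ) : ℝ) ^ (-d) := by positivity
  linarith

/-- the real character mod 4 -/
noncomputable def X4 (n : ℕ) : ℝ := ((ZMod.χ₄ (n : ZMod 4) : ℤ) : ℝ)

lemma X4_eq (n : ℕ) : X4 n = if n % 2 = 0 then 0 else if n % 4 = 1 then 1 else -1 := by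
  unfold X4
  rw [ZMod.χ₄_nat_eq_if_mod_four]
  split_ifs <;> simp

lemma X4_mul (m n : ℕ) : X4 (m * n) = X4 m * X4 n := by
  unfold X4; push_cast; rw [map_mul]; push_cast; rfl

lemma X4_abs (n : ℕ) : |X4 n| ≤ 1 := by
  rw [X4_eq]; split_ifs <;> simp

noncomputable def fz (s : ℝ) (hs : s ≠ 0) : ℕ →*₀ ℝ where
  toFun n := (n : ℝ) ^ (-s)
  map_zero' := by simp [Real.zero_rpow (neg_ne_zero.2 hs)]
  map_one' := by simp
  map_mul' m n := by
    push_cast; rw [Real.mul_rpow (by positivity) (by positivity)]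

noncomputable def fc (s : ℝ) : ℕ →*₀ ℝ where
  toFun n := X4 n * (n : ℝ) ^ (-s)
  map_zero' := by simp [X4_eq]
  map_one' := by simp [X4_eq]
  map_mul' m n := by
    rw [X4_mul]
    push_cast; rw [Real.mul_rpow (by positivity) (by positivity)]; ring

lemma fz_apply (s : ℝ) (hs : s ≠ 0) (n : ℕ) : fz s hs n = (n : ℝ) ^ (-s) := rfl
lemma fc_apply (s : ℝ) (n : ℕ) : fc s n = X4 n * (n : ℝ) ^ (-s) := rfl

lemma rpow_anti {s : ℝ} (hs : 0 ≤ s) {m n : ℕ} (hm : 1 ≤ m) (hmn : m ≤ n) :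
    (n : ℝ) ^ (-s) ≤ (m : ℝ) ^ (-s) :=
  Real.rpow_le_rpow_of_nonpos (by exact_mod_cast hm) (by exact_mod_cast hmn) (by linarith)

lemma L_lower (s : ℝ) (hs : 1 ≤ s) (N : ℕ) : 2 / 3 ≤ ∑ n ∈ range (4 * N + 4), fc s n := by
  induction N with
  | zero =>
    simp only [mul_zero, zero_add, Finset.sum_range_succ, Finset.sum_range_zero, fc_apply, X4_eq]
    norm_num
    have : (3 : ℝ) ^ (-s) ≤ 3 ^ (-1 : ℝ) := Real.rpow_le_rpow_of_exponent_le (by norm_num) (by linarith)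
    rw [Real.rpow_neg_one] at this
    linarith
  | succ N ih =>
    rw [show 4 * (N + 1) + 4 = (4 * N + 4) + 1 + 1 + 1 + 1 by ring]
    rw [Finset.sum_range_succ, Finset.sum_range_succ, Finset.sum_range_succ, Finset.sum_range_succ]
    rw [fc_apply s (4 * N + 4), fc_apply s (4 * N + 4 + 1), fc_apply s (4 * N + 4 + 1 + 1),
      fc_apply s (4 * N + 4 + 1 + 1 + 1), X4_eq, X4_eq, X4_eq, X4_eq]
    have a0 : (4 * N + 4) % 2 = 0 := by omega
    have a1 : (4 * N + 4 + 1) % 2 ≠ 0 := by omega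
    have a1' : (4 * N + 4 + 1) % 4 = 1 := by omega
    have a2 : (4 * N + 4 + 1 + 1) % 2 = 0 := by omega
    have a3 : (4 * N + 4 + 1 + 1 + 1) % 2 ≠ 0 := by omega
    have a3' : (4 * N + 4 + 1 + 1 + 1) % 4 ≠ 1 := by omega
    rw [if_pos a0, if_neg a1, if_pos a1', if_pos a2, if_neg a3, if_neg a3']
    have := rpow_anti (s := s) (by linarith) (show 1 ≤ 4 * N + 4 + 1 by omega)
      (show 4 * N + 4 + 1 ≤ 4 * N + 4 + 1 + 1 + 1 by omega)
    linarith

lemma L_upper (s : ℝ) (hs : 1 ≤ s) (N : ℕ) : ∑ n ∈ range (4 * N + 2), fc s n ≤ 1 := by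
  induction N with
  | zero =>
    simp [Finset.sum_range_succ, fc_apply, X4_eq]
  | succ N ih =>
    rw [show 4 * (N + 1) + 2 = (4 * N + 2) + 1 + 1 + 1 + 1 by ring]
    rw [Finset.sum_range_succ, Finset.sum_range_succ, Finset.sum_range_succ, Finset.sum_range_succ]
    rw [fc_apply s (4 * N + 2), fc_apply s (4 * N + 2 + 1), fc_apply s (4 * N + 2 + 1 + 1),
      fc_apply s (4 * N + 2 + 1 + 1 + 1), X4_eq, X4_eq, X4_eq, X4_eq]
    have a0 : (4 * N + 2) % 2 = 0 := by omega
    have a1 : (4 * N + 2 + 1) % 2 ≠ 0 := by omega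
    have a1' : (4 * N + 2 + 1) % 4 ≠ 1 := by omega
    have a2 : (4 * N + 2 + 1 + 1) % 2 = 0 := by omega
    have a3 : (4 * N + 2 + 1 + 1 + 1) % 2 ≠ 0 := by omega
    have a3' : (4 * N + 2 + 1 + 1 + 1) % 4 = 1 := by omega
    rw [if_pos a0, if_neg a1, if_neg a1', if_pos a2, if_neg a3, if_pos a3']
    have := rpow_anti (s := s) (by linarith) (show 1 ≤ 4 * N + 2 + 1 by omega)
      (show 4 * N + 2 + 1 ≤ 4 * N + 2 + 1 + 1 + 1 by omega)
    linarith

lemma summable_fz (s : ℝ) (hs : 1 < s) : Summable (fun n : ℕ => (n : ℝ) ^ (-s)) :=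
  Real.summable_nat_rpow.2 (by linarith)

lemma summable_fc (s : ℝ) (hs : 1 < s) : Summable (fun n : ℕ => ‖fc s n‖) := by
  refine Summable.of_nonneg_of_le (fun _ => norm_nonneg _) (fun n => ?_) (summable_fz s hs)
  rw [fc_apply, norm_mul, Real.norm_eq_abs, Real.norm_eq_abs, abs_of_nonneg (a := (n : ℝ) ^ (-s)) (by positivity)]
  exact mul_le_of_le_one_left (by positivity) (X4_abs n)

lemma L_bounds (s : ℝ) (hs : 1 < s) : 2 / 3 ≤ ∑' n, fc s n ∧ ∑' n, fc s n ≤ 1 := by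
  have hsum : Summable (fun n => fc s n) := (summable_fc s hs).of_norm
  have ht := hsum.hasSum.tendsto_sum_nat
  constructor
  · have h1 : Tendsto (fun N : ℕ => 4 * N + 4) atTop atTop :=
      tendsto_atTop_mono (fun n => by show n ≤ 4 * n + 4; omega) tendsto_id
    exact ge_of_tendsto' (ht.comp h1) (fun N => L_lower s hs.le N)
  · have h1 : Tendsto (fun N : ℕ => 4 * N + 2) atTop atTop :=
      tendsto_atTop_mono (fun n => by show n ≤ 4 * n + 2; omega) tendsto_id
    exact le_of_tendsto' (ht.comp h1) (fun N => L_upper s hs.le N)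

lemma zeta_bound (d : ℝ) (hd : 0 < d) : ∑' n : ℕ, (n : ℝ) ^ (-(1 + d)) ≤ 1 + 1 / d :=
  le_of_tendsto' (summable_fz (1 + d) (by linarith)).hasSum.tendsto_sum_nat
    (fun N => zeta_partial d hd N)

end VS

open Finset Filter Topology
namespace VS

lemma factor_compare (e a t : ℝ) (he : |e| ≤ 1) (ht : 0 ≤ t) (hta : t ≤ a) (ha : a ≤ 1 / 2) :
    (0 < 1 - e * t ∧ 0 < 1 - e * a) ∧
    1 - e * t ≤ (1 - e * a) * Real.exp (2 * (a - t)) ∧ 1 - e * a ≤ (1 - e * t) * Real.exp (2 * (a - t)) := by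
  obtain ⟨h1, h2⟩ := abs_le.1 he
  have hx := Real.add_one_le_exp (2 * (a - t))
  have b1 : 1 / 2 ≤ 1 - e * t := by nlinarith
  have b2 : 1 / 2 ≤ 1 - e * a := by nlinarith
  have hd : |e * (a - t)| ≤ a - t := by
    rw [abs_mul, abs_of_nonneg (show 0 ≤ a - t by linarith)]
    exact mul_le_of_le_one_left (by linarith) he
  obtain ⟨h3, h4⟩ := abs_le.1 hd
  refine ⟨⟨by linarith, by linarith⟩, ?_, ?_⟩
  · refine le_trans ?_ (mul_le_mul_of_nonneg_left hx (by linarith))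
    nlinarith
  · refine le_trans ?_ (mul_le_mul_of_nonneg_left hx (by linarith))
    nlinarith

lemma prime_t (d : ℝ) (hd : 0 < d) (p : ℕ) (hp : p.Prime) :
    0 ≤ (p : ℝ) ^ (-(1 + d)) ∧ (p : ℝ) ^ (-(1 + d)) ≤ 1 / p ∧ (1 : ℝ) / p ≤ 1 / 2 ∧
      1 / p - (p : ℝ) ^ (-(1 + d)) ≤ d * (Real.log p / p) := by
  have hp0 : (0 : ℝ) < p := by exact_mod_cast hp.pos
  have hp2 : (2 : ℝ) ≤ p := by exact_mod_cast hp.two_le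
  have e : (p : ℝ) ^ (-(1 + d)) = 1 / p * (p : ℝ) ^ (-d) := by
    rw [show -(1 + d) = -1 + -d by ring, Real.rpow_add hp0, Real.rpow_neg_one, one_div]
  have h1 : (p : ℝ) ^ (-d) ≤ 1 := Real.rpow_le_one_of_one_le_of_nonpos (by linarith) (by linarith)
  refine ⟨by positivity, ?_, ?_, ?_⟩
  · rw [e]; exact mul_le_of_le_one_right (by positivity) h1
  · exact one_div_le_one_div_of_le (by norm_num) hp2
  · rw [e, Real.rpow_def_of_pos hp0]
    have := Real.add_one_le_exp (Real.log p * -d)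
    have h2 : 1 / (p : ℝ) * (1 - Real.exp (Real.log p * -d)) ≤ 1 / (p : ℝ) * (d * Real.log p) := by
      gcongr; linarith
    calc _ = 1 / (p : ℝ) * (1 - Real.exp (Real.log p * -d)) := by ring
      _ ≤ _ := h2
      _ = _ := by ring

lemma head_compare (u : ℕ) (hu : 2 ≤ u) (e : ℕ → ℝ) (he : ∀ p, |e p| ≤ 1) :
    let d := 1 / Real.log u
    (∏ p ∈ PP u, (1 - e p * (p : ℝ) ^ (-(1 + d))) ≤ (∏ p ∈ PP u, (1 - e p * (1 / p))) * Real.exp 6) ∧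
    (∏ p ∈ PP u, (1 - e p * (1 / p)) ≤ (∏ p ∈ PP u, (1 - e p * (p : ℝ) ^ (-(1 + d)))) * Real.exp 6) := by
  intro d
  have hlu : Real.log 2 ≤ Real.log u := Real.log_le_log (by norm_num) (by exact_mod_cast hu)
  have hl2 := Real.log_pos (show (1 : ℝ) < 2 by norm_num)
  have hlu0 : 0 < Real.log u := by linarith
  have hd : 0 < d := by positivity
  have hsum : ∑ p ∈ PP u, 2 * (1 / (p : ℝ) - (p : ℝ) ^ (-(1 + d))) ≤ 6 := by
    have h1 := sum_log_div_le u (by omega)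
    have h4 : Real.log 4 = 2 * Real.log 2 := by
      rw [show (4 : ℝ) = 2 ^ 2 by norm_num, Real.log_pow]; norm_num
    have h2 : ∑ p ∈ PP u, (1 / (p : ℝ) - (p : ℝ) ^ (-(1 + d))) ≤ ∑ p ∈ PP u, d * (Real.log p / p) :=
      Finset.sum_le_sum (fun p hp => (prime_t d hd p (mem_PP.1 hp).2).2.2.2)
    rw [← Finset.mul_sum] at h2 ⊢
    have h3 : d * ∑ p ∈ PP u, Real.log p / p ≤ d * (3 * Real.log u) := by
      gcongr; linarith
    have h5 : d * (3 * Real.log u) = 3 := by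
      simp only [d]; field_simp
    linarith
  have hexp := Real.exp_le_exp.2 hsum
  rw [Real.exp_sum] at hexp
  have fc := fun p (hp : p ∈ PP u) =>
    factor_compare (e p) (1 / p) ((p : ℝ) ^ (-(1 + d))) (he p)
      (prime_t d hd p (mem_PP.1 hp).2).1 (prime_t d hd p (mem_PP.1 hp).2).2.1
      (prime_t d hd p (mem_PP.1 hp).2).2.2.1
  constructor
  · refine (Finset.prod_le_prod (fun p hp => (fc p hp).1.1.le) (fun p hp => (fc p hp).2.1)).trans ?_
    rw [Finset.prod_mul_distrib]
    exact mul_le_mul_of_nonneg_left hexp (Finset.prod_nonneg (fun p hp => (fc p hp).1.2.le))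
  · refine (Finset.prod_le_prod (fun p hp => (fc p hp).1.2.le) (fun p hp => (fc p hp).2.2)).trans ?_
    rw [Finset.prod_mul_distrib]
    exact mul_le_mul_of_nonneg_left hexp (Finset.prod_nonneg (fun p hp => (fc p hp).1.1.le))

lemma mertens_raw : ∃ C : ℝ, 1 ≤ C ∧ ∀ u : ℕ, 2 ≤ u →
    (∏ p ∈ PP u, (1 - X4 p * (1 / p)) ≤ C) ∧ (1 ≤ C * ∏ p ∈ PP u, (1 - X4 p * (1 / p))) ∧
    (1 ≤ C * Real.log u * ∏ p ∈ PP u, (1 - 1 / (p : ℝ))) := by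
  set K := Real.exp 6 with hK
  have hK1 : 1 ≤ K := Real.one_le_exp (by norm_num)
  refine ⟨5 * K ^ 2, by nlinarith, ?_⟩
  intro u hu
  have hlu : Real.log 2 ≤ Real.log u := Real.log_le_log (by norm_num) (by exact_mod_cast hu)
  have hl2 := Real.log_two_gt_d9
  have hlu0 : 0 < Real.log u := by linarith
  set d := 1 / Real.log u with hd_def
  have hd : 0 < d := by positivity
  have hdi : 1 / d = Real.log u := by simp [hd_def]
  set t : ℕ → ℝ := fun p => (p : ℝ) ^ (-(1 + d)) with ht
  obtain ⟨hz1, hz2⟩ := head_compare u hu (fun _ => 1) (by simp)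
  obtain ⟨hc1, hc2⟩ := head_compare u hu X4 X4_abs
  simp only [one_mul] at hz1 hz2
  have ht1 : ∀ p : ℕ, p.Prime → 0 ≤ t p ∧ t p ≤ 1 / 2 := fun p hp =>
    ⟨(prime_t d hd p hp).1, (prime_t d hd p hp).2.1.trans (prime_t d hd p hp).2.2.1⟩
  have hX : ∀ p : ℕ, p.Prime → 0 < 1 - X4 p * t p ∧ 1 - t p ≤ 1 - X4 p * t p ∧
      (1 - X4 p * t p) * (1 - t p) ≤ 1 := by
    intro p hp
    obtain ⟨h1, h2⟩ := ht1 p hp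
    obtain ⟨h3, h4⟩ := abs_le.1 (X4_abs p)
    refine ⟨by nlinarith, by nlinarith, ?_⟩
    have : 1 - X4 p * t p ≤ 1 + t p := by nlinarith
    nlinarith
  set Hz := ∏ p ∈ PP u, (1 - t p) with hHz
  set Hc := ∏ p ∈ PP u, (1 - X4 p * t p) with hHc
  have hHz0 : 0 < Hz := Finset.prod_pos (fun p hp => by
    have := ht1 p (mem_PP.1 hp).2; linarith)
  have hHc0 : 0 < Hc := Finset.prod_pos (fun p hp => (hX p (mem_PP.1 hp).2).1)
  -- Euler products
  have hne : (1 + d) ≠ 0 := by linarith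
  have E1 := EulerProduct.eulerProduct_completely_multiplicative (f := fz (1 + d) hne)
    (by
      simp only [fz_apply]
      exact (summable_fz (1 + d) (by linarith)).norm)
  have E2 := EulerProduct.eulerProduct_completely_multiplicative (f := fc (1 + d))
    (summable_fc (1 + d) (by linarith))
  simp only [fz_apply, fc_apply] at E1 E2
  have hzb := zeta_bound d hd
  rw [hdi] at hzb
  obtain ⟨hL1, hL2⟩ := L_bounds (1 + d) (by linarith)
  simp only [fc_apply] at hL1 hL2
  set L := ∑' n : ℕ, X4 n * (n : ℝ) ^ (-(1 + d))
  -- the tail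
  set tail : ℕ → Finset ℕ := fun n => (n.primesBelow).filter (fun p => u < p) with htail
  have hsplit : ∀ n, u + 1 ≤ n → ∀ f : ℕ → ℝ, ∏ p ∈ n.primesBelow, f p =
      (∏ p ∈ PP u, f p) * ∏ p ∈ tail n, f p := by
    intro n hn f
    rw [mul_comm, htail]
    simp only
    rw [← Finset.prod_filter_mul_prod_filter_not n.primesBelow (fun p => u < p)]
    congr 1
    apply Finset.prod_congr _ (fun _ _ => rfl)
    ext p
    simp only [Finset.mem_filter, Nat.mem_primesBelow, mem_PP]
    constructor
    · rintro ⟨⟨h1, h2⟩, h3⟩; exact ⟨by omega, h2⟩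
    · rintro ⟨h1, h2⟩; exact ⟨⟨by omega, h2⟩, by omega⟩
  have htp : ∀ n, ∀ p ∈ tail n, p.Prime := fun n p hp =>
    (Nat.mem_primesBelow.1 (Finset.mem_filter.1 hp).1).2
  set T : ℕ → ℝ := fun n => ∏ p ∈ tail n, (1 - t p) with hT
  have hT0 : ∀ n, 0 < T n := fun n => Finset.prod_pos (fun p hp => by
    have := ht1 p (htp n p hp); linarith)
  have hT1 : ∀ n, T n ≤ 1 := fun n => Finset.prod_le_one (fun p hp => by
    have := ht1 p (htp n p hp); linarith) (fun p hp => by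
    have := ht1 p (htp n p hp); linarith)
  have hTz : ∀ n, u + 1 ≤ n → 1 ≤ (1 + Real.log u) * (Hz * T n) := by
    intro n hn
    have h1 : ∏ p ∈ n.primesBelow, (1 - t p)⁻¹ ≤ 1 + Real.log u := by
      refine le_trans ?_ hzb
      refine Monotone.ge_of_tendsto ?_ E1 n
      intro a b hab
      have hp1 : ∀ p : ℕ, p.Prime → 1 ≤ (1 - t p)⁻¹ := fun p hp => by
        obtain ⟨h1, h2⟩ := ht1 p hp
        exact (one_le_inv₀ (by linarith)).2 (by linarith)
      apply Finset.prod_le_prod_of_subset_of_one_le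
      · intro p hp
        rw [Nat.mem_primesBelow] at hp ⊢
        exact ⟨by omega, hp.2⟩
      · intro p hp
        linarith [hp1 p (Nat.mem_primesBelow.1 hp).2]
      · intro p hp _
        exact hp1 p (Nat.mem_primesBelow.1 hp).2
    rw [Finset.prod_inv_distrib, hsplit n hn] at h1
    have h2 : 0 < Hz * T n := mul_pos hHz0 (hT0 n)
    have h3 : (Hz * T n)⁻¹ ≤ 1 + Real.log u := h1
    calc (1 : ℝ) = (Hz * T n)⁻¹ * (Hz * T n) := (inv_mul_cancel₀ h2.ne').symm
      _ ≤ _ := by gcongr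
  have hlow := log_mul_prod_le_one u (by omega)
  have hTl : ∀ n, u + 1 ≤ n → 1 ≤ 3 * K * T n := by
    intro n hn
    have h1 := hTz n hn
    have h2 : Real.log u * Hz ≤ K := by
      calc Real.log u * Hz ≤ Real.log u * ((∏ p ∈ PP u, (1 - 1 / (p : ℝ))) * K) := by gcongr
        _ = (Real.log u * ∏ p ∈ PP u, (1 - 1 / (p : ℝ))) * K := by ring
        _ ≤ 1 * K := by gcongr
        _ = K := one_mul _
    have h3 : (1 + Real.log u) * Hz ≤ 3 * K := by nlinarith
    calc 1 ≤ _ := h1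
      _ = ((1 + Real.log u) * Hz) * T n := by ring
      _ ≤ _ := by gcongr; exact (hT0 n).le
  -- character tail
  set Tc : ℕ → ℝ := fun n => ∏ p ∈ tail n, (1 - X4 p * t p) with hTc
  have hTc0 : ∀ n, 0 < Tc n := fun n => Finset.prod_pos (fun p hp => (hX p (htp n p hp)).1)
  have hTc1 : ∀ n, T n ≤ Tc n := fun n => Finset.prod_le_prod (fun p hp => by
    have := ht1 p (htp n p hp); linarith) (fun p hp => (hX p (htp n p hp)).2.1)
  have hTc2 : ∀ n, Tc n * T n ≤ 1 := fun n => by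
    rw [hTc, hT]; simp only
    rw [← Finset.prod_mul_distrib]
    exact Finset.prod_le_one (fun p hp => mul_nonneg (hX p (htp n p hp)).1.le (by
      have := ht1 p (htp n p hp); linarith)) (fun p hp => (hX p (htp n p hp)).2.2)
  have E2' : Tendsto (fun n => (Hc * Tc n)⁻¹) atTop (𝓝 L) := by
    refine E2.congr' ?_
    filter_upwards [eventually_ge_atTop (u + 1)] with n hn
    rw [Finset.prod_inv_distrib, hsplit n hn]
  have hHcL : 1 ≤ 3 * K * Hc * L ∧ Hc * L ≤ 3 * K := by
    constructor
    · refine ge_of_tendsto (E2'.const_mul (3 * K * Hc)) ?_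
      filter_upwards [eventually_ge_atTop (u + 1)] with n hn
      have h1 := hTl n hn
      have e : 3 * K * Hc * (Hc * Tc n)⁻¹ = 3 * K / Tc n := by
        have := hTc0 n; field_simp
      rw [e, le_div_iff₀ (hTc0 n)]
      have h2 := hTc2 n
      have := hTc0 n
      nlinarith [mul_le_mul_of_nonneg_left h1 this.le]
    · refine le_of_tendsto (E2'.const_mul Hc) ?_
      filter_upwards [eventually_ge_atTop (u + 1)] with n hn
      have h1 := hTl n hn
      have e : Hc * (Hc * Tc n)⁻¹ = 1 / Tc n := by
        have := hTc0 n; field_simp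
      rw [e, div_le_iff₀ (hTc0 n)]
      have h2 := hTc1 n
      nlinarith
  obtain ⟨hA, hB⟩ := hHcL
  set Pc := ∏ p ∈ PP u, (1 - X4 p * (1 / (p : ℝ))) with hPc
  have hc1' : Hc ≤ Pc * K := hc1
  have hc2' : Pc ≤ Hc * K := hc2
  have hz2' : Hz ≤ (∏ p ∈ PP u, (1 - 1 / (p : ℝ))) * K := hz1
  refine ⟨?_, ?_, ?_⟩
  · have : Hc ≤ 4.5 * K := by nlinarith
    nlinarith
  · have h1 : 1 ≤ 3 * K * Hc := by
      refine hA.trans ?_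
      exact mul_le_of_le_one_right (by positivity) hL2
    nlinarith
  · have h1 := hTz (u + 1) le_rfl
    have h2 : 1 ≤ (1 + Real.log u) * Hz := by
      refine h1.trans ?_
      have := hT1 (u + 1)
      gcongr
      exact mul_le_of_le_one_right hHz0.le this
    have h3 : 1 + Real.log u ≤ 3 * Real.log u := by linarith
    have h4 : 1 ≤ 3 * Real.log u * ((∏ p ∈ PP u, (1 - 1 / (p : ℝ))) * K) := by
      refine h2.trans ?_
      gcongr
    have h5 : 0 ≤ Real.log u * ∏ p ∈ PP u, (1 - 1 / (p : ℝ)) := by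
      apply mul_nonneg hlu0.le
      exact Finset.prod_nonneg (fun p hp => by
        have := (prime_t d hd p (mem_PP.1 hp).2).2.2.1
        linarith)
    set G := Real.log u * ∏ p ∈ PP u, (1 - 1 / (p : ℝ)) with hG
    have h6 : 1 ≤ G * (3 * K) := by
      calc (1 : ℝ) ≤ _ := h4
        _ = G * (3 * K) := by rw [hG]; ring
    calc (1 : ℝ) ≤ _ := h6
      _ ≤ G * (5 * K ^ 2) := mul_le_mul_of_nonneg_left (by nlinarith) h5
      _ = _ := by rw [hG]; ring

end VS

open Finset Filter Topology
namespace VS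

lemma PP_split (u : ℕ) (hu : 2 ≤ u) (f : ℕ → ℝ) :
    ∏ p ∈ PP u, f p = f 2 * ((∏ p ∈ Q 1 u, f p) * ∏ p ∈ Q 3 u, f p) := by
  have h : PP u = insert 2 (Q 1 u ∪ Q 3 u) := by
    ext p
    simp only [mem_PP, mem_insert, mem_union, mem_Q]
    constructor
    · rintro ⟨h1, h2⟩
      rcases h2.eq_two_or_odd with h | h
      · exact Or.inl h
      · have : p % 4 = 1 ∨ p % 4 = 3 := by omega
        tauto
    · rintro (h | h | h)
      · exact ⟨by omega, by rw [h]; exact Nat.prime_two⟩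
      · exact ⟨h.1, h.2.1⟩
      · exact ⟨h.1, h.2.1⟩
  rw [h, prod_insert, prod_union]
  · rw [disjoint_left]
    intro p h1 h2
    have := (mem_Q.1 h1).2.2
    have := (mem_Q.1 h2).2.2
    omega
  · simp [mem_Q]

lemma Q_inv {r u p : ℕ} (hp : p ∈ Q r u) : 0 < 1 / (p : ℝ) ∧ 1 / (p : ℝ) ≤ 1 / 2 := by
  have h2 := (mem_Q.1 hp).2.1.two_le
  have h2' : (2 : ℝ) ≤ p := by exact_mod_cast h2
  refine ⟨by positivity, ?_⟩
  exact one_div_le_one_div_of_le (by norm_num) h2'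

lemma prod_sq_half (u : ℕ) (hu : 2 ≤ u) : (1 / 2 : ℝ) ≤ ∏ p ∈ Q 3 u, (1 - (1 / (p : ℝ)) ^ 2) := by
  have h1 : ∀ u : ℕ, 1 ≤ u → ∏ n ∈ Icc 2 u, (1 - (1 / (n : ℝ)) ^ 2) = ((u : ℝ) + 1) / (2 * u) := by
    intro u hu
    induction u, hu using Nat.le_induction with
    | base => norm_num
    | succ k hk ih =>
      rw [Finset.prod_Icc_succ_top (by omega), ih]
      have : (0 : ℝ) < k := by exact_mod_cast hk
      push_cast
      field_simp
      ring
  have h2 : ∏ n ∈ Icc 2 u, (1 - (1 / (n : ℝ)) ^ 2) ≤ ∏ p ∈ Q 3 u, (1 - (1 / (p : ℝ)) ^ 2) := by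
    have h3 : ∀ n ∈ Icc 2 u, (0 : ℝ) ≤ 1 - (1 / (n : ℝ)) ^ 2 ∧ 1 - (1 / (n : ℝ)) ^ 2 ≤ 1 := by
      intro n hn
      have h4 : (2 : ℝ) ≤ n := by exact_mod_cast (mem_Icc.1 hn).1
      have h5 : 1 / (n : ℝ) ≤ 1 / 2 := one_div_le_one_div_of_le (by norm_num) h4
      have h6 : 0 ≤ 1 / (n : ℝ) := by positivity
      constructor <;> nlinarith
    apply Finset.prod_le_prod_of_subset_of_le_one
    · intro p hp
      obtain ⟨h1, h2, _⟩ := mem_Q.1 hp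
      exact mem_Icc.2 ⟨h2.two_le, h1⟩
    · exact fun n hn => (h3 n hn).1
    · exact fun n hn _ => (h3 n hn).2
  refine le_trans ?_ h2
  rw [h1 u (by omega)]
  have : (0 : ℝ) < u := by exact_mod_cast (by omega : 0 < u)
  rw [div_le_div_iff₀ (by norm_num) (by positivity)]
  linarith

lemma mertens4 : ∃ C : ℝ, 1 ≤ C ∧ ∀ u : ℕ, 2 ≤ u →
    (1 ≤ C * √(Real.log u) * ∏ p ∈ Q 1 u, (1 - 1 / (p : ℝ))) ∧
    (1 ≤ C * √(Real.log u) * ∏ p ∈ Q 3 u, (1 - 1 / (p : ℝ))) ∧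
    (√(Real.log u) ≤ C * ∏ p ∈ Q 3 u, (1 + 1 / (p : ℝ))) := by
  obtain ⟨C, hC1, hC⟩ := mertens_raw
  refine ⟨2 * C, by linarith, ?_⟩
  intro u hu
  obtain ⟨a1, a2, a3⟩ := hC u hu
  have a4 := log_mul_prod_le_one u (by omega)
  have a5 := prod_sq_half u hu
  have hL : 0 ≤ Real.log u := Real.log_natCast_nonneg u
  set L := √(Real.log u) with hLdef
  have hL2 : L ^ 2 = Real.log u := Real.sq_sqrt hL
  have hL0 : 0 ≤ L := Real.sqrt_nonneg _
  rw [PP_split u hu] at a1 a2 a3 a4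
  set P1 := ∏ p ∈ Q 1 u, (1 - 1 / (p : ℝ)) with hP1
  set P3 := ∏ p ∈ Q 3 u, (1 - 1 / (p : ℝ)) with hP3
  set R3 := ∏ p ∈ Q 3 u, (1 + 1 / (p : ℝ)) with hR3
  have e1 : ∏ p ∈ Q 1 u, (1 - X4 p * (1 / (p : ℝ))) = P1 := by
    apply prod_congr rfl
    intro p hp
    have := (mem_Q.1 hp).2.2
    rw [X4_eq, if_neg (by omega), if_pos this, one_mul]
  have e3 : ∏ p ∈ Q 3 u, (1 - X4 p * (1 / (p : ℝ))) = R3 := by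
    apply prod_congr rfl
    intro p hp
    have := (mem_Q.1 hp).2.2
    rw [X4_eq, if_neg (by omega), if_neg (by omega)]; ring
  have e5 : ∏ p ∈ Q 3 u, (1 - (1 / (p : ℝ)) ^ 2) = P3 * R3 := by
    rw [hP3, hR3, ← prod_mul_distrib]
    apply prod_congr rfl
    intro p hp; ring
  have e6 : P3 * R3 ≤ 1 := by
    rw [← e5]
    apply prod_le_one
    · intro p hp
      have := Q_inv hp
      nlinarith
    · intro p hp
      have := Q_inv hp
      nlinarith
  have x2 : X4 2 = 0 := by rw [X4_eq]; simp
  rw [e1, e3, x2] at a1 a2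
  rw [e5] at a5
  rw [← hL2] at a3 a4
  norm_num at a1 a2 a3 a4
  have p1 : 0 < P1 := prod_pos (fun p hp => by have := Q_inv hp; linarith)
  have p3 : 0 < P3 := prod_pos (fun p hp => by have := Q_inv hp; linarith)
  have r3 : 0 < R3 := prod_pos (fun p hp => by have := Q_inv hp; linarith)
  have hC0 : 0 < C := by linarith
  refine ⟨?_, ?_, ?_⟩
  · have : 1 ≤ (2 * C * L * P1) ^ 2 := by
      have h1 : 1 * 1 ≤ (C * L ^ 2 * (1 / 2 * (P1 * P3))) * (C * (P1 * R3)) := by gcongr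
      have h2 : (C * L ^ 2 * (1 / 2 * (P1 * P3))) * (C * (P1 * R3)) =
        (C * L * P1) ^ 2 / 2 * (P3 * R3) := by ring
      have h3 : (C * L * P1) ^ 2 / 2 * (P3 * R3) ≤ (C * L * P1) ^ 2 / 2 * 1 := by gcongr
      nlinarith
    exact (one_le_sq_iff₀ (by positivity)).1 this
  · have : 1 ≤ (2 * C * L * P3) ^ 2 := by
      have h1 : 1 ≤ (C * L ^ 2 * (1 / 2 * (P1 * P3))) * (2 * (P3 * R3)) := by nlinarith
      have h2 : (C * L ^ 2 * (1 / 2 * (P1 * P3))) * (2 * (P3 * R3)) =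
        C * (L * P3) ^ 2 * (P1 * R3) := by ring
      have h3 : C * (L * P3) ^ 2 * (P1 * R3) ≤ C * (L * P3) ^ 2 * C := by gcongr
      nlinarith [sq_nonneg (C * (L * P3))]
    exact (one_le_sq_iff₀ (by positivity)).1 this
  · have : L ^ 2 ≤ (2 * C * R3) ^ 2 := by
      have h0 : 1 * 1 ≤ C * (P1 * R3) * (2 * (P3 * R3)) := by
        apply mul_le_mul a2 (by linarith) (by norm_num) (by positivity)
      have h1 : L ^ 2 * 1 ≤ L ^ 2 * (C * (P1 * R3) * (2 * (P3 * R3))) :=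
        mul_le_mul_of_nonneg_left (by linarith) (by positivity)
      have h2 : L ^ 2 * (C * (P1 * R3) * (2 * (P3 * R3))) =
        4 * C * R3 ^ 2 * (L ^ 2 * (1 / 2 * (P1 * P3))) := by ring
      have h3 : 4 * C * R3 ^ 2 * (L ^ 2 * (1 / 2 * (P1 * P3))) ≤ 4 * C * R3 ^ 2 * 1 := by gcongr
      have h4 : 4 * C * R3 ^ 2 ≤ 4 * C ^ 2 * R3 ^ 2 := by gcongr; exact le_self_pow₀ hC1 (by norm_num)
      linarith [h1, h2, h3, h4, (by ring : (2 * C * R3) ^ 2 = 4 * C ^ 2 * R3 ^ 2)]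
    exact (pow_le_pow_iff_left₀ hL0 (by positivity) (by norm_num)).1 this

/-- integers up to `v` all of whose prime factors are `1 mod 4` -/
def M1 (v : ℕ) : Finset ℕ := (Icc 1 v).filter (fun m => ∀ p ∈ m.primeFactors, p % 4 = 1)

lemma mem_M1 {v m : ℕ} : m ∈ M1 v ↔ (1 ≤ m ∧ m ≤ v) ∧ ∀ p : ℕ, p.Prime → p ∣ m → p % 4 = 1 := by
  simp only [M1, mem_filter, mem_Icc, Nat.mem_primeFactors]
  constructor
  · rintro ⟨h1, h2⟩
    exact ⟨h1, fun p hp hd => h2 p ⟨hp, hd, by omega⟩⟩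
  · rintro ⟨h1, h2⟩
    exact ⟨h1, fun p hp => h2 p hp.1 hp.2.1⟩

open Classical in
lemma sum_M1 : ∃ c : ℝ, 0 < c ∧ ∀ v : ℕ, 2 ≤ v → c * √(Real.log v) ≤ ∑ m ∈ M1 v, (1 : ℝ) / m := by
  obtain ⟨C, hC1, hC⟩ := mertens4
  have hC0 : 0 < C := by linarith
  refine ⟨1 / (2 * C), by positivity, ?_⟩
  intro v hv
  obtain ⟨-, h3, -⟩ := hC v hv
  have h2 : (2 : ℕ) ∉ Q 3 v := by simp [mem_Q]
  have h4 := harm_coprime v (insert 2 (Q 3 v)) (by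
    intro p hp
    rcases mem_insert.1 hp with h | h
    · rw [h]; exact Nat.prime_two
    · exact (mem_Q.1 h).2.1)
  rw [prod_insert h2] at h4
  have h5 := log_le_harm v (by omega)
  have e : (Icc 1 v).filter (fun m : ℕ => ∀ p ∈ (insert 2 (Q 3 v) : Finset ℕ), ¬ p ∣ m) = M1 v := by
    ext m
    simp only [mem_M1, mem_filter, mem_Icc]
    constructor
    · rintro ⟨h1, h2⟩
      refine ⟨h1, ?_⟩
      intro p hp hpm
      by_contra hne
      refine h2 p ?_ hpm
      rcases hp.eq_two_or_odd with h | h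
      · simp [h]
      · refine mem_insert_of_mem (mem_Q.2 ⟨(Nat.le_of_dvd (by omega) hpm).trans h1.2, hp, by omega⟩)
    · rintro ⟨h1, h2⟩
      refine ⟨h1, ?_⟩
      intro p hp hpm
      rcases mem_insert.1 hp with h | h
      · have := h2 2 Nat.prime_two (h ▸ hpm); omega
      · have := h2 p (mem_Q.1 h).2.1 hpm
        have := (mem_Q.1 h).2.2
        omega
  have e2 : ∀ f : ℕ → ℝ, ∑ m ∈ M1 v, f m = ∑ m ∈ (Icc 1 v).filter (fun m : ℕ => ∀ p ∈ (insert 2 (Q 3 v) : Finset ℕ), ¬ p ∣ m), f m := by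
    intro f; rw [e]
  rw [e2]
  refine le_trans ?_ (h4.trans (le_of_eq (by congr!)))
  have hL : 0 ≤ Real.log v := Real.log_natCast_nonneg v
  set L := √(Real.log v) with hLdef
  have hL2 : L ^ 2 = Real.log v := Real.sq_sqrt hL
  have hL0 : 0 ≤ L := Real.sqrt_nonneg _
  set P3 := ∏ p ∈ Q 3 v, (1 - 1 / (p : ℝ)) with hP3
  have p3 : 0 < P3 := prod_pos (fun p hp => by have := Q_inv hp; linarith)
  have h6 : L ^ 2 * ((1 / 2) * P3) ≤ (∑ m ∈ Icc 1 v, (1 : ℝ) / m) * ((1 - 1 / (2 : ℕ)) * P3) := by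
    norm_num
    gcongr
    simpa [hL2] using h5
  refine le_trans ?_ h6
  rw [div_mul_eq_mul_div, div_le_iff₀ (by positivity)]
  nlinarith

end VS

open Finset Filter Topology
namespace VS

/-- elementary symmetric sums -/
def es (r : ℕ) (S : Finset ℕ) (g : ℕ → ℝ) : ℝ := ∑ T ∈ powersetCard r S, ∏ p ∈ T, g p
/-- truncated inclusion-exclusion -/
def UU (r : ℕ) (S : Finset ℕ) (g : ℕ → ℝ) : ℝ := ∑ j ∈ range (r + 1), (-1) ^ j * es j S g

lemma es_zero (S : Finset ℕ) (g : ℕ → ℝ) : es 0 S g = 1 := by simp [es]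
lemma es_empty (r : ℕ) (g : ℕ → ℝ) : es (r + 1) ∅ g = 0 := by
  rw [es, powersetCard_eq_empty.2 (by simp)]; simp

lemma es_insert (r : ℕ) (S : Finset ℕ) (g : ℕ → ℝ) (p : ℕ) (hp : p ∉ S) :
    es (r + 1) (insert p S) g = es (r + 1) S g + g p * es r S g := by
  unfold es
  rw [powersetCard_succ_insert hp, sum_union]
  · congr 1
    rw [sum_image, mul_sum]
    · apply sum_congr rfl
      intro T hT
      rw [prod_insert]
      exact fun h => hp ((mem_powersetCard.1 hT).1 h)
    · intro T hT T' hT' h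
      have h1 : p ∉ T := fun h => hp ((mem_powersetCard.1 hT).1 h)
      have h2 : p ∉ T' := fun h => hp ((mem_powersetCard.1 hT').1 h)
      rw [← erase_insert h1, ← erase_insert h2, h]
  · rw [disjoint_left]
    intro T hT hT'
    obtain ⟨T', _, rfl⟩ := mem_image.1 hT'
    exact hp ((mem_powersetCard.1 hT).1 (mem_insert_self _ _))

lemma UU_zero (S : Finset ℕ) (g : ℕ → ℝ) : UU 0 S g = 1 := by simp [UU, es_zero]

lemma UU_insert (r : ℕ) (S : Finset ℕ) (g : ℕ → ℝ) (p : ℕ) (hp : p ∉ S) :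
    UU (r + 1) (insert p S) g = UU (r + 1) S g - g p * UU r S g := by
  unfold UU
  rw [sum_range_succ', sum_range_succ' (fun j => (-1) ^ j * es j S g), mul_sum]
  simp only [es_zero, es_insert _ S g p hp]
  have : ∀ a b c : ℝ, a = b - c → a + (-1) ^ 0 * 1 = b + (-1) ^ 0 * 1 - c := by
    intro a b c h; rw [h]; ring
  apply this
  rw [← sum_sub_distrib]
  apply sum_congr rfl
  intro j _
  ring

lemma es_nonneg (r : ℕ) (S : Finset ℕ) (g : ℕ → ℝ) (hg : ∀ p ∈ S, 0 ≤ g p) : 0 ≤ es r S g :=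
  sum_nonneg (fun T hT => prod_nonneg (fun p hp => hg p ((mem_powersetCard.1 hT).1 hp)))

lemma bern (s g : ℝ) (hs : 0 ≤ s) (hg : 0 ≤ g) (r : ℕ) :
    s ^ (r + 1) + (r + 1) * g * s ^ r ≤ (s + g) ^ (r + 1) := by
  induction r with
  | zero => simp
  | succ r ih =>
    have h1 : s ^ (r + 1) ≤ (s + g) ^ (r + 1) := by gcongr; linarith
    have h2 := mul_le_mul_of_nonneg_right ih hs
    have h3 := mul_le_mul_of_nonneg_right h1 hg
    have e : (s + g) ^ (r + 1 + 1) = (s + g) ^ (r + 1) * s + (s + g) ^ (r + 1) * g := by ring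
    rw [e]
    push_cast
    have e2 : s ^ (r + 1 + 1) + ((r : ℝ) + 1 + 1) * g * s ^ (r + 1) =
      (s ^ (r + 1) + (r + 1) * g * s ^ r) * s + s ^ (r + 1) * g := by ring
    rw [e2]; linarith

lemma es_le (r : ℕ) (S : Finset ℕ) (g : ℕ → ℝ) (hg : ∀ p ∈ S, 0 ≤ g p) :
    es r S g ≤ (∑ p ∈ S, g p) ^ r / r.factorial := by
  induction S using Finset.induction_on generalizing r with
  | empty =>
    cases r with
    | zero => simp [es_zero]
    | succ r => simp [es_empty]
  | insert p S hp ih =>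
    have hS : ∀ q ∈ S, 0 ≤ g q := fun q hq => hg q (mem_insert_of_mem hq)
    have hgp := hg p (mem_insert_self _ _)
    cases r with
    | zero => simp [es_zero]
    | succ r =>
      rw [es_insert _ _ _ _ hp, sum_insert hp]
      have h1 := ih (r + 1) hS
      have h2 := ih r hS
      have h3 := bern (∑ p ∈ S, g p) (g p) (sum_nonneg hS) hgp r
      rw [add_comm (g p)]
      have hf : (0 : ℝ) < r.factorial := by exact_mod_cast Nat.factorial_pos r
      have h4 : ((r + 1).factorial : ℝ) = (r + 1) * r.factorial := by
        rw [Nat.factorial_succ]; push_cast; ring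
      have h5 := mul_le_mul_of_nonneg_left h2 hgp
      rw [h4] at h1 ⊢
      set s := ∑ p ∈ S, g p
      calc es (r + 1) S g + g p * es r S g ≤
          s ^ (r + 1) / ((r + 1) * r.factorial) + g p * (s ^ r / r.factorial) := by linarith
        _ = (s ^ (r + 1) + (r + 1) * g p * s ^ r) / ((r + 1) * r.factorial) := by
          have : (0 : ℝ) < r + 1 := by positivity
          field_simp
        _ ≤ _ := by gcongr

lemma bonf (r : ℕ) (S : Finset ℕ) (g : ℕ → ℝ) (hg : ∀ p ∈ S, 0 ≤ g p ∧ g p ≤ 1) :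
    0 ≤ (-1) ^ r * (UU r S g - ∏ p ∈ S, (1 - g p)) ∧
      (-1) ^ r * (UU r S g - ∏ p ∈ S, (1 - g p)) ≤ es (r + 1) S g := by
  induction S using Finset.induction_on generalizing r with
  | empty =>
    have : UU r ∅ g = 1 := by
      rw [UU, sum_range_succ']
      simp [es_empty, es_zero]
    simp [this, es_empty]
  | insert p S hp ih =>
    have hS : ∀ q ∈ S, 0 ≤ g q ∧ g q ≤ 1 := fun q hq => hg q (mem_insert_of_mem hq)
    obtain ⟨h0, h1⟩ := hg p (mem_insert_self _ _)
    have ih' := fun r => ih r hS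
    rw [prod_insert hp]
    have hV0 : 0 ≤ ∏ p ∈ S, (1 - g p) := prod_nonneg (fun q hq => by linarith [(hS q hq).2])
    have hV1 : ∏ p ∈ S, (1 - g p) ≤ 1 := prod_le_one (fun q hq => by linarith [(hS q hq).2])
      (fun q hq => by linarith [(hS q hq).1])
    rw [es_insert _ _ _ _ hp]
    cases r with
    | zero =>
      have := ih' 0
      simp only [UU_zero, es_zero] at this ⊢
      constructor <;> nlinarith
    | succ r =>
      rw [UU_insert _ _ _ _ hp]
      obtain ⟨a1, a2⟩ := ih' (r + 1)
      obtain ⟨b1, b2⟩ := ih' r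
      set V := ∏ p ∈ S, (1 - g p)
      have e : (-1) ^ (r + 1) * (UU (r + 1) S g - g p * UU r S g - (1 - g p) * V) =
        (-1) ^ (r + 1) * (UU (r + 1) S g - V) + g p * ((-1) ^ r * (UU r S g - V)) := by ring
      rw [e]
      have := mul_nonneg h0 b1
      have := mul_le_mul_of_nonneg_left b2 h0
      constructor <;> linarith

lemma bonf_even (b : ℕ) (S : Finset ℕ) (g : ℕ → ℝ) (hg : ∀ p ∈ S, 0 ≤ g p ∧ g p ≤ 1) :
    ∏ p ∈ S, (1 - g p) ≤ UU (2 * b) S g ∧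
      UU (2 * b) S g - ∏ p ∈ S, (1 - g p) ≤ es (2 * b + 1) S g := by
  have := bonf (2 * b) S g hg
  rw [pow_mul] at this
  norm_num at this
  constructor <;> linarith [this.1, this.2]

lemma UU_abs (r : ℕ) (S : Finset ℕ) (g : ℕ → ℝ) (hg : ∀ p ∈ S, 0 ≤ g p) (N : ℝ)
    (hN : ∑ p ∈ S, g p ≤ N) : UU r S g ≤ (1 + N) ^ r := by
  have h0 : 0 ≤ ∑ p ∈ S, g p := sum_nonneg hg
  have h1 : ∀ j, (-1) ^ j * es j S g ≤ N ^ j := by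
    intro j
    have h2 := es_nonneg j S g hg
    have h3 := es_le j S g hg
    have h4 : (∑ p ∈ S, g p) ^ j / j.factorial ≤ N ^ j := by
      calc (∑ p ∈ S, g p) ^ j / j.factorial ≤ (∑ p ∈ S, g p) ^ j := by
            apply div_le_self (by positivity)
            exact_mod_cast Nat.factorial_pos j
        _ ≤ N ^ j := by gcongr
    rcases neg_one_pow_eq_or ℝ j with h | h <;> rw [h] <;> linarith
  have hN0 : 0 ≤ N := h0.trans hN
  have h2 : ∀ r : ℕ, ∑ j ∈ range (r + 1), N ^ j ≤ (1 + N) ^ r := by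
    intro r
    induction r with
    | zero => simp
    | succ r ih =>
      rw [sum_range_succ, pow_succ (1 + N)]
      have : N ^ r ≤ (1 + N) ^ r := by gcongr; linarith
      have := mul_le_mul_of_nonneg_right this hN0
      rw [pow_succ]
      linarith
  exact (sum_le_sum (fun j _ => h1 j)).trans (h2 r)

lemma one_sub_ge_exp (g : ℝ) (h0 : 0 ≤ g) (h1 : g ≤ 1 / 2) : Real.exp (-2 * g) ≤ 1 - g := by
  have h2 := Real.add_one_le_exp (2 * g)
  rw [show -2 * g = -(2 * g) by ring, Real.exp_neg]
  have : (Real.exp (2 * g))⁻¹ ≤ (2 * g + 1)⁻¹ := inv_anti₀ (by linarith) h2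
  refine this.trans ?_
  rw [inv_le_iff_one_le_mul₀ (by linarith)]
  nlinarith

/-- the block estimate -/
lemma block_est (S : Finset ℕ) (g : ℕ → ℝ) (κ t : ℝ) (hκ : 0 ≤ κ) (ht : 0 ≤ t) (b : ℕ)
    (hb : 40 * (κ + t) ≤ b)
    (hg : ∀ p ∈ S, 0 ≤ g p ∧ g p ≤ 1 / 2) (hs : ∑ p ∈ S, g p ≤ 8 * κ) :
    es (2 * b + 1) S g ≤ Real.exp (-80 * t) * ∏ p ∈ S, (1 - g p) := by
  have hg0 : ∀ p ∈ S, 0 ≤ g p := fun p hp => (hg p hp).1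
  have h0 := sum_nonneg hg0
  set s := ∑ p ∈ S, g p with hsdef
  have h1 : Real.exp (-16 * κ) ≤ ∏ p ∈ S, (1 - g p) := by
    calc Real.exp (-16 * κ) ≤ Real.exp (∑ p ∈ S, -2 * g p) := by
          rw [← mul_sum]
          apply Real.exp_le_exp.2; linarith
      _ = ∏ p ∈ S, Real.exp (-2 * g p) := Real.exp_sum _ _
      _ ≤ _ := prod_le_prod (fun p _ => (Real.exp_pos _).le)
          (fun p hp => one_sub_ge_exp _ (hg p hp).1 (hg p hp).2)
  have h2 := es_le (2 * b + 1) S g hg0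
  have h3 := Real.pow_div_factorial_le_exp (s * Real.exp 1) (by positivity) (2 * b + 1)
  have h4 : s ^ (2 * b + 1) / (2 * b + 1).factorial =
      (s * Real.exp 1) ^ (2 * b + 1) / (2 * b + 1).factorial * Real.exp (-((2 * b + 1 : ℕ) : ℝ)) := by
    rw [mul_pow, ← Real.exp_nat_mul, mul_one, Real.exp_neg]
    field_simp
  have he := Real.exp_one_lt_d9
  calc es (2 * b + 1) S g ≤ _ := h2
    _ = _ := h4
    _ ≤ Real.exp (s * Real.exp 1) * Real.exp (-((2 * b + 1 : ℕ) : ℝ)) := by gcongr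
    _ = Real.exp (s * Real.exp 1 + -((2 * b + 1 : ℕ) : ℝ)) := (Real.exp_add _ _).symm
    _ ≤ Real.exp (-80 * t + -16 * κ) := by
      apply Real.exp_le_exp.2
      push_cast
      have : s * Real.exp 1 ≤ (8 * κ) * 3 := by
        apply mul_le_mul hs (by linarith) (Real.exp_pos _).le (by positivity)
      linarith
    _ = Real.exp (-80 * t) * Real.exp (-16 * κ) := Real.exp_add _ _
    _ ≤ _ := by gcongr

/-- Brun-Hooley combination -/
lemma brun_hooley (n : ℕ) (x y : ℕ → ℝ) (h0 : ∀ i, i < n → 0 ≤ x i) (h1 : ∀ i, i < n → x i ≤ y i) :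
    ∏ i ∈ range n, y i - ∑ l ∈ range n, (y l - x l) * ∏ i ∈ (range n).erase l, y i ≤
      ∏ i ∈ range n, x i := by
  induction n with
  | zero => simp
  | succ n ih =>
    have ih' := ih (fun i hi => h0 i (by omega)) (fun i hi => h1 i (by omega))
    have hy : 0 ≤ y n := (h0 n (by omega)).trans (h1 n (by omega))
    rw [prod_range_succ, prod_range_succ, sum_range_succ]
    have e1 : (range (n + 1)).erase n = range n := by
      ext i; simp; omega
    have e2 : ∀ l ∈ range n, (y l - x l) * ∏ i ∈ (range (n + 1)).erase l, y i =
        ((y l - x l) * ∏ i ∈ (range n).erase l, y i) * y n := by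
      intro l hl
      have hl' := mem_range.1 hl
      have : (range (n + 1)).erase l = insert n ((range n).erase l) := by
        ext i; simp; omega
      rw [this, prod_insert (by simp)]
      ring
    rw [e1, sum_congr rfl e2, ← sum_mul]
    have h3 := mul_le_mul_of_nonneg_right ih' hy
    have h4 : ∏ i ∈ range n, x i ≤ ∏ i ∈ range n, y i :=
      prod_le_prod (fun i hi => h0 i (by have := mem_range.1 hi; omega))
        (fun i hi => h1 i (by have := mem_range.1 hi; omega))
    have h5 := h1 n (by omega)
    nlinarith
end VS

open Finset Filter Topology
namespace VS

/-- `G` is a signed combination of at most `D` monomials over square-free `T ⊆ S`, `∏ T ≤ D` -/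
def Poly (S : Finset ℕ) (D : ℕ) (G : (ℕ → ℝ) → ℝ) : Prop :=
  ∃ (ι : Type) (_ : Fintype ι) (c : ι → ℝ) (T : ι → Finset ℕ),
    Fintype.card ι ≤ D ∧ (∀ i, |c i| ≤ 1) ∧ (∀ i, T i ⊆ S ∧ ∏ p ∈ T i, p ≤ D) ∧
      ∀ e, G e = ∑ i, c i * ∏ p ∈ T i, e p

lemma Poly.one : Poly ∅ 1 (fun _ => 1) :=
  ⟨Unit, inferInstance, fun _ => 1, fun _ => ∅, by simp, by simp, by simp, by simp⟩

lemma Poly.mul {S S' : Finset ℕ} {D D' : ℕ} {G G' : (ℕ → ℝ) → ℝ} (h : Poly S D G)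
    (h' : Poly S' D' G') (hd : Disjoint S S') : Poly (S ∪ S') (D * D') (fun e => G e * G' e) := by
  obtain ⟨ι, _, c, T, h1, h2, h3, h4⟩ := h
  obtain ⟨ι', _, c', T', h1', h2', h3', h4'⟩ := h'
  have hdd : ∀ i j, Disjoint (T i) (T' j) := fun i j =>
    disjoint_of_subset_left (h3 i).1 (disjoint_of_subset_right (h3' j).1 hd)
  refine ⟨ι × ι', inferInstance, fun i => c i.1 * c' i.2, fun i => T i.1 ∪ T' i.2, ?_, ?_, ?_, ?_⟩
  · rw [Fintype.card_prod]; exact Nat.mul_le_mul h1 h1'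
  · intro i
    rw [abs_mul]
    exact mul_le_one₀ (h2 _) (abs_nonneg _) (h2' _)
  · intro i
    refine ⟨union_subset_union (h3 _).1 (h3' _).1, ?_⟩
    rw [prod_union (hdd _ _)]
    exact Nat.mul_le_mul (h3 _).2 (h3' _).2
  · intro e
    show G e * G' e = _
    rw [h4, h4', Fintype.sum_mul_sum, Fintype.sum_prod_type]
    apply sum_congr rfl; intro i _
    apply sum_congr rfl; intro j _
    rw [prod_union (hdd _ _)]
    ring

lemma Poly.mono {S S' : Finset ℕ} {D D' : ℕ} {G : (ℕ → ℝ) → ℝ} (h : Poly S D G)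
    (hS : S ⊆ S') (hD : D ≤ D') : Poly S' D' G := by
  obtain ⟨ι, _, c, T, h1, h2, h3, h4⟩ := h
  exact ⟨ι, _, c, T, h1.trans hD, h2, fun i => ⟨(h3 i).1.trans hS, (h3 i).2.trans hD⟩, h4⟩

lemma Poly.prod (n : ℕ) (S : ℕ → Finset ℕ) (D : ℕ → ℕ) (G : ℕ → (ℕ → ℝ) → ℝ)
    (h : ∀ i, i < n → Poly (S i) (D i) (G i)) (hd : ∀ i j, i ≠ j → Disjoint (S i) (S j)) :
    Poly ((range n).biUnion S) (∏ i ∈ range n, D i) (fun e => ∏ i ∈ range n, G i e) := by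
  induction n with
  | zero => simpa using Poly.one
  | succ n ih =>
    have := (ih (fun i hi => h i (by omega))).mul (h n (by omega)) (by
      rw [disjoint_biUnion_left]
      intro i hi
      exact hd i n (by have := mem_range.1 hi; omega))
    rw [range_add_one, biUnion_insert, union_comm, prod_insert (by simp), mul_comm (D n)]
    convert this using 2 with e
    rw [prod_insert (by simp), mul_comm]

lemma Poly.eval {S : Finset ℕ} {D : ℕ} {G : (ℕ → ℝ) → ℝ} (h : Poly S D G) {α : Type*}
    (Ω : Finset α) (e : α → ℕ → ℝ) (g : ℕ → ℝ) (N R : ℝ) (hR0 : 0 ≤ R)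
    (hR : ∀ T ⊆ S, ∏ p ∈ T, p ≤ D → |∑ ω ∈ Ω, ∏ p ∈ T, e ω p - N * ∏ p ∈ T, g p| ≤ R) :
    |∑ ω ∈ Ω, G (e ω) - N * G g| ≤ D * R := by
  obtain ⟨ι, _, c, T, h1, h2, h3, h4⟩ := h
  have e1 : ∑ ω ∈ Ω, G (e ω) - N * G g =
      ∑ i, c i * (∑ ω ∈ Ω, ∏ p ∈ T i, e ω p - N * ∏ p ∈ T i, g p) := by
    simp only [h4]
    rw [sum_comm, mul_sum, ← sum_sub_distrib]
    apply sum_congr rfl; intro i _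
    rw [← mul_sum]; ring
  rw [e1]
  calc |∑ i, c i * (∑ ω ∈ Ω, ∏ p ∈ T i, e ω p - N * ∏ p ∈ T i, g p)|
      ≤ ∑ i, |c i * (∑ ω ∈ Ω, ∏ p ∈ T i, e ω p - N * ∏ p ∈ T i, g p)| := abs_sum_le_sum_abs _ _
    _ ≤ ∑ i : ι, R := by
      apply sum_le_sum; intro i _
      rw [abs_mul]
      calc _ ≤ 1 * R := mul_le_mul (h2 i) (hR _ (h3 i).1 (h3 i).2) (abs_nonneg _) (by norm_num)
        _ = R := one_mul _
    _ = Fintype.card ι * R := by simp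
    _ ≤ D * R := by gcongr

/-- polynomials given by a family of subsets -/
lemma Poly.family (S : Finset ℕ) (hS : ∀ p ∈ S, p.Prime) (𝒯 : Finset (Finset ℕ)) (B r : ℕ)
    (hB : 1 ≤ B) (hSB : ∀ p ∈ S, p ≤ B) (h𝒯 : ∀ T ∈ 𝒯, T ⊆ S ∧ T.card ≤ r) (c : Finset ℕ → ℝ)
    (hc : ∀ T, |c T| ≤ 1) : Poly S (B ^ r) (fun e => ∑ T ∈ 𝒯, c T * ∏ p ∈ T, e p) := by
  have hT : ∀ T ∈ 𝒯, ∏ p ∈ T, p ≤ B ^ r := by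
    intro T hT
    calc ∏ p ∈ T, p ≤ ∏ p ∈ T, B := prod_le_prod' (fun p hp => hSB p ((h𝒯 T hT).1 hp))
      _ = B ^ T.card := by simp
      _ ≤ B ^ r := Nat.pow_le_pow_right hB (h𝒯 T hT).2
  refine ⟨𝒯, inferInstance, fun T => c T, fun T => T, ?_, fun T => hc _, ?_, ?_⟩
  · rw [Fintype.card_coe]
    have : 𝒯.card ≤ (Icc 1 (B ^ r)).card := by
      apply card_le_card_of_injOn (fun T => ∏ p ∈ T, p)
      · intro T hT'
        have := hT T hT'
        simp only [coe_Icc, Set.mem_Icc]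
        exact ⟨Nat.one_le_iff_ne_zero.2 (prod_ne_zero_iff.2 (fun p hp =>
          (hS p ((h𝒯 T hT').1 hp)).ne_zero)), this⟩
      · intro T h1 T' h2 h
        have a1 := Nat.primeFactors_prod (s := T) (fun p hp => hS p ((h𝒯 T h1).1 hp))
        have a2 := Nat.primeFactors_prod (s := T') (fun p hp => hS p ((h𝒯 T' h2).1 hp))
        rw [← a1, ← a2]
        exact congrArg _ h
    simpa using this
  · intro T
    exact ⟨(h𝒯 T T.2).1, hT T T.2⟩
  · intro e
    exact (sum_coe_sort 𝒯 (fun T => c T * ∏ p ∈ T, e p)).symm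

lemma Poly.es (S : Finset ℕ) (hS : ∀ p ∈ S, p.Prime) (B r r' : ℕ) (hB : 1 ≤ B)
    (hSB : ∀ p ∈ S, p ≤ B) (hr : r ≤ r') : Poly S (B ^ r') (VS.es r S) := by
  have := Poly.family S hS (powersetCard r S) B r' hB hSB (by
    intro T hT; have := mem_powersetCard.1 hT; exact ⟨this.1, by omega⟩) (fun _ => 1) (by simp)
  convert this using 2 with e
  simp [VS.es]

lemma Poly.UU (S : Finset ℕ) (hS : ∀ p ∈ S, p.Prime) (B r r' : ℕ) (hB : 1 ≤ B)
    (hSB : ∀ p ∈ S, p ≤ B) (hr : r ≤ r') : Poly S (B ^ r') (VS.UU r S) := by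
  have := Poly.family S hS ((range (r + 1)).biUnion (fun j => powersetCard j S)) B r' hB hSB (by
    intro T hT
    obtain ⟨j, hj, hT⟩ := mem_biUnion.1 hT
    have := mem_powersetCard.1 hT
    have := mem_range.1 hj
    exact ⟨by tauto, by omega⟩) (fun T => (-1) ^ T.card) (by simp)
  convert this using 2 with e
  unfold VS.UU
  rw [sum_biUnion]
  · apply sum_congr rfl
    intro j _
    unfold VS.es
    rw [mul_sum]
    apply sum_congr rfl
    intro T hT
    rw [(mem_powersetCard.1 hT).2]
  · intro i _ j _ hij
    exact pairwise_disjoint_powersetCard S hij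

end VS

open Finset Filter Topology
namespace VS

def bb (κ J i : ℕ) : ℕ := 40 * (κ + (J - i))
/-- upper bound weight -/
def WW (J κ : ℕ) (S : ℕ → Finset ℕ) (e : ℕ → ℝ) : ℝ := ∏ i ∈ range J, UU (2 * bb κ J i) (S i) e
/-- Brun-Hooley correction terms -/
def LL (J κ : ℕ) (S : ℕ → Finset ℕ) (l : ℕ) (e : ℕ → ℝ) : ℝ :=
  es (2 * bb κ J l + 1) (S l) e * ∏ i ∈ (range J).erase l, UU (2 * bb κ J i) (S i) e
def VV (J : ℕ) (S : ℕ → Finset ℕ) (e : ℕ → ℝ) : ℝ := ∏ i ∈ range J, ∏ p ∈ S i, (1 - e p)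

lemma WW_ge (J κ : ℕ) (S : ℕ → Finset ℕ) (e : ℕ → ℝ)
    (he : ∀ i, i < J → ∀ p ∈ S i, 0 ≤ e p ∧ e p ≤ 1) : 0 ≤ VV J S e ∧ VV J S e ≤ WW J κ S e := by
  have h0 : ∀ i ∈ range J, 0 ≤ ∏ p ∈ S i, (1 - e p) := fun i hi =>
    prod_nonneg (fun p hp => by linarith [(he i (mem_range.1 hi) p hp).2])
  exact ⟨prod_nonneg h0, prod_le_prod h0
    (fun i hi => (bonf_even _ _ _ (he i (mem_range.1 hi))).1)⟩

lemma LL_lower (J κ : ℕ) (S : ℕ → Finset ℕ) (e : ℕ → ℝ)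
    (he : ∀ i, i < J → ∀ p ∈ S i, 0 ≤ e p ∧ e p ≤ 1) :
    WW J κ S e - ∑ l ∈ range J, LL J κ S l e ≤ VV J S e := by
  have h0 : ∀ i, i < J → 0 ≤ ∏ p ∈ S i, (1 - e p) := fun i hi =>
    prod_nonneg (fun p hp => by linarith [(he i hi p hp).2])
  have hb := fun i (hi : i < J) => bonf_even (bb κ J i) (S i) e (he i hi)
  have h1 := brun_hooley J (fun i => ∏ p ∈ S i, (1 - e p)) (fun i => UU (2 * bb κ J i) (S i) e) h0
    (fun i hi => (hb i hi).1)
  refine le_trans ?_ h1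
  unfold WW
  apply sub_le_sub_left
  apply sum_le_sum
  intro l hl
  unfold LL
  apply mul_le_mul_of_nonneg_right (hb l (mem_range.1 hl)).2
  apply prod_nonneg
  intro i hi
  have hi' := mem_range.1 (mem_erase.1 hi).2
  exact (h0 i hi').trans (hb i hi').1

lemma sum_eps (J : ℕ) : ∑ i ∈ range J, Real.exp (-80 * ((J - i : ℕ) : ℝ)) ≤ 1 / 2 := by
  have h : ∀ J : ℕ, ∑ i ∈ range J, Real.exp (-80 * ((J - i : ℕ) : ℝ)) ≤
      (1 / 2) * (1 - (1 / 3) ^ J) := by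
    intro J
    induction J with
    | zero => simp
    | succ J ih =>
      rw [sum_range_succ']
      have e1 : ∀ i ∈ range J, Real.exp (-80 * ((J + 1 - (i + 1) : ℕ) : ℝ)) =
          Real.exp (-80 * ((J - i : ℕ) : ℝ)) := by
        intro i _
        congr 3; omega
      rw [sum_congr rfl e1]
      have h2 : Real.exp (-80 * ((J + 1 - 0 : ℕ) : ℝ)) ≤ (1 / 3) ^ (J + 1) := by
        have : Real.exp (-80 * ((J + 1 - 0 : ℕ) : ℝ)) = Real.exp (-80) ^ (J + 1) := by
          rw [← Real.exp_nat_mul]; congr 1; push_cast; ring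
        rw [this]
        gcongr
        rw [Real.exp_neg]
        have := Real.add_one_le_exp (80 : ℝ)
        rw [one_div]
        apply inv_anti₀ (by norm_num); linarith
      rw [pow_succ] at h2 ⊢
      linarith
  refine (h J).trans ?_
  have : (0 : ℝ) ≤ (1 / 3) ^ J := by positivity
  linarith

lemma dens (J κ : ℕ) (S : ℕ → Finset ℕ) (g : ℕ → ℝ)
    (hg : ∀ i, i < J → ∀ p ∈ S i, 0 ≤ g p ∧ g p ≤ 1 / 2)
    (hs : ∀ i, i < J → ∑ p ∈ S i, g p ≤ 8 * κ) :
    0 < VV J S g ∧ WW J κ S g ≤ 2 * VV J S g ∧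
    1 / 2 * VV J S g ≤ WW J κ S g - ∑ l ∈ range J, LL J κ S l g := by
  have hg1 : ∀ i, i < J → ∀ p ∈ S i, 0 ≤ g p ∧ g p ≤ 1 := fun i hi p hp =>
    ⟨(hg i hi p hp).1, by linarith [(hg i hi p hp).2]⟩
  have h0 : ∀ i, i < J → 0 < ∏ p ∈ S i, (1 - g p) := fun i hi =>
    prod_pos (fun p hp => by linarith [(hg i hi p hp).2])
  have hb := fun i (hi : i < J) => bonf_even (bb κ J i) (S i) g (hg1 i hi)
  have hE : ∀ i, i < J → es (2 * bb κ J i + 1) (S i) g ≤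
      Real.exp (-80 * ((J - i : ℕ) : ℝ)) * ∏ p ∈ S i, (1 - g p) := fun i hi =>
    block_est (S i) g κ ((J - i : ℕ) : ℝ) (by positivity) (by positivity) _
      (by unfold bb; push_cast; linarith) (hg i hi) (hs i hi)
  have hV : 0 < VV J S g := prod_pos (fun i hi => h0 i (mem_range.1 hi))
  have hW := (WW_ge J κ S g hg1).2
  refine ⟨hV, ?_, ?_⟩
  · calc WW J κ S g ≤ ∏ i ∈ range J, (Real.exp (Real.exp (-80 * ((J - i : ℕ) : ℝ))) *
          ∏ p ∈ S i, (1 - g p)) := by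
          apply Finset.prod_le_prod
          · intro i hi
            exact (h0 i (mem_range.1 hi)).le.trans (hb i (mem_range.1 hi)).1
          · intro i hi
            have h1 := (hb i (mem_range.1 hi)).2
            have h2 := hE i (mem_range.1 hi)
            have h3 := Real.add_one_le_exp (Real.exp (-80 * ((J - i : ℕ) : ℝ)))
            have h4 := h0 i (mem_range.1 hi)
            have := mul_le_mul_of_nonneg_right h3 h4.le
            linarith
      _ = Real.exp (∑ i ∈ range J, Real.exp (-80 * ((J - i : ℕ) : ℝ))) * VV J S g := by
          rw [prod_mul_distrib, Real.exp_sum]; rfl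
      _ ≤ Real.exp (1 / 2) * VV J S g := by
          gcongr; exact sum_eps J
      _ ≤ 2 * VV J S g := by
          gcongr
          have h1 : Real.exp (1 / 2) ^ 2 = Real.exp 1 := by
            rw [← Real.exp_nat_mul]; norm_num
          have := Real.exp_one_lt_d9
          nlinarith [Real.exp_pos (1 / 2)]
  · have h1 : ∀ l ∈ range J, LL J κ S l g ≤ Real.exp (-80 * ((J - l : ℕ) : ℝ)) * WW J κ S g := by
      intro l hl
      have hl' := mem_range.1 hl
      unfold LL WW
      rw [← mul_prod_erase _ _ hl, ← mul_assoc]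
      apply mul_le_mul_of_nonneg_right
      · refine (hE l hl').trans ?_
        gcongr
        exact (hb l hl').1
      · apply prod_nonneg
        intro i hi
        have hi' := mem_range.1 (mem_erase.1 hi).2
        exact (h0 i hi').le.trans (hb i hi').1
    have h2 := sum_le_sum h1
    rw [← sum_mul] at h2
    have h3 := sum_eps J
    have : 0 ≤ WW J κ S g := hV.le.trans hW
    nlinarith

lemma WW_max (J κ : ℕ) (S : ℕ → Finset ℕ) (e : ℕ → ℝ) (N : ℝ) (hN0 : 0 ≤ N)
    (he : ∀ i, i < J → ∀ p ∈ S i, 0 ≤ e p ∧ e p ≤ 1) (hN : ∀ i, i < J → ∑ p ∈ S i, e p ≤ N) :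
    WW J κ S e ≤ (1 + N) ^ (80 * J * (κ + J)) := by
  have hb := fun i (hi : i < J) => bonf_even (bb κ J i) (S i) e (he i hi)
  calc WW J κ S e ≤ ∏ i ∈ range J, (1 + N) ^ (80 * (κ + J)) := by
        apply Finset.prod_le_prod
        · intro i hi
          exact (prod_nonneg (fun p hp => by linarith [(he i (mem_range.1 hi) p hp).2])).trans
            (hb i (mem_range.1 hi)).1
        · intro i hi
          refine (UU_abs _ _ _ (fun p hp => (he i (mem_range.1 hi) p hp).1) N
            (hN i (mem_range.1 hi))).trans ?_
          apply pow_le_pow_right₀ (by linarith)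
          unfold bb
          have : J - i ≤ J := Nat.sub_le _ _
          nlinarith
    _ = _ := by
        rw [prod_const, card_range, ← pow_mul]; congr 1; ring

lemma lev_sum (J κ : ℕ) : ∑ i ∈ range J, 2 ^ (i + 1) * (κ + (J - i)) ≤ 2 ^ (J + 1) * (κ + 2) := by
  induction J generalizing κ with
  | zero => simp
  | succ J ih =>
    rw [sum_range_succ]
    have e : ∀ i ∈ range J, 2 ^ (i + 1) * (κ + (J + 1 - i)) = 2 ^ (i + 1) * (κ + 1 + (J - i)) := by
      intro i hi
      have := mem_range.1 hi
      congr 1; omega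
    rw [sum_congr rfl e]
    have := ih (κ + 1)
    have e2 : J + 1 - J = 1 := by omega
    rw [e2, pow_succ 2 (J + 1)]
    nlinarith

lemma lev_prod (J κ : ℕ) : ∏ i ∈ range J, (2 ^ 2 ^ (i + 1)) ^ (2 * bb κ J i + 1) ≤
    2 ^ (81 * (2 ^ (J + 1) * (κ + 2))) := by
  have e : ∀ i ∈ range J, (2 ^ 2 ^ (i + 1)) ^ (2 * bb κ J i + 1) ≤
      2 ^ (81 * (2 ^ (i + 1) * (κ + (J - i)))) := by
    intro i hi
    have := mem_range.1 hi
    rw [← pow_mul]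
    apply Nat.pow_le_pow_right (by norm_num)
    unfold bb
    have h1 : 1 ≤ κ + (J - i) := by omega
    have : 2 * (40 * (κ + (J - i))) + 1 ≤ 81 * (κ + (J - i)) := by omega
    calc _ ≤ 2 ^ (i + 1) * (81 * (κ + (J - i))) := Nat.mul_le_mul_left _ this
      _ = _ := by ring
  refine (prod_le_prod' e).trans ?_
  rw [prod_pow_eq_pow_sum, ← mul_sum]
  exact Nat.pow_le_pow_right (by norm_num) (Nat.mul_le_mul_left _ (lev_sum J κ))

lemma Poly.WW (J κ : ℕ) (S : ℕ → Finset ℕ) (hS : ∀ i, S i ⊆ Bk i)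
    (hd : ∀ i j, i ≠ j → Disjoint (S i) (S j)) :
    Poly ((range J).biUnion S) (2 ^ (81 * (2 ^ (J + 1) * (κ + 2)))) (VS.WW J κ S) := by
  refine (Poly.prod J S (fun i => (2 ^ 2 ^ (i + 1)) ^ (2 * bb κ J i + 1))
    (fun i => VS.UU (2 * bb κ J i) (S i)) ?_ hd).mono (Subset.refl _) (lev_prod J κ)
  intro i _
  exact Poly.UU _ (fun p hp => (mem_Bk.1 (hS i hp)).1.2) _ _ _ Nat.one_le_two_pow
    (fun p hp => (mem_Bk.1 (hS i hp)).1.1) (by omega)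

lemma Poly.LL (J κ : ℕ) (S : ℕ → Finset ℕ) (hS : ∀ i, S i ⊆ Bk i)
    (hd : ∀ i j, i ≠ j → Disjoint (S i) (S j)) (l : ℕ) (hl : l < J) :
    Poly ((range J).biUnion S) (2 ^ (81 * (2 ^ (J + 1) * (κ + 2)))) (VS.LL J κ S l) := by
  have := (Poly.prod J S (fun i => (2 ^ 2 ^ (i + 1)) ^ (2 * bb κ J i + 1))
    (fun i => if i = l then VS.es (2 * bb κ J i + 1) (S i) else VS.UU (2 * bb κ J i) (S i)) ?_ hd
    ).mono (Subset.refl _) (lev_prod J κ)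
  · convert this using 2 with e
    unfold VS.LL
    rw [← mul_prod_erase _ _ (mem_range.2 hl)]
    congr 1
    · simp
    · apply prod_congr rfl
      intro i hi
      rw [if_neg (mem_erase.1 hi).1]
  · intro i _
    split_ifs
    · exact Poly.es _ (fun p hp => (mem_Bk.1 (hS i hp)).1.2) _ _ _ Nat.one_le_two_pow
        (fun p hp => (mem_Bk.1 (hS i hp)).1.1) (by omega)
    · exact Poly.UU _ (fun p hp => (mem_Bk.1 (hS i hp)).1.2) _ _ _ Nat.one_le_two_pow
        (fun p hp => (mem_Bk.1 (hS i hp)).1.1) (by omega)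

lemma Bk_disj {i j : ℕ} (h : i ≠ j) : Disjoint (Bk i) (Bk j) := by
  have key : ∀ i j, i < j → Disjoint (Bk i) (Bk j) := by
    intro i j h
    rw [disjoint_left]
    intro p h1 h2
    have a1 := (mem_Bk.1 h1).1.1
    have a2 := (mem_Bk.1 h2).2
    have : 2 ^ 2 ^ (i + 1) ≤ 2 ^ 2 ^ j :=
      Nat.pow_le_pow_right (by norm_num) (Nat.pow_le_pow_right (by norm_num) h)
    omega
  rcases lt_or_gt_of_ne h with h | h
  · exact key _ _ h
  · exact (key _ _ h).symm

end VS

open Finset Filter Topology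
namespace VS

lemma crt_sum (m n : ℕ) (hm : 0 < m) (hn : 0 < n) (h : Nat.Coprime m n) (F : ℕ → ℕ → ℝ) :
    ∑ x ∈ range (m * n), F (x % m) (x % n) = ∑ i ∈ range m, ∑ j ∈ range n, F i j := by
  rw [← sum_product']
  refine sum_nbij' (fun x => (x % m, x % n)) (fun p => (Nat.chineseRemainder h p.1 p.2 : ℕ))
    ?_ ?_ ?_ ?_ ?_
  · intro x _
    simp [Nat.mod_lt _ hm, Nat.mod_lt _ hn]
  · intro p _
    exact mem_range.2 (Nat.chineseRemainder_lt_mul h _ _ hm.ne' hn.ne')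
  · intro x hx
    have h1 := (Nat.chineseRemainder_modEq_unique h (a := x % m) (b := x % n) (z := x)
      (Nat.mod_modEq _ _).symm (Nat.mod_modEq _ _).symm)
    have h2 := Nat.chineseRemainder_lt_mul h (x % m) (x % n) hm.ne' hn.ne'
    exact (Nat.ModEq.eq_of_lt_of_lt h1 (mem_range.1 hx) h2).symm
  · rintro ⟨i, j⟩ hp
    simp only [mem_product, mem_range] at hp
    have h3 := (Nat.chineseRemainder h i j).2
    ext
    · exact Eq.trans h3.1 (Nat.mod_eq_of_lt hp.1)
    · exact Eq.trans h3.2 (Nat.mod_eq_of_lt hp.2)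
  · intro x _; rfl

lemma full1 (s : Finset ℕ) (hs0 : ∀ q ∈ s, 0 < q)
    (hs : ∀ q ∈ s, ∀ q' ∈ s, q ≠ q' → Nat.Coprime q q') (f : ℕ → ℕ → ℝ)
    (hf : ∀ q ∈ s, ∀ a, f q a = f q (a % q)) :
    ∑ a ∈ range (∏ q ∈ s, q), ∏ q ∈ s, f q a = ∏ q ∈ s, ∑ a ∈ range q, f q a := by
  induction s using Finset.induction_on with
  | empty => simp
  | insert q s hq ih =>
    have ih' := ih (fun q' hq' => hs0 q' (mem_insert_of_mem hq'))
      (fun q' hq' q'' hq'' => hs q' (mem_insert_of_mem hq') q'' (mem_insert_of_mem hq''))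
      (fun q' hq' => hf q' (mem_insert_of_mem hq'))
    rw [prod_insert hq, prod_insert hq]
    set M := ∏ q ∈ s, q
    have hM : 0 < M := prod_pos (fun q' hq' => hs0 q' (mem_insert_of_mem hq'))
    have hco : Nat.Coprime q M := Nat.Coprime.prod_right (fun q' hq' =>
      hs q (mem_insert_self _ _) q' (mem_insert_of_mem hq') (by rintro rfl; exact hq hq'))
    have hq0 := hs0 q (mem_insert_self _ _)
    have hper : ∀ q' ∈ s, ∀ a, f q' a = f q' (a % M) := by
      intro q' hq' a
      rw [hf q' (mem_insert_of_mem hq') a, hf q' (mem_insert_of_mem hq') (a % M),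
        Nat.mod_mod_of_dvd _ (dvd_prod_of_mem _ hq')]
    have e : ∀ a ∈ range (q * M), ∏ q' ∈ insert q s, f q' a =
        (fun i j => f q i * ∏ q' ∈ s, f q' j) (a % q) (a % M) := by
      intro a _
      rw [prod_insert hq, hf q (mem_insert_self _ _) a]
      congr 1
      exact prod_congr rfl (fun q' hq' => hper q' hq' a)
    rw [sum_congr rfl e, crt_sum q M hq0 hM hco (fun i j => f q i * ∏ q' ∈ s, f q' j), ← ih',
      sum_mul_sum]

lemma full2 (s : Finset ℕ) (hs0 : ∀ q ∈ s, 0 < q)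
    (hs : ∀ q ∈ s, ∀ q' ∈ s, q ≠ q' → Nat.Coprime q q') (f : ℕ → ℕ → ℕ → ℝ)
    (hf : ∀ q ∈ s, ∀ a b, f q a b = f q (a % q) (b % q)) :
    ∑ a ∈ range (∏ q ∈ s, q), ∑ b ∈ range (∏ q ∈ s, q), ∏ q ∈ s, f q a b =
      ∏ q ∈ s, ∑ a ∈ range q, ∑ b ∈ range q, f q a b := by
  induction s using Finset.induction_on with
  | empty => simp
  | insert q s hq ih =>
    have ih' := ih (fun q' hq' => hs0 q' (mem_insert_of_mem hq'))
      (fun q' hq' q'' hq'' => hs q' (mem_insert_of_mem hq') q'' (mem_insert_of_mem hq''))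
      (fun q' hq' => hf q' (mem_insert_of_mem hq'))
    rw [prod_insert hq, prod_insert hq]
    set M := ∏ q ∈ s, q
    have hM : 0 < M := prod_pos (fun q' hq' => hs0 q' (mem_insert_of_mem hq'))
    have hco : Nat.Coprime q M := Nat.Coprime.prod_right (fun q' hq' =>
      hs q (mem_insert_self _ _) q' (mem_insert_of_mem hq') (by rintro rfl; exact hq hq'))
    have hq0 := hs0 q (mem_insert_self _ _)
    have hper : ∀ q' ∈ s, ∀ a b, f q' a b = f q' (a % M) (b % M) := by
      intro q' hq' a b
      rw [hf q' (mem_insert_of_mem hq') a b, hf q' (mem_insert_of_mem hq') (a % M) (b % M),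
        Nat.mod_mod_of_dvd _ (dvd_prod_of_mem _ hq'), Nat.mod_mod_of_dvd _ (dvd_prod_of_mem _ hq')]
    have e : ∀ a ∈ range (q * M), ∑ b ∈ range (q * M), ∏ q' ∈ insert q s, f q' a b =
        (fun i j => ∑ k ∈ range q, ∑ l ∈ range M, f q i k * ∏ q' ∈ s, f q' j l) (a % q) (a % M) := by
      intro a _
      dsimp only
      rw [← crt_sum q M hq0 hM hco (fun k l => f q (a % q) k * ∏ q' ∈ s, f q' (a % M) l)]
      apply sum_congr rfl
      intro b _
      rw [prod_insert hq, hf q (mem_insert_self _ _) a]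
      congr 1
      exact prod_congr rfl (fun q' hq' => hper q' hq' a b)
    rw [sum_congr rfl e, crt_sum q M hq0 hM hco
      (fun i j => ∑ k ∈ range q, ∑ l ∈ range M, f q i k * ∏ q' ∈ s, f q' j l), ← ih', sum_mul_sum]
    apply sum_congr rfl; intro i _
    apply sum_congr rfl; intro j _
    rw [sum_mul_sum]

lemma per_block (f : ℕ → ℝ) (M : ℕ) (hf : ∀ x, f (x + M) = f x) (A : ℕ) :
    ∑ x ∈ Ico A (A + M), f x = ∑ x ∈ range M, f x := by
  induction A with
  | zero => simp
  | succ A ih =>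
    rw [← ih]
    rcases Nat.eq_zero_or_pos M with h | h
    · simp [h]
    rw [sum_eq_sum_Ico_succ_bot (by omega : A < A + M), show A + 1 + M = (A + M) + 1 by ring,
      sum_Ico_succ_top (by omega), hf]
    ring

lemma per_blocks (f : ℕ → ℝ) (M : ℕ) (hf : ∀ x, f (x + M) = f x) (A t : ℕ) :
    ∑ x ∈ Ico A (A + t * M), f x = t * ∑ x ∈ range M, f x := by
  induction t with
  | zero => simp
  | succ t ih =>
    rw [← sum_Ico_consecutive f (by omega : A ≤ A + t * M) (by nlinarith : A + t * M ≤ A + (t + 1) * M),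
      ih, show A + (t + 1) * M = (A + t * M) + M by ring, per_block f M hf]
    push_cast; ring

lemma per_bounds (f : ℕ → ℝ) (M : ℕ) (hM : 0 < M) (hf : ∀ x, f (x + M) = f x) (h0 : ∀ x, 0 ≤ f x)
    (A N : ℕ) :
    ((N / M : ℕ) : ℝ) * ∑ x ∈ range M, f x ≤ ∑ x ∈ Ico A (A + N), f x ∧
    ∑ x ∈ Ico A (A + N), f x ≤ (((N / M : ℕ) : ℝ) + 1) * ∑ x ∈ range M, f x := by
  constructor
  · rw [← per_blocks f M hf A]
    apply sum_le_sum_of_subset_of_nonneg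
    · apply Ico_subset_Ico_right
      have := Nat.div_mul_le_self N M
      omega
    · intro x _ _; exact h0 x
  · have := per_blocks f M hf A (N / M + 1)
    push_cast at this
    rw [← this]
    apply sum_le_sum_of_subset_of_nonneg
    · apply Ico_subset_Ico_right
      have := Nat.lt_div_mul_add hM (a := N)
      nlinarith
    · intro x _ _; exact h0 x

lemma count1 (s : Finset ℕ) (hs0 : ∀ q ∈ s, 0 < q)
    (hs : ∀ q ∈ s, ∀ q' ∈ s, q ≠ q' → Nat.Coprime q q') (f : ℕ → ℕ → ℝ)
    (hf : ∀ q ∈ s, ∀ a, f q a = f q (a % q)) (hf0 : ∀ q a, 0 ≤ f q a ∧ f q a ≤ 1) (A N : ℕ) :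
    |∑ a ∈ Ico A (A + N), ∏ q ∈ s, f q a - N * ∏ q ∈ s, ((∑ a ∈ range q, f q a) / q)| ≤
      ((∏ q ∈ s, q : ℕ) : ℝ) := by
  have hM : 0 < ∏ q ∈ s, q := prod_pos hs0
  have hfull := full1 s hs0 hs f hf
  set M := ∏ q ∈ s, q with hMdef
  have hper : ∀ x, ∏ q ∈ s, f q (x + M) = ∏ q ∈ s, f q x := by
    intro x
    apply prod_congr rfl
    intro q hq
    rw [hf q hq, hf q hq x]
    congr 1
    obtain ⟨k, hk⟩ := dvd_prod_of_mem (fun q => q) hq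
    rw [hMdef, hk]; simp
  have h0 : ∀ x, 0 ≤ ∏ q ∈ s, f q x := fun x => prod_nonneg (fun q _ => (hf0 q x).1)
  have h1 : ∀ x, ∏ q ∈ s, f q x ≤ 1 := fun x => prod_le_one (fun q _ => (hf0 q x).1)
    (fun q _ => (hf0 q x).2)
  obtain ⟨b1, b2⟩ := per_bounds _ M hM hper h0 A N
  rw [prod_div_distrib, ← hfull]
  set σ := ∑ a ∈ range M, ∏ q ∈ s, f q a
  have hσ0 : 0 ≤ σ := sum_nonneg (fun x _ => h0 x)
  have hσ1 : σ ≤ M := by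
    calc σ ≤ ∑ a ∈ range M, (1 : ℝ) := sum_le_sum (fun x _ => h1 x)
      _ = M := by simp
  have hM' : (0 : ℝ) < M := by exact_mod_cast hM
  have t1 : ((N / M : ℕ) : ℝ) ≤ N / M := Nat.cast_div_le
  have t2 : (N : ℝ) / M ≤ ((N / M : ℕ) : ℝ) + 1 := by
    rw [div_le_iff₀ hM']
    have := Nat.lt_div_mul_add hM (a := N)
    have : N ≤ (N / M + 1) * M := by nlinarith
    exact_mod_cast this
  have e : (∏ q ∈ s, (q : ℝ)) = M := by rw [hMdef]; push_cast; rfl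
  rw [e, show (N : ℝ) * (σ / M) = (N / M) * σ by ring, abs_le]
  have := mul_le_mul_of_nonneg_right t1 hσ0
  have := mul_le_mul_of_nonneg_right t2 hσ0
  constructor <;> nlinarith

lemma count2 (s : Finset ℕ) (hs0 : ∀ q ∈ s, 0 < q)
    (hs : ∀ q ∈ s, ∀ q' ∈ s, q ≠ q' → Nat.Coprime q q') (f : ℕ → ℕ → ℕ → ℝ)
    (hf : ∀ q ∈ s, ∀ a b, f q a b = f q (a % q) (b % q))
    (hf0 : ∀ q a b, 0 ≤ f q a b ∧ f q a b ≤ 1) (A N : ℕ) :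
    |∑ a ∈ Ico A (A + N), ∑ b ∈ range N, ∏ q ∈ s, f q a b -
      (N : ℝ) ^ 2 * ∏ q ∈ s, ((∑ a ∈ range q, ∑ b ∈ range q, f q a b) / (q : ℝ) ^ 2)| ≤
      2 * N * ((∏ q ∈ s, q : ℕ) : ℝ) + ((∏ q ∈ s, q : ℕ) : ℝ) ^ 2 := by
  have hM : 0 < ∏ q ∈ s, q := prod_pos hs0
  have hfull := full2 s hs0 hs f hf
  set M := ∏ q ∈ s, q with hMdef
  set F : ℕ → ℕ → ℝ := fun a b => ∏ q ∈ s, f q a b with hF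
  have hper1 : ∀ a b, F (a + M) b = F a b := by
    intro a b
    apply prod_congr rfl
    intro q hq
    rw [hf q hq, hf q hq a]
    congr 1
    obtain ⟨k, hk⟩ := dvd_prod_of_mem (fun q => q) hq
    rw [hMdef, hk]; simp
  have hper2 : ∀ a b, F a (b + M) = F a b := by
    intro a b
    apply prod_congr rfl
    intro q hq
    rw [hf q hq, hf q hq a b]
    congr 1
    obtain ⟨k, hk⟩ := dvd_prod_of_mem (fun q => q) hq
    rw [hMdef, hk]; simp
  have h0 : ∀ a b, 0 ≤ F a b := fun a b => prod_nonneg (fun q _ => (hf0 q a b).1)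
  have h1 : ∀ a b, F a b ≤ 1 := fun a b => prod_le_one (fun q _ => (hf0 q a b).1)
    (fun q _ => (hf0 q a b).2)
  set t : ℝ := ((N / M : ℕ) : ℝ) with ht
  have ht0 : 0 ≤ t := by positivity
  set r : ℕ → ℝ := fun b => ∑ a ∈ range M, F a b with hr
  have hr0 : ∀ b, 0 ≤ r b := fun b => sum_nonneg (fun a _ => h0 a b)
  have hrp : ∀ b, r (b + M) = r b := fun b => sum_congr rfl (fun a _ => hper2 a b)
  have b1 := fun b => per_bounds (fun a => F a b) M hM (fun a => hper1 a b) (fun a => h0 a b) A N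
  obtain ⟨c1, c2⟩ := per_bounds r M hM hrp hr0 0 N
  rw [zero_add, ← range_eq_Ico] at c1 c2
  set σ := ∑ b ∈ range M, r b with hσ
  have eσ : ∑ a ∈ range M, ∑ b ∈ range M, F a b = σ := sum_comm
  have hσ0 : 0 ≤ σ := sum_nonneg (fun x _ => hr0 x)
  have hσ1 : σ ≤ (M : ℝ) ^ 2 := by
    calc σ ≤ ∑ b ∈ range M, ∑ a ∈ range M, (1 : ℝ) :=
        sum_le_sum (fun x _ => sum_le_sum (fun y _ => h1 y x))
      _ = (M : ℝ) ^ 2 := by simp; ring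
  have low : t * (t * σ) ≤ ∑ a ∈ Ico A (A + N), ∑ b ∈ range N, F a b := by
    rw [sum_comm]
    calc t * (t * σ) ≤ t * ∑ b ∈ range N, r b := by gcongr
      _ = ∑ b ∈ range N, t * r b := mul_sum _ _ _
      _ ≤ _ := sum_le_sum (fun b _ => (b1 b).1)
  have upp : ∑ a ∈ Ico A (A + N), ∑ b ∈ range N, F a b ≤ (t + 1) * ((t + 1) * σ) := by
    rw [sum_comm]
    calc _ ≤ ∑ b ∈ range N, (t + 1) * r b := sum_le_sum (fun b _ => (b1 b).2)
      _ = (t + 1) * ∑ b ∈ range N, r b := (mul_sum _ _ _).symm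
      _ ≤ _ := by gcongr
  have hM' : (0 : ℝ) < M := by exact_mod_cast hM
  have t1 : t ≤ N / M := Nat.cast_div_le
  have t2 : (N : ℝ) / M ≤ t + 1 := by
    rw [div_le_iff₀ hM']
    have := Nat.lt_div_mul_add hM (a := N)
    have : N ≤ (N / M + 1) * M := by nlinarith
    rw [ht]; exact_mod_cast this
  have e : (∏ q ∈ s, (q : ℝ) ^ 2) = (M : ℝ) ^ 2 := by rw [hMdef]; push_cast; rw [prod_pow]
  rw [prod_div_distrib, ← hfull, eσ, e, show (N : ℝ) ^ 2 * (σ / M ^ 2) = (N / M) ^ 2 * σ by ring]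
  have s1 : t ^ 2 * σ ≤ (N / M) ^ 2 * σ := by gcongr
  have s2 : (N / M : ℝ) ^ 2 * σ ≤ (t + 1) ^ 2 * σ := by gcongr
  have s3 : (2 * t + 1) * σ ≤ 2 * N * M + M ^ 2 := by
    calc (2 * t + 1) * σ ≤ (2 * (N / M) + 1) * M ^ 2 := by gcongr
      _ = _ := by field_simp
  rw [abs_le]
  constructor <;> nlinarith

end VS

open Finset Filter Topology
namespace VS

lemma sum_range_zmod (p : ℕ) [NeZero p] (F : ZMod p → ℝ) :
    ∑ a ∈ range p, F (a : ZMod p) = ∑ z : ZMod p, F z := by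
  refine sum_nbij' (fun a => (a : ZMod p)) ZMod.val ?_ ?_ ?_ ?_ ?_
  · intro a _; simp
  · intro z _; exact mem_range.2 (ZMod.val_lt z)
  · intro a ha; exact ZMod.val_cast_of_lt (mem_range.1 ha)
  · intro z _; exact ZMod.natCast_zmod_val z
  · intro a _; rfl

/-- number of representations modulo `p` -/
def rep (p : ℕ) [NeZero p] (j : ZMod p) : ℕ :=
  ((univ : Finset (ZMod p × ZMod p)).filter (fun z => z.1 ^ 2 + z.2 ^ 2 = j)).card

lemma rep_le (p : ℕ) [Fact p.Prime] (i j : ZMod p) (hi : i ≠ 0) (hj : j ≠ 0) :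
    rep p i ≤ rep p j := by
  obtain ⟨s, t, hst⟩ := ZMod.sq_add_sq p (j / i)
  have hne : s ^ 2 + t ^ 2 ≠ 0 := by rw [hst]; exact div_ne_zero hj hi
  apply card_le_card_of_injOn (fun z => (s * z.1 - t * z.2, s * z.2 + t * z.1))
  · intro z hz
    simp only [coe_filter, mem_univ, true_and, Set.mem_ofPred_eq] at hz ⊢
    have : (s * z.1 - t * z.2) ^ 2 + (s * z.2 + t * z.1) ^ 2 =
      (s ^ 2 + t ^ 2) * (z.1 ^ 2 + z.2 ^ 2) := by ring
    rw [this, hst, hz, div_mul_cancel₀ _ hi]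
  · rintro ⟨z1, z2⟩ _ ⟨w1, w2⟩ _ h
    simp only [Prod.mk.injEq] at h
    obtain ⟨h1, h2⟩ := h
    have e1 : (s ^ 2 + t ^ 2) * (z1 - w1) = 0 := by linear_combination s * h1 + t * h2
    have e2 : (s ^ 2 + t ^ 2) * (z2 - w2) = 0 := by linear_combination -t * h1 + s * h2
    ext
    · exact sub_eq_zero.1 ((mul_eq_zero.1 e1).resolve_left hne)
    · exact sub_eq_zero.1 ((mul_eq_zero.1 e2).resolve_left hne)

lemma rep_zero3 (p : ℕ) [Fact p.Prime] (hp : p % 4 = 3) : rep p 0 = 1 := by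
  unfold rep
  rw [card_eq_one]
  refine ⟨(0, 0), ?_⟩
  ext ⟨a, b⟩
  simp only [mem_filter, mem_univ, true_and, mem_singleton, Prod.mk.injEq]
  constructor
  · intro h
    by_cases hb : b = 0
    · subst hb
      simpa using h
    · exfalso
      have : (a / b) ^ 2 = -1 := by
        rw [div_pow, div_eq_iff (pow_ne_zero 2 hb)]
        linear_combination h
      exact ZMod.mod_four_ne_three_of_sq_eq_neg_one this hp
  · rintro ⟨rfl, rfl⟩; simp

lemma rep_three (p : ℕ) [Fact p.Prime] (hp : p % 4 = 3) (j : ZMod p) (hj : j ≠ 0) :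
    rep p j = p + 1 := by
  have h1 : ∑ i : ZMod p, rep p i = p * p := by
    have := card_eq_sum_card_fiberwise (f := fun z : ZMod p × ZMod p => z.1 ^ 2 + z.2 ^ 2)
      (s := univ) (t := univ) (by intro z _; simp)
    rw [card_univ, Fintype.card_prod, ZMod.card] at this
    rw [this]; rfl
  have h2 : ∀ i : ZMod p, i ∈ univ.erase (0 : ZMod p) → rep p i = rep p j := by
    intro i hi
    have hi' := (mem_erase.1 hi).1
    exact le_antisymm (rep_le p i j hi' hj) (rep_le p j i hj hi')
  rw [← add_sum_erase _ _ (mem_univ (0 : ZMod p)), sum_congr rfl h2, sum_const, rep_zero3 p hp,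
    card_erase_of_mem (mem_univ _), card_univ, ZMod.card, smul_eq_mul] at h1
  have h3 := (Fact.out : p.Prime).two_le
  obtain ⟨q, rfl⟩ : ∃ q, p = q + 1 := ⟨p - 1, by omega⟩
  have h4 : q * rep (q + 1) j = q * (q + 1 + 1) := by
    simp only [Nat.add_sub_cancel] at h1
    nlinarith
  exact Nat.eq_of_mul_eq_mul_left (by omega) h4

lemma rep_zero1 (p : ℕ) [Fact p.Prime] (hp : p % 4 = 1) : rep p 0 = 2 * p - 1 := by
  obtain ⟨i, hi⟩ := (ZMod.exists_sq_eq_neg_one_iff (p := p)).2 (by omega)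
  have hp3 : 2 < p := by have := (Fact.out : p.Prime).two_le; omega
  have : Fact (2 < p) := ⟨hp3⟩
  have h20 : (2 : ZMod p) ≠ 0 := by
    intro h
    have h5 : ((2 : ℕ) : ZMod p) = 0 := by exact_mod_cast h
    rw [ZMod.natCast_eq_zero_iff] at h5
    have := Nat.le_of_dvd (by norm_num) h5
    omega
  have hi0 : i ≠ 0 := by rintro rfl; simp at hi
  have h1 : rep p 0 = ∑ w : ZMod p, ((univ : Finset (ZMod p)).filter (fun z => z ^ 2 + w ^ 2 = 0)).card := by
    unfold rep
    simp only [card_filter]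
    rw [Fintype.sum_prod_type, sum_comm]
  have h2 : ∀ w ∈ (univ : Finset (ZMod p)).erase 0,
      ((univ : Finset (ZMod p)).filter (fun z => z ^ 2 + w ^ 2 = 0)).card = 2 := by
    intro w hw
    have hw0 := (mem_erase.1 hw).1
    have : (univ : Finset (ZMod p)).filter (fun z => z ^ 2 + w ^ 2 = 0) = {i * w, -(i * w)} := by
      ext z
      simp only [mem_filter, mem_univ, true_and, mem_insert, mem_singleton]
      constructor
      · intro h
        have : (z - i * w) * (z + i * w) = 0 := by linear_combination h + w ^ 2 * hi
        rcases mul_eq_zero.1 this with h | h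
        · left; exact sub_eq_zero.1 h
        · right; exact eq_neg_of_add_eq_zero_left h
      · rintro (rfl | rfl)
        · linear_combination -w ^ 2 * hi
        · linear_combination -w ^ 2 * hi
    rw [this, card_pair]
    intro h
    have : 2 * (i * w) = 0 := by linear_combination h
    simp [h20, hi0, hw0] at this
  rw [h1, ← add_sum_erase _ _ (mem_univ (0 : ZMod p)), sum_congr rfl h2, sum_const,
    card_erase_of_mem (mem_univ _), card_univ, ZMod.card]
  have : ((univ : Finset (ZMod p)).filter (fun z => z ^ 2 + (0 : ZMod p) ^ 2 = 0)) = {0} := by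
    ext z; simp
  rw [this]
  simp
  omega

/-- counting pairs with `m (a^2 + b^2)` in a set of classes -/
lemma local_sum (p : ℕ) [Fact p.Prime] (m : ℕ) (hm : ¬ p ∣ m) (C : Finset (ZMod p)) :
    ∑ a ∈ range p, ∑ b ∈ range p,
      (if (m : ZMod p) * ((a : ZMod p) ^ 2 + (b : ZMod p) ^ 2) ∈ C then (1 : ℝ) else 0) =
      ∑ j ∈ C, (rep p (j / m) : ℝ) := by
  have hm0 : (m : ZMod p) ≠ 0 := by rwa [Ne, ZMod.natCast_eq_zero_iff]
  have e1 : ∀ a ∈ range p, ∑ b ∈ range p,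
      (if (m : ZMod p) * ((a : ZMod p) ^ 2 + (b : ZMod p) ^ 2) ∈ C then (1 : ℝ) else 0) =
      (fun z : ZMod p => ∑ w : ZMod p, if (m : ZMod p) * (z ^ 2 + w ^ 2) ∈ C then (1 : ℝ) else 0) a := by
    intro a _
    exact sum_range_zmod p (fun w => if (m : ZMod p) * ((a : ZMod p) ^ 2 + w ^ 2) ∈ C then (1 : ℝ) else 0)
  rw [sum_congr rfl e1, sum_range_zmod p (fun z : ZMod p => ∑ w : ZMod p, if (m : ZMod p) * (z ^ 2 + w ^ 2) ∈ C then (1 : ℝ) else 0)]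
  have e2 : ∀ z w : ZMod p, (if (m : ZMod p) * (z ^ 2 + w ^ 2) ∈ C then (1 : ℝ) else 0) =
      ∑ j ∈ C, if z ^ 2 + w ^ 2 = j / m then (1 : ℝ) else 0 := by
    intro z w
    have : ∀ j, (z ^ 2 + w ^ 2 = j / m) ↔ (m : ZMod p) * (z ^ 2 + w ^ 2) = j := by
      intro j
      rw [eq_div_iff hm0, mul_comm]
    simp only [this, sum_ite_eq]
  simp only [e2]
  have e3 : ∀ j : ZMod p, (rep p j : ℝ) = ∑ z : ZMod p, ∑ w : ZMod p, if z ^ 2 + w ^ 2 = j then (1 : ℝ) else 0 := by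
    intro j
    unfold rep
    rw [card_filter, Fintype.sum_prod_type]
    push_cast
    rfl
  simp only [e3]
  rw [sum_congr rfl (fun z _ => sum_comm), sum_comm]

end VS

open Finset Filter Topology
namespace VS

/-- representations by two integer squares -/
noncomputable def AA (n : ℕ) : Finset (ℤ × ℤ) :=
  ((Icc (-(n : ℤ)) n) ×ˢ (Icc (-(n : ℤ)) n)).filter (fun z => z.1 ^ 2 + z.2 ^ 2 = n)

lemma mem_AA {n : ℕ} {z : ℤ × ℤ} : z ∈ AA n ↔ z.1 ^ 2 + z.2 ^ 2 = n := by
  unfold AA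
  simp only [mem_filter, mem_product, mem_Icc, and_iff_right_iff_imp]
  intro h
  have h1 : ∀ x : ℤ, x ^ 2 ≤ n → -(n : ℤ) ≤ x ∧ x ≤ n := by
    intro x hx
    have h2 := Int.le_self_sq x
    have h3 := Int.le_self_sq (-x)
    rw [neg_sq] at h3
    constructor <;> linarith
  exact ⟨h1 _ (by nlinarith [sq_nonneg z.2]), h1 _ (by nlinarith [sq_nonneg z.1])⟩

lemma AA_one : (AA 1).card ≤ 4 := by
  have : AA 1 ⊆ {(1, 0), (-1, 0), (0, 1), (0, -1)} := by
    rintro ⟨a, b⟩ h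
    rw [mem_AA] at h
    simp only [Nat.cast_one] at h
    have h1 : -1 ≤ a ∧ a ≤ 1 := by constructor <;> nlinarith [sq_nonneg b]
    have h2 : -1 ≤ b ∧ b ≤ 1 := by constructor <;> nlinarith [sq_nonneg a]
    obtain ⟨h1, h1'⟩ := h1
    obtain ⟨h2, h2'⟩ := h2
    interval_cases a <;> interval_cases b <;> simp at h ⊢
  exact (card_le_card this).trans (by decide)

lemma AA_two (n : ℕ) : (AA (2 * n)).card ≤ (AA n).card := by
  have : AA (2 * n) ⊆ (AA n).image (fun z => (z.1 + z.2, z.1 - z.2)) := by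
    rintro ⟨a, b⟩ h
    rw [mem_AA] at h
    push_cast at h
    have hpar : (a + b) % 2 = 0 := by
      have h1 : (a ^ 2 + b ^ 2) % 2 = 0 := by omega
      rcases Int.emod_two_eq_zero_or_one a with ha | ha <;>
        rcases Int.emod_two_eq_zero_or_one b with hb | hb <;>
        simp [pow_two, Int.add_emod, Int.mul_emod, ha, hb] at h1 ⊢
    obtain ⟨c, hc⟩ : ∃ c, a + b = 2 * c := ⟨(a + b) / 2, by omega⟩
    rw [mem_image]
    refine ⟨(c, c - b), ?_, ?_⟩
    · rw [mem_AA]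
      have ha : a = 2 * c - b := by linarith
      subst ha
      simp only at h ⊢
      nlinarith
    · ext <;> simp; linarith
  exact (card_le_card this).trans card_image_le

lemma AA_three (p : ℕ) (hp : p.Prime) (hp3 : p % 4 = 3) (n : ℕ) (hn : n ≠ 0) (hpn : p ∣ n)
    (hne : (AA n).Nonempty) : ∃ m, n = p ^ 2 * m ∧ (AA n).card ≤ (AA m).card := by
  have key : ∀ z ∈ AA n, (p : ℤ) ∣ z.1 ∧ (p : ℤ) ∣ z.2 := by
    rintro ⟨a, b⟩ h
    rw [mem_AA] at h
    haveI : Fact p.Prime := ⟨hp⟩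
    have h0 : (n : ZMod p) = 0 := (ZMod.natCast_eq_zero_iff _ _).2 hpn
    have h1 : ((a : ZMod p)) ^ 2 + (b : ZMod p) ^ 2 = 0 := by
      have := congrArg (Int.cast : ℤ → ZMod p) h
      push_cast at this
      rw [this, h0]
    have h2 := rep_zero3 p hp3
    unfold rep at h2
    rw [card_eq_one] at h2
    obtain ⟨w, hw⟩ := h2
    have h3 : ((a : ZMod p), (b : ZMod p)) ∈ ({w} : Finset (ZMod p × ZMod p)) := by
      rw [← hw]; simp [h1]
    have h4 : ((0 : ZMod p), (0 : ZMod p)) ∈ ({w} : Finset (ZMod p × ZMod p)) := by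
      rw [← hw]; simp
    have h5 := (mem_singleton.1 h3).trans (mem_singleton.1 h4).symm
    simp only [Prod.mk.injEq] at h5
    exact ⟨(ZMod.intCast_zmod_eq_zero_iff_dvd _ _).1 h5.1, (ZMod.intCast_zmod_eq_zero_iff_dvd _ _).1 h5.2⟩
  obtain ⟨⟨a, b⟩, hz⟩ := hne
  obtain ⟨⟨a', ha⟩, ⟨b', hb⟩⟩ := key _ hz
  simp only at ha hb
  have hp0 : (p : ℤ) ≠ 0 := by exact_mod_cast hp.ne_zero
  have hm : (n : ℤ) = (p : ℤ) ^ 2 * (a' ^ 2 + b' ^ 2) := by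
    rw [mem_AA] at hz
    simp only [ha, hb] at hz
    rw [← hz]; ring
  obtain ⟨m, hm'⟩ : ∃ m : ℕ, (m : ℤ) = a' ^ 2 + b' ^ 2 :=
    ⟨(a' ^ 2 + b' ^ 2).toNat, Int.toNat_of_nonneg (by positivity)⟩
  rw [← hm'] at hm
  refine ⟨m, by exact_mod_cast hm, ?_⟩
  have : AA n ⊆ (AA m).image (fun z => (p * z.1, p * z.2)) := by
    rintro ⟨c, d⟩ h
    obtain ⟨⟨c', hc⟩, ⟨d', hd⟩⟩ := key _ h
    simp only at hc hd
    rw [mem_image]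
    refine ⟨(c', d'), ?_, by simp [hc, hd]⟩
    rw [mem_AA] at h ⊢
    simp only [hc, hd] at h ⊢
    have : (p : ℤ) ^ 2 * (c' ^ 2 + d' ^ 2) = (p : ℤ) ^ 2 * m := by rw [← hm, ← h]; ring
    exact mul_left_cancel₀ (pow_ne_zero 2 hp0) this
  exact (card_le_card this).trans card_image_le

lemma AA_p1 (p : ℕ) (hp : p.Prime) (hp1 : p % 4 = 1) (n : ℕ) :
    (AA (p * n)).card ≤ 2 * (AA n).card := by
  have : Fact p.Prime := ⟨hp⟩
  obtain ⟨s, t, hst⟩ := Nat.Prime.sq_add_sq (p := p) (by omega)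
  have hst' : (s : ℤ) ^ 2 + (t : ℤ) ^ 2 = p := by exact_mod_cast hst
  have hp0 : (p : ℤ) ≠ 0 := by exact_mod_cast hp.ne_zero
  have hpp : Prime (p : ℤ) := Nat.prime_iff_prime_int.1 hp
  have half : ∀ t : ℤ, (s : ℤ) ^ 2 + t ^ 2 = p → ∀ a b : ℤ, a ^ 2 + b ^ 2 = p * n →
      (p : ℤ) ∣ a * s + b * t →
      (a, b) ∈ (AA n).image (fun z => (z.1 * s + z.2 * t, z.1 * t - z.2 * s)) := by
    intro t ht a b hab hd
    have hd2 : (p : ℤ) ∣ a * t - b * s := by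
      apply hpp.dvd_of_dvd_pow (n := 2)
      have : (a * t - b * s) ^ 2 = p * (p * n) - (a * s + b * t) ^ 2 := by
        rw [← hab, ← ht]; ring
      rw [this]
      exact dvd_sub (dvd_mul_right _ _) (dvd_pow hd (by norm_num))
    obtain ⟨c, hc⟩ := hd
    obtain ⟨d, hd⟩ := hd2
    rw [mem_image]
    refine ⟨(c, d), ?_, ?_⟩
    · rw [mem_AA]
      have : (p : ℤ) ^ 2 * (c ^ 2 + d ^ 2) = (p : ℤ) ^ 2 * n := by
        calc (p : ℤ) ^ 2 * (c ^ 2 + d ^ 2) = (p * c) ^ 2 + (p * d) ^ 2 := by ring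
          _ = (a * s + b * t) ^ 2 + (a * t - b * s) ^ 2 := by rw [hc, hd]
          _ = (s ^ 2 + t ^ 2) * (a ^ 2 + b ^ 2) := by ring
          _ = _ := by rw [ht, hab]; ring
      exact mul_left_cancel₀ (pow_ne_zero 2 hp0) this
    · simp only [Prod.mk.injEq]
      constructor
      · apply mul_left_cancel₀ hp0
        calc (p : ℤ) * (c * s + d * t) = (p * c) * s + (p * d) * t := by ring
          _ = (s ^ 2 + t ^ 2) * a := by rw [← hc, ← hd]; ring
          _ = _ := by rw [ht]
      · apply mul_left_cancel₀ hp0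
        calc (p : ℤ) * (c * t - d * s) = (p * c) * t - (p * d) * s := by ring
          _ = (s ^ 2 + t ^ 2) * b := by rw [← hc, ← hd]; ring
          _ = _ := by rw [ht]
  have : AA (p * n) ⊆ (AA n).image (fun z => (z.1 * s + z.2 * t, z.1 * t - z.2 * s)) ∪
      (AA n).image (fun z => (z.1 * s + z.2 * (-t), z.1 * (-t) - z.2 * s)) := by
    rintro ⟨a, b⟩ h
    rw [mem_AA] at h
    push_cast at h
    have hd : (p : ℤ) ∣ (a * s + b * t) * (a * s + b * (-t)) := by
      have : (a * s + b * t) * (a * s + b * (-t)) = p * (n * s ^ 2 - b ^ 2) := by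
        have e : (a * s + b * t) * (a * s + b * (-t)) = (a ^ 2 + b ^ 2) * s ^ 2 - b ^ 2 * (s ^ 2 + t ^ 2) := by ring
        rw [e, h, hst']; ring
      rw [this]; exact dvd_mul_right _ _
    rw [mem_union]
    rcases hpp.dvd_or_dvd hd with hd | hd
    · left; exact half t hst' a b h hd
    · right; exact half (-t) (by rw [neg_sq]; exact hst') a b h hd
  calc (AA (p * n)).card ≤ _ := card_le_card this
    _ ≤ _ := card_union_le _ _
    _ ≤ (AA n).card + (AA n).card := Nat.add_le_add card_image_le card_image_le
    _ = _ := by ring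

lemma AA_bound (v : ℕ) : ∀ n : ℕ, 1 ≤ n → (∀ p : ℕ, p.Prime → p % 4 = 1 → p ∣ n → v ≤ p) →
    ∃ j, (AA n).card ≤ 4 * 2 ^ j ∧ v ^ j ≤ n := by
  intro n
  induction n using Nat.strong_induction_on with
  | _ n ih =>
  intro hn hv
  by_cases h1 : n = 1
  · exact ⟨0, by rw [h1]; exact AA_one, by simpa using hn⟩
  obtain ⟨p, hp, hpn⟩ := Nat.exists_prime_and_dvd h1
  have hp2 := hp.two_le
  by_cases hE : (AA n).Nonempty
  swap
  · refine ⟨0, ?_, by simpa using hn⟩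
    rw [not_nonempty_iff_eq_empty.1 hE]; simp
  have h4 : p = 2 ∨ p % 4 = 1 ∨ p % 4 = 3 := by
    rcases hp.eq_two_or_odd with h | h
    · left; exact h
    · right; omega
  rcases h4 with h4 | h4 | h4
  · subst h4
    obtain ⟨m, rfl⟩ := hpn
    obtain ⟨j, hj1, hj2⟩ := ih m (by omega) (by omega)
      (fun q hq hq1 hqm => hv q hq hq1 (hqm.mul_left 2))
    exact ⟨j, (AA_two m).trans hj1, by omega⟩
  · obtain ⟨m, rfl⟩ := hpn
    have hm : 1 ≤ m := by
      rcases Nat.eq_zero_or_pos m with h | h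
      · subst h; simp at hn
      · exact h
    obtain ⟨j, hj1, hj2⟩ := ih m (by nlinarith) hm
      (fun q hq hq1 hqm => hv q hq hq1 (hqm.mul_left p))
    refine ⟨j + 1, ?_, ?_⟩
    · have := AA_p1 p hp h4 m
      rw [pow_succ]; omega
    · have := hv p hp h4 (dvd_mul_right _ _)
      rw [pow_succ, mul_comm p]
      exact Nat.mul_le_mul hj2 this
  · obtain ⟨m, hm, hc⟩ := AA_three p hp h4 n (by omega) hpn hE
    have hm1 : 1 ≤ m := by
      rcases Nat.eq_zero_or_pos m with h | h
      · subst h; simp at hm; omega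
      · exact h
    have hlt : m < n := by
      have h5 : 4 ≤ p ^ 2 := by nlinarith
      rw [hm]; nlinarith
    obtain ⟨j, hj1, hj2⟩ := ih m hlt hm1
      (fun q hq hq1 hqm => hv q hq hq1 (hm ▸ hqm.mul_left _))
    exact ⟨j, hc.trans hj1, hj2.trans hlt.le⟩

end VS

open Finset Filter Topology
namespace VS

lemma greedy_step (H : Finset ℕ) (p : ℕ) (hp : 0 < p) :
    ∃ c : ℕ, (H.card : ℝ) * (1 - 1 / (p : ℝ)) ≤ ((H.filter (fun h => ¬ p ∣ c + h)).card : ℝ) := by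
  by_contra hcon
  push Not at hcon
  have h1 : ∑ c ∈ range p, ((H.filter (fun h => p ∣ c + h)).card : ℝ) = H.card := by
    simp only [card_filter]
    push_cast
    rw [sum_comm]
    have : ∀ h ∈ H, ∑ c ∈ range p, (if p ∣ c + h then (1 : ℝ) else 0) = 1 := by
      intro h _
      have h2 := Nat.mod_lt h hp
      rw [sum_eq_single ((p - h % p) % p)]
      · rw [if_pos]
        rw [Nat.dvd_iff_mod_eq_zero, Nat.add_mod, Nat.mod_mod]
        rcases Nat.eq_zero_or_pos (h % p) with h0 | h0
        · rw [h0]; simp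
        · rw [Nat.mod_eq_of_lt (by omega : p - h % p < p)]
          rw [Nat.sub_add_cancel h2.le, Nat.mod_self]
      · intro b hb hne
        rw [if_neg]
        intro hd
        apply hne
        have hb' := mem_range.1 hb
        have h3 : p ∣ b + h % p := by
          have : b + h = (b + h % p) + p * (h / p) := by have := Nat.mod_add_div h p; omega
          rw [this] at hd
          exact (Nat.dvd_add_left (dvd_mul_right _ _)).1 hd
        obtain ⟨t, ht⟩ := h3
        have : t < 2 := by
          by_contra hh
          have : 2 ≤ t := by omega
          nlinarith
        interval_cases t
        · have : h % p = 0 := by omega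
          rw [this]; simp; omega
        · rw [Nat.mod_eq_of_lt (by omega : p - h % p < p)]; omega
      · intro hh
        exact absurd (mem_range.2 (Nat.mod_lt _ hp)) hh
    rw [sum_congr rfl this]; simp
  have h2 : ∀ c, ((H.filter (fun h => p ∣ c + h)).card : ℝ) =
      H.card - ((H.filter (fun h => ¬ p ∣ c + h)).card : ℝ) := by
    intro c
    rw [eq_sub_iff_add_eq]
    exact_mod_cast card_filter_add_card_filter_not (s := H) (fun h => p ∣ c + h)
  have h3 : ∑ c ∈ range p, ((H.card : ℝ) * (1 / p)) < ∑ c ∈ range p, ((H.filter (fun h => p ∣ c + h)).card : ℝ) := by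
    apply sum_lt_sum_of_nonempty
    · exact nonempty_range_iff.2 hp.ne'
    · intro c _
      have := hcon c
      rw [h2]; linarith
  rw [h1, sum_const, card_range, nsmul_eq_mul] at h3
  have : (p : ℝ) ≠ 0 := by positivity
  have e : (p : ℝ) * ((H.card : ℝ) * (1 / p)) = H.card := by field_simp
  linarith

lemma greedy (L : ℕ) (P : Finset ℕ) (hP : ∀ p ∈ P, 2 ≤ p) :
    ∃ H ⊆ Icc 1 L, ∃ r : ℕ → ℕ, (∀ p ∈ P, ∀ h ∈ H, ¬ p ∣ r p + h) ∧
      (L : ℝ) * ∏ p ∈ P, (1 - 1 / (p : ℝ)) ≤ H.card := by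
  induction P using Finset.induction_on with
  | empty => exact ⟨Icc 1 L, subset_rfl, fun _ => 0, by simp, by simp⟩
  | insert q P hq ih =>
    obtain ⟨H, hH, r, hr, hc⟩ := ih (fun p hp => hP p (mem_insert_of_mem hp))
    have hq2 := hP q (mem_insert_self _ _)
    obtain ⟨c, hcc⟩ := greedy_step H q (by omega)
    refine ⟨H.filter (fun h => ¬ q ∣ c + h), (filter_subset _ _).trans hH,
      Function.update r q c, ?_, ?_⟩
    · intro p hp h hh
      rw [mem_filter] at hh
      by_cases hpq : p = q
      · subst hpq; simpa using hh.2
      · rw [Function.update_of_ne hpq]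
        exact hr p (mem_of_mem_insert_of_ne hp hpq) h hh.1
    · rw [prod_insert hq]
      refine le_trans ?_ hcc
      have h0 : (0 : ℝ) ≤ 1 - 1 / q := by
        rw [sub_nonneg, div_le_one (by positivity)]
        exact_mod_cast (by omega : 1 ≤ q)
      nlinarith

/-- multiplicity of the representation `n = m (a^2 + b^2)` -/
lemma mult (v n : ℕ) (hn : 1 ≤ n) (E : Finset (ℕ × ℕ × ℕ))
    (hE : ∀ z ∈ E, z.1 ∈ M1 v ∧ z.1 * (z.2.1 ^ 2 + z.2.2 ^ 2) = n ∧
      ∀ p : ℕ, p.Prime → p % 4 = 1 → p ≤ v → ¬ p ∣ z.2.1 ^ 2 + z.2.2 ^ 2) :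
    ∃ j, E.card ≤ 4 * 2 ^ j ∧ v ^ j ≤ n := by
  rcases E.eq_empty_or_nonempty with h0 | ⟨z0, hz0⟩
  · exact ⟨0, by simp [h0], by simpa using hn⟩
  have hdiv : ∀ z ∈ E, ∀ z' ∈ E, z.1 ∣ z'.1 := by
    intro z hz z' hz'
    obtain ⟨h1, h2, h3⟩ := hE z hz
    obtain ⟨h1', h2', h3'⟩ := hE z' hz'
    have hco : Nat.Coprime z.1 (z'.2.1 ^ 2 + z'.2.2 ^ 2) := by
      apply Nat.coprime_of_dvd
      intro p hp hpz hps
      rw [mem_M1] at h1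
      exact h3' p hp (h1.2 p hp hpz) ((Nat.le_of_dvd (by omega) hpz).trans h1.1.2) hps
    apply hco.dvd_of_dvd_mul_right
    rw [h2', ← h2]
    exact dvd_mul_right _ _
  obtain ⟨g1, g2, g3⟩ := hE z0 hz0
  set s := z0.2.1 ^ 2 + z0.2.2 ^ 2 with hs
  have hm0 := (mem_M1.1 g1).1.1
  have hall : ∀ z ∈ E, z.1 = z0.1 ∧ z.2.1 ^ 2 + z.2.2 ^ 2 = s := by
    intro z hz
    have e := Nat.dvd_antisymm (hdiv z hz z0 hz0) (hdiv z0 hz0 z hz)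
    refine ⟨e, ?_⟩
    have := (hE z hz).2.1
    rw [e, ← g2] at this
    exact Nat.eq_of_mul_eq_mul_left (by omega) this
  have hs1 : 1 ≤ s := by
    rcases Nat.eq_zero_or_pos s with h | h
    · rw [h] at g2; simp at g2; omega
    · exact h
  obtain ⟨j, hj1, hj2⟩ := AA_bound v s hs1 (by
    intro p hp hp1 hps
    by_contra hh
    exact g3 p hp hp1 (by omega) hps)
  refine ⟨j, le_trans ?_ hj1, hj2.trans ?_⟩
  · apply card_le_card_of_injOn (fun z => ((z.2.1 : ℤ), (z.2.2 : ℤ)))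
    · intro z hz
      have := (hall z hz).2
      rw [mem_coe, mem_AA]
      show (z.2.1 : ℤ) ^ 2 + (z.2.2 : ℤ) ^ 2 = s
      exact_mod_cast this
    · intro z hz z' hz' he
      simp only [Prod.mk.injEq, Nat.cast_inj] at he
      ext
      · rw [(hall z hz).1, (hall z' hz').1]
      · exact he.1
      · exact he.2
  · rw [← g2]; nlinarith

end VS

open Finset Filter Topology
namespace VS

/-- blocks of primes `3 mod 4` above `L` -/
def SB (L i : ℕ) : Finset ℕ := (Bk i).filter (fun p => p % 4 = 3 ∧ L < p)
/-- blocks of primes `1 mod 4` -/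
def RB (i : ℕ) : Finset ℕ := (Bk i).filter (fun p => p % 4 = 1)

lemma mem_SB {L i p : ℕ} (h : p ∈ SB L i) : p ∈ Bk i ∧ p.Prime ∧ p % 4 = 3 ∧ L < p := by
  rw [SB, mem_filter] at h
  exact ⟨h.1, (mem_Bk.1 h.1).1.2, h.2⟩

lemma mem_RB {i p : ℕ} (h : p ∈ RB i) : p ∈ Bk i ∧ p.Prime ∧ p % 4 = 1 := by
  rw [RB, mem_filter] at h
  exact ⟨h.1, (mem_Bk.1 h.1).1.2, h.2⟩

lemma SB_disj (L : ℕ) (i j : ℕ) (h : i ≠ j) : Disjoint (SB L i) (SB L j) :=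
  disjoint_of_subset_left (filter_subset _ _) (disjoint_of_subset_right (filter_subset _ _) (Bk_disj h))

lemma RB_disj (i j : ℕ) (h : i ≠ j) : Disjoint (RB i) (RB j) :=
  disjoint_of_subset_left (filter_subset _ _) (disjoint_of_subset_right (filter_subset _ _) (Bk_disj h))

open Classical in
/-- event: `p` divides one of the `x + h` -/
noncomputable def eX (H : Finset ℕ) (x p : ℕ) : ℝ := if ∃ h ∈ H, p ∣ x + h then 1 else 0

open Classical in
/-- the progression -/
noncomputable def Om (L : ℕ) (r : ℕ → ℕ) (A N : ℕ) : Finset ℕ :=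
  (Ico A (A + N)).filter (fun x => ∀ p ∈ Q 3 L, (x : ZMod p) = (r p : ZMod p))

/-- the product of the primes `3 mod 4` up to `L` -/
def P0 (L : ℕ) : ℕ := ∏ p ∈ Q 3 L, p

lemma P0_pos (L : ℕ) : 0 < P0 L := prod_pos (fun p hp => (mem_Q.1 hp).2.1.pos)

lemma P0_le (L : ℕ) : P0 L ≤ 4 ^ L := by
  refine le_trans ?_ (primorial_le_four_pow L)
  unfold P0 primorial
  apply prod_le_prod_of_subset_of_one_le'
  · intro p hp
    have := mem_Q.1 hp
    rw [mem_filter, mem_range]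
    exact ⟨by omega, this.2.1⟩
  · intro p hp _
    exact (mem_filter.1 hp).2.one_lt.le

lemma eX_01 (H : Finset ℕ) (x p : ℕ) : 0 ≤ eX H x p ∧ eX H x p ≤ 1 := by
  unfold eX; split_ifs <;> norm_num

lemma eX_eq (H : Finset ℕ) (x p : ℕ) :
    eX H x p = if (x : ZMod p) ∈ H.image (fun h : ℕ => -(h : ZMod p)) then 1 else 0 := by
  unfold eX
  congr 1
  simp only [mem_image, eq_iff_iff]
  constructor
  · rintro ⟨h, hh, hd⟩
    refine ⟨h, hh, ?_⟩
    rw [← ZMod.natCast_eq_zero_iff] at hd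
    push_cast at hd
    exact (eq_neg_of_add_eq_zero_left hd).symm
  · rintro ⟨h, hh, hd⟩
    refine ⟨h, hh, ?_⟩
    rw [← ZMod.natCast_eq_zero_iff]
    push_cast
    rw [← hd]; ring

lemma H_inj {L p : ℕ} {H : Finset ℕ} (hH : H ⊆ Icc 1 L) (hp : L < p) :
    Set.InjOn (fun h : ℕ => (h : ZMod p)) H := by
  intro a ha b hb hab
  have ha' := mem_Icc.1 (hH ha)
  have hb' := mem_Icc.1 (hH hb)
  have := (ZMod.natCast_eq_natCast_iff' _ _ _).1 hab
  rwa [Nat.mod_eq_of_lt (by omega), Nat.mod_eq_of_lt (by omega)] at this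

lemma sum_zmod_mem (p : ℕ) [NeZero p] (C : Finset (ZMod p)) :
    ∑ a ∈ range p, (if (a : ZMod p) ∈ C then (1 : ℝ) else 0) = C.card := by
  rw [sum_range_zmod p (fun z => if z ∈ C then (1 : ℝ) else 0)]
  simp

/-- mod p congruence selector for the `x`-sum -/
noncomputable def fX (L : ℕ) (H : Finset ℕ) (r : ℕ → ℕ) (q x : ℕ) : ℝ :=
  if (x : ZMod q) ∈ (if q ≤ L then {(r q : ZMod q)} else H.image (fun h : ℕ => -(h : ZMod q))) then 1 else 0

lemma coprime_of_primes {s : Finset ℕ} (h : ∀ q ∈ s, q.Prime) :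
    ∀ q ∈ s, ∀ q' ∈ s, q ≠ q' → Nat.Coprime q q' :=
  fun q hq q' hq' hne => (Nat.coprime_primes (h q hq) (h q' hq')).2 hne

lemma level_X (L : ℕ) (H : Finset ℕ) (hH : H ⊆ Icc 1 L) (r : ℕ → ℕ) (A N : ℕ) (T : Finset ℕ)
    (hT : ∀ p ∈ T, p.Prime ∧ L < p) :
    |∑ x ∈ Om L r A N, ∏ p ∈ T, eX H x p - (N / (P0 L : ℝ)) * ∏ p ∈ T, ((H.card : ℝ) / p)| ≤
      (P0 L : ℝ) * ((∏ p ∈ T, p : ℕ) : ℝ) := by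
  have hdisj : Disjoint (Q 3 L) T := by
    rw [disjoint_left]
    intro p hp hpT
    have := (mem_Q.1 hp).1
    have := (hT p hpT).2
    omega
  have hprime : ∀ q ∈ Q 3 L ∪ T, q.Prime := by
    intro q hq
    rcases mem_union.1 hq with h | h
    · exact (mem_Q.1 h).2.1
    · exact (hT q h).1
  have h1 := count1 (Q 3 L ∪ T) (fun q hq => (hprime q hq).pos) (coprime_of_primes hprime)
    (fX L H r) (by
      intro q _ a
      unfold fX
      rw [ZMod.natCast_mod]) (by intro q a; unfold fX; split_ifs <;> norm_num) A N
  rw [prod_union hdisj, prod_union hdisj] at h1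
  have e1 : ∑ a ∈ Ico A (A + N), ∏ q ∈ Q 3 L ∪ T, fX L H r q a = ∑ x ∈ Om L r A N, ∏ p ∈ T, eX H x p := by
    unfold Om
    rw [sum_filter]
    apply sum_congr rfl
    intro x _
    rw [prod_union hdisj]
    have e2 : ∏ q ∈ T, fX L H r q x = ∏ q ∈ T, eX H x q := by
      apply prod_congr rfl
      intro q hq
      have hq' : ¬ q ≤ L := not_le.2 (hT q hq).2
      rw [eX_eq, fX, if_neg hq']
    rw [e2]
    split_ifs with hx
    · rw [prod_eq_one, one_mul]
      intro q hq
      rw [fX, if_pos (mem_Q.1 hq).1, if_pos (mem_singleton.2 (hx q hq))]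
    · push Not at hx
      obtain ⟨q, hq, hne⟩ := hx
      rw [prod_eq_zero hq, zero_mul]
      rw [fX, if_pos (mem_Q.1 hq).1, if_neg (by rwa [mem_singleton])]
  have e3 : ∏ q ∈ Q 3 L, ((∑ a ∈ range q, fX L H r q a) / (q : ℝ)) = 1 / (P0 L : ℝ) := by
    unfold P0
    push_cast
    rw [one_div, ← prod_inv_distrib]
    apply prod_congr rfl
    intro q hq
    have : NeZero q := ⟨(mem_Q.1 hq).2.1.ne_zero⟩
    have : ∑ a ∈ range q, fX L H r q a = 1 := by
      unfold fX
      rw [sum_zmod_mem, if_pos (mem_Q.1 hq).1]; simp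
    rw [this, one_div]
  have e4 : ∏ q ∈ T, ((∑ a ∈ range q, fX L H r q a) / (q : ℝ)) = ∏ p ∈ T, ((H.card : ℝ) / p) := by
    apply prod_congr rfl
    intro q hq
    have : NeZero q := ⟨(hT q hq).1.ne_zero⟩
    have : ∑ a ∈ range q, fX L H r q a = H.card := by
      unfold fX
      rw [sum_zmod_mem, if_neg (by have := (hT q hq).2; omega), card_image_of_injOn]
      intro a ha b hb hab
      exact H_inj hH (hT q hq).2 ha hb (neg_injective hab)
    rw [this]
  rw [e1, e3, e4] at h1
  calc _ = _ := by congr 2; ring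
    _ ≤ _ := h1
    _ = _ := by unfold P0; push_cast; rfl

/-- local densities -/
lemma SB_mass (L i : ℕ) (c : ℝ) (hc : 0 ≤ c) (g : ℕ → ℝ) (hg : ∀ p ∈ SB L i, g p ≤ c / p) :
    ∑ p ∈ SB L i, g p ≤ 4 * c := by
  calc ∑ p ∈ SB L i, g p ≤ ∑ p ∈ SB L i, c * (1 / (p : ℝ)) := by
        apply sum_le_sum; intro p hp; rw [mul_one_div]; exact hg p hp
    _ ≤ ∑ p ∈ Bk i, c * (1 / (p : ℝ)) :=
        sum_le_sum_of_subset_of_nonneg (filter_subset _ _) (fun _ _ _ => by positivity)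
    _ = c * ∑ p ∈ Bk i, (1 / (p : ℝ)) := by rw [mul_sum]
    _ ≤ c * 4 := by gcongr; exact sum_Bk_le i
    _ = _ := by ring

noncomputable def wX (J L : ℕ) (H : Finset ℕ) (x : ℕ) : ℝ := WW J H.card (SB L) (eX H x)
noncomputable def V0 (J L : ℕ) (H : Finset ℕ) : ℝ := VV J (SB L) (fun p => (H.card : ℝ) / p)
def DS (J κ : ℕ) : ℕ := 2 ^ (81 * (2 ^ (J + 1) * (κ + 2)))

lemma wX_nonneg (J L : ℕ) (H : Finset ℕ) (x : ℕ) : 0 ≤ wX J L H x := by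
  have := WW_ge J H.card (SB L) (eX H x) (fun i _ p _ => eX_01 H x p)
  exact this.1.trans this.2

lemma g_half {L p k : ℕ} (hk : 2 * k ≤ L + 1) (hp : L < p) : 0 ≤ (k : ℝ) / p ∧ (k : ℝ) / p ≤ 1 / 2 := by
  have hp0 : (0 : ℝ) < p := by exact_mod_cast (by omega : 0 < p)
  refine ⟨by positivity, ?_⟩
  rw [div_le_div_iff₀ hp0 (by norm_num)]
  exact_mod_cast (by omega : k * 2 ≤ 1 * p)

lemma SB_poly_sub {J L : ℕ} {T : Finset ℕ} (hT : T ⊆ (range J).biUnion (SB L)) :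
    ∀ p ∈ T, p.Prime ∧ p % 4 = 3 ∧ L < p := by
  intro p hp
  obtain ⟨i, _, hi⟩ := mem_biUnion.1 (hT hp)
  have := mem_SB hi
  exact ⟨this.2.1, this.2.2⟩

lemma upperW (J L : ℕ) (H : Finset ℕ) (hH : H ⊆ Icc 1 L) (hk : 2 * H.card ≤ L + 1) (r : ℕ → ℕ)
    (A N : ℕ) :
    ∑ x ∈ Om L r A N, wX J L H x ≤ (N / (P0 L : ℝ)) * (2 * V0 J L H) +
      (DS J H.card : ℝ) * ((P0 L : ℝ) * DS J H.card) := by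
  have hpoly := Poly.WW J H.card (SB L) (fun i => filter_subset _ _) (SB_disj L)
  have h1 := hpoly.eval (Om L r A N) (eX H) (fun p => (H.card : ℝ) / p) (N / (P0 L : ℝ))
    ((P0 L : ℝ) * DS J H.card) (by positivity) (by
      intro T hT hD
      refine (level_X L H hH r A N T ?_).trans ?_
      · intro p hp
        have := SB_poly_sub hT p hp
        exact ⟨this.1, this.2.2⟩
      · gcongr
        exact hD)
  have h2 := (dens J H.card (SB L) (fun p => (H.card : ℝ) / p)
    (fun i _ p hp => g_half hk (mem_SB hp).2.2.2) (by
      intro i _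
      have := SB_mass L i H.card (by positivity) _ (fun p _ => le_rfl)
      have h0 : (0 : ℝ) ≤ H.card := by positivity
      linarith)).2.1
  have h3 := (abs_le.1 h1).2
  have h4 : (N / (P0 L : ℝ)) * WW J H.card (SB L) (fun p => (H.card : ℝ) / p) ≤
      (N / (P0 L : ℝ)) * (2 * V0 J L H) := by
    gcongr; exact h2
  have h5 : ∑ x ∈ Om L r A N, wX J L H x = ∑ x ∈ Om L r A N, WW J H.card (SB L) (eX H x) := rfl
  rw [h5]
  have h6 : ((2 ^ (81 * (2 ^ (J + 1) * (H.card + 2))) : ℕ) : ℝ) = (DS J H.card : ℝ) := rfl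
  rw [h6] at h3
  linarith

end VS

open Finset Filter Topology
namespace VS

def mu (m q : ℕ) : ℕ := if q % 4 = 1 then 1 else m

def Cl (L : ℕ) (H : Finset ℕ) (r : ℕ → ℕ) (h q : ℕ) : Finset (ZMod q) :=
  if q % 4 = 1 then {0} else if q ≤ L then {(h : ZMod q) + (r q : ZMod q)} else
    H.image (fun h' : ℕ => (h : ZMod q) - (h' : ZMod q))

noncomputable def fY (L : ℕ) (H : Finset ℕ) (r : ℕ → ℕ) (m h q a b : ℕ) : ℝ :=
  if (mu m q : ZMod q) * ((a : ZMod q) ^ 2 + (b : ZMod q) ^ 2) ∈ Cl L H r h q then 1 else 0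

noncomputable def gY (k p : ℕ) : ℝ :=
  if p % 4 = 1 then (2 * (p : ℝ) - 1) / (p : ℝ) ^ 2 else (((k : ℝ) - 1) * (p + 1) + 1) / (p : ℝ) ^ 2

open Classical in
noncomputable def OmY (L : ℕ) (r : ℕ → ℕ) (m h N : ℕ) : Finset (ℕ × ℕ) :=
  ((Ico (11 * N) (11 * N + N)) ×ˢ range N).filter (fun z => ∀ p ∈ Q 3 L,
    (m : ZMod p) * ((z.1 : ZMod p) ^ 2 + (z.2 : ZMod p) ^ 2) = (h : ZMod p) + (r p : ZMod p))

noncomputable def beta (L : ℕ) : ℝ := ∏ p ∈ Q 3 L, (((p : ℝ) + 1) / (p : ℝ) ^ 2)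

lemma fY_01 (L : ℕ) (H : Finset ℕ) (r : ℕ → ℕ) (m h q a b : ℕ) :
    0 ≤ fY L H r m h q a b ∧ fY L H r m h q a b ≤ 1 := by
  unfold fY; split_ifs <;> norm_num

lemma fY_sum0 (L : ℕ) (H : Finset ℕ) (r : ℕ → ℕ) (m h q : ℕ) (hq : q.Prime) (hq3 : q % 4 = 3)
    (hm : ¬ q ∣ m) (hqL : q ≤ L) (hr : ¬ q ∣ r q + h) :
    ∑ a ∈ range q, ∑ b ∈ range q, fY L H r m h q a b = (q : ℝ) + 1 := by
  have : Fact q.Prime := ⟨hq⟩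
  have hmu : mu m q = m := by unfold mu; rw [if_neg (by omega)]
  have hCl : Cl L H r h q = {(h : ZMod q) + (r q : ZMod q)} := by
    unfold Cl; rw [if_neg (by omega), if_pos hqL]
  simp only [fY, hmu, hCl]
  rw [local_sum q m hm, sum_singleton, rep_three q hq3]
  · push_cast; ring
  · have hm0 : (m : ZMod q) ≠ 0 := by rwa [Ne, ZMod.natCast_eq_zero_iff]
    apply div_ne_zero _ hm0
    intro h0
    apply hr
    rw [← ZMod.natCast_eq_zero_iff]
    push_cast
    rw [← h0]; ring

lemma fY_sum3 (L : ℕ) (H : Finset ℕ) (hH : H ⊆ Icc 1 L) (r : ℕ → ℕ) (m h q : ℕ) (hh : h ∈ H)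
    (hq : q.Prime) (hq3 : q % 4 = 3)
    (hm : ¬ q ∣ m) (hqL : L < q) :
    ∑ a ∈ range q, ∑ b ∈ range q, fY L H r m h q a b = ((H.card : ℝ) - 1) * (q + 1) + 1 := by
  have : Fact q.Prime := ⟨hq⟩
  have hmu : mu m q = m := by unfold mu; rw [if_neg (by omega)]
  have hCl : Cl L H r h q = H.image (fun h' : ℕ => (h : ZMod q) - (h' : ZMod q)) := by
    unfold Cl; rw [if_neg (by omega), if_neg (by omega)]
  simp only [fY, hmu, hCl]
  have hm0 : (m : ZMod q) ≠ 0 := by rwa [Ne, ZMod.natCast_eq_zero_iff]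
  rw [local_sum q m hm, sum_image, ← add_sum_erase _ _ hh]
  · have e : ∀ h' ∈ H.erase h, (rep q (((h : ZMod q) - (h' : ZMod q)) / m) : ℝ) = (q : ℝ) + 1 := by
      intro h' hh'
      rw [mem_erase] at hh'
      rw [rep_three q hq3]
      · push_cast; ring
      · apply div_ne_zero _ hm0
        rw [sub_ne_zero]
        intro heq
        exact hh'.1 (H_inj hH hqL hh'.2 hh heq.symm)
    rw [sum_congr rfl e, sub_self, zero_div, rep_zero3 q hq3, sum_const, card_erase_of_mem hh,
      nsmul_eq_mul, Nat.cast_sub (card_pos.2 ⟨h, hh⟩)]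
    push_cast; ring
  · intro a ha b hb hab
    exact H_inj hH hqL ha hb (sub_right_injective hab)

lemma fY_sum1 (L : ℕ) (H : Finset ℕ) (r : ℕ → ℕ) (m h q : ℕ) (hq : q.Prime) (hq1 : q % 4 = 1) :
    ∑ a ∈ range q, ∑ b ∈ range q, fY L H r m h q a b = 2 * (q : ℝ) - 1 := by
  have : Fact q.Prime := ⟨hq⟩
  have hmu : mu m q = 1 := by unfold mu; rw [if_pos hq1]
  have hCl : Cl L H r h q = {0} := by unfold Cl; rw [if_pos hq1]
  simp only [fY, hmu, hCl]
  rw [local_sum q 1 (by rw [Nat.dvd_one]; exact hq.one_lt.ne'), sum_singleton, zero_div, rep_zero1 q hq1,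
    Nat.cast_sub (by have := hq.pos; omega)]
  push_cast; ring

lemma level_Y (L : ℕ) (H : Finset ℕ) (hH : H ⊆ Icc 1 L) (r : ℕ → ℕ)
    (hr : ∀ p ∈ Q 3 L, ∀ h ∈ H, ¬ p ∣ r p + h) (m h N : ℕ) (hh : h ∈ H)
    (hm : ∀ p : ℕ, p.Prime → p % 4 = 3 → ¬ p ∣ m) (T : Finset ℕ)
    (hT : ∀ p ∈ T, p.Prime ∧ (p % 4 = 1 ∨ (p % 4 = 3 ∧ L < p))) :
    |∑ z ∈ OmY L r m h N, ∏ p ∈ T, fY L H r m h p z.1 z.2 -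
      ((N : ℝ) ^ 2 * beta L) * ∏ p ∈ T, gY H.card p| ≤
      2 * N * ((P0 L : ℝ) * ((∏ p ∈ T, p : ℕ) : ℝ)) + ((P0 L : ℝ) * ((∏ p ∈ T, p : ℕ) : ℝ)) ^ 2 := by
  have hdisj : Disjoint (Q 3 L) T := by
    rw [disjoint_left]
    intro p hp hpT
    have := (mem_Q.1 hp)
    have := (hT p hpT).2
    omega
  have hprime : ∀ q ∈ Q 3 L ∪ T, q.Prime := by
    intro q hq
    rcases mem_union.1 hq with h | h
    · exact (mem_Q.1 h).2.1
    · exact (hT q h).1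
  have h1 := count2 (Q 3 L ∪ T) (fun q hq => (hprime q hq).pos) (coprime_of_primes hprime)
    (fY L H r m h) (by
      intro q _ a b
      unfold fY
      rw [ZMod.natCast_mod, ZMod.natCast_mod]) (fun q a b => fY_01 L H r m h q a b) (11 * N) N
  rw [prod_union hdisj, prod_union hdisj] at h1
  have e1 : ∑ a ∈ Ico (11 * N) (11 * N + N), ∑ b ∈ range N, ∏ q ∈ Q 3 L ∪ T, fY L H r m h q a b =
      ∑ z ∈ OmY L r m h N, ∏ p ∈ T, fY L H r m h p z.1 z.2 := by
    unfold OmY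
    rw [sum_filter, sum_product]
    apply sum_congr rfl
    intro a _
    apply sum_congr rfl
    intro b _
    rw [prod_union hdisj]
    have hq0 : ∀ q ∈ Q 3 L, fY L H r m h q a b =
        if (m : ZMod q) * ((a : ZMod q) ^ 2 + (b : ZMod q) ^ 2) = (h : ZMod q) + (r q : ZMod q) then 1 else 0 := by
      intro q hq
      have hq' := mem_Q.1 hq
      have hmu : mu m q = m := by unfold mu; rw [if_neg (by omega)]
      have hCl : Cl L H r h q = {(h : ZMod q) + (r q : ZMod q)} := by
        unfold Cl; rw [if_neg (by omega), if_pos hq'.1]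
      simp only [fY, hmu, hCl, mem_singleton]
    simp only
    split_ifs with hx
    · rw [prod_eq_one, one_mul]
      intro q hq
      rw [hq0 q hq, if_pos (hx q hq)]
    · push Not at hx
      obtain ⟨q, hq, hne⟩ := hx
      rw [prod_eq_zero hq, zero_mul]
      rw [hq0 q hq, if_neg hne]
  have e3 : ∏ q ∈ Q 3 L, ((∑ a ∈ range q, ∑ b ∈ range q, fY L H r m h q a b) / (q : ℝ) ^ 2) = beta L := by
    unfold beta
    apply prod_congr rfl
    intro q hq
    have hq' := mem_Q.1 hq
    rw [fY_sum0 L H r m h q hq'.2.1 hq'.2.2 (hm q hq'.2.1 hq'.2.2) hq'.1 (hr q hq h hh)]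
  have e4 : ∏ q ∈ T, ((∑ a ∈ range q, ∑ b ∈ range q, fY L H r m h q a b) / (q : ℝ) ^ 2) =
      ∏ p ∈ T, gY H.card p := by
    apply prod_congr rfl
    intro q hq
    obtain ⟨hq1, hq2⟩ := hT q hq
    unfold gY
    rcases hq2 with hq2 | ⟨hq2, hq3⟩
    · rw [fY_sum1 L H r m h q hq1 hq2, if_pos hq2]
    · rw [fY_sum3 L H hH r m h q hh hq1 hq2 (hm q hq1 hq2) hq3, if_neg (by omega)]
  rw [e1, e3, e4] at h1
  calc _ = _ := by congr 2; ring
    _ ≤ _ := h1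
    _ = _ := by unfold P0; push_cast; ring

lemma gY3 {L p k : ℕ} (hk1 : 1 ≤ k) (hk : 2 * k ≤ L + 1) (hp : L < p) (hp3 : p % 4 = 3) :
    0 ≤ gY k p ∧ gY k p ≤ (k : ℝ) / p ∧ 1 - gY k p = (1 - (k : ℝ) / p) * (1 + 1 / (p : ℝ)) := by
  have hp0 : (0 : ℝ) < p := by exact_mod_cast (by omega : 0 < p)
  have hk1' : (1 : ℝ) ≤ k := by exact_mod_cast hk1
  have hkp : (k : ℝ) ≤ p := by exact_mod_cast (by omega : k ≤ p)
  have e : gY k p = (((k : ℝ) - 1) * (p + 1) + 1) / (p : ℝ) ^ 2 := by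
    unfold gY; rw [if_neg (by omega)]
  have e2 : 1 - gY k p = (1 - (k : ℝ) / p) * (1 + 1 / (p : ℝ)) := by
    rw [e]; field_simp; ring
  refine ⟨?_, ?_, e2⟩
  · rw [e]
    apply div_nonneg _ (by positivity)
    have : 0 ≤ ((k : ℝ) - 1) * (p + 1) := mul_nonneg (by linarith) (by linarith)
    linarith
  · rw [e, div_le_div_iff₀ (by positivity) hp0]
    nlinarith

lemma gY1 {p k : ℕ} (hp : 4 ≤ p) (hp1 : p % 4 = 1) :
    0 ≤ gY k p ∧ gY k p ≤ 1 / 2 ∧ gY k p ≤ 2 / (p : ℝ) ∧ 1 - gY k p = (1 - 1 / (p : ℝ)) ^ 2 := by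
  have hp0 : (4 : ℝ) ≤ p := by exact_mod_cast hp
  have hp0' : (0 : ℝ) < p := by linarith
  have e : gY k p = (2 * (p : ℝ) - 1) / (p : ℝ) ^ 2 := by
    unfold gY; rw [if_pos hp1]
  have e2 : 1 - gY k p = (1 - 1 / (p : ℝ)) ^ 2 := by
    rw [e]; field_simp; ring
  have h3 : gY k p ≤ 2 / (p : ℝ) := by
    rw [e, div_le_div_iff₀ (by positivity) hp0']
    nlinarith
  refine ⟨?_, h3.trans ?_, h3, e2⟩
  · rw [e]
    apply div_nonneg _ (by positivity)
    linarith
  · rw [div_le_div_iff₀ hp0' (by norm_num)]; linarith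

noncomputable def V1 (J L k : ℕ) : ℝ := VV J (SB L) (gY k)
noncomputable def VR (J k : ℕ) : ℝ := VV J RB (gY k)

lemma lower_Y (J J' L : ℕ) (H : Finset ℕ) (hH : H ⊆ Icc 1 L) (hk : 2 * H.card ≤ L + 1) (r : ℕ → ℕ)
    (hr : ∀ p ∈ Q 3 L, ∀ h ∈ H, ¬ p ∣ r p + h) (m h N : ℕ) (hh : h ∈ H)
    (hm : ∀ p : ℕ, p.Prime → p % 4 = 3 → ¬ p ∣ m) (D : ℕ) (hD : D = DS J H.card * DS J' 1) :
    (N : ℝ) ^ 2 * beta L * (V1 J L H.card * (1 / 2 * VR J' H.card)) -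
      (J' + 1) * (D * (2 * N * (P0 L * D) + (P0 L * D) ^ 2)) ≤
    ∑ z ∈ OmY L r m h N, WW J H.card (SB L) (fun p => fY L H r m h p z.1 z.2) *
      VV J' RB (fun p => fY L H r m h p z.1 z.2) := by
  set e : ℕ × ℕ → ℕ → ℝ := fun z p => fY L H r m h p z.1 z.2 with he
  set k := H.card with hkdef
  have hk1 : 1 ≤ k := card_pos.2 ⟨h, hh⟩
  have he01 : ∀ z p, 0 ≤ e z p ∧ e z p ≤ 1 := fun z p => fY_01 L H r m h p z.1 z.2
  have hSpoly := Poly.WW J k (SB L) (fun i => filter_subset _ _) (SB_disj L)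
  have hRpoly := Poly.WW J' 1 RB (fun i => filter_subset _ _) RB_disj
  have hLpoly := fun l hl => Poly.LL J' 1 RB (fun i => filter_subset _ _) RB_disj l hl
  have hdSR : Disjoint ((range J).biUnion (SB L)) ((range J').biUnion RB) := by
    rw [disjoint_left]
    intro p hp hp'
    obtain ⟨i, _, hi⟩ := mem_biUnion.1 hp
    obtain ⟨j, _, hj⟩ := mem_biUnion.1 hp'
    have := mem_SB hi
    have := mem_RB hj
    omega
  have hev : ∀ G, Poly ((range J).biUnion (SB L) ∪ (range J').biUnion RB) D G →
      |∑ z ∈ OmY L r m h N, G (e z) - ((N : ℝ) ^ 2 * beta L) * G (gY k)| ≤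
      D * (2 * N * (P0 L * D) + (P0 L * D) ^ 2) := by
    intro G hG
    apply hG.eval (OmY L r m h N) e (gY k) _ _ (by positivity)
    intro T hT hTD
    refine (level_Y L H hH r hr m h N hh hm T ?_).trans ?_
    · intro p hp
      rcases mem_union.1 (hT hp) with h1 | h1
      · obtain ⟨i, _, hi⟩ := mem_biUnion.1 h1
        have := mem_SB hi
        exact ⟨this.2.1, Or.inr this.2.2⟩
      · obtain ⟨i, _, hi⟩ := mem_biUnion.1 h1
        have := mem_RB hi
        exact ⟨this.2.1, Or.inl this.2.2⟩
    · have : ((∏ p ∈ T, p : ℕ) : ℝ) ≤ D := by exact_mod_cast hTD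
      gcongr
  have h1 := hev _ ((hSpoly.mul hRpoly hdSR).mono subset_rfl (by rw [hD]; rfl))
  have h2 := fun l (hl : l < J') =>
    hev _ ((hSpoly.mul (hLpoly l hl) hdSR).mono subset_rfl (by rw [hD]; rfl))
  set R : ℝ := D * (2 * N * (P0 L * D) + (P0 L * D) ^ 2) with hR
  have h3 : ∑ z ∈ OmY L r m h N, WW J k (SB L) (e z) *
      (WW J' 1 RB (e z) - ∑ l ∈ range J', LL J' 1 RB l (e z)) ≤
      ∑ z ∈ OmY L r m h N, WW J k (SB L) (e z) * VV J' RB (e z) := by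
    apply sum_le_sum
    intro z _
    have hw := WW_ge J k (SB L) (e z) (fun i _ p _ => he01 z p)
    exact mul_le_mul_of_nonneg_left (LL_lower J' 1 RB (e z) (fun i _ p _ => he01 z p)) (hw.1.trans hw.2)
  refine le_trans ?_ h3
  have h4 : ∑ z ∈ OmY L r m h N, WW J k (SB L) (e z) *
      (WW J' 1 RB (e z) - ∑ l ∈ range J', LL J' 1 RB l (e z)) =
      ∑ z ∈ OmY L r m h N, WW J k (SB L) (e z) * WW J' 1 RB (e z) -
      ∑ l ∈ range J', ∑ z ∈ OmY L r m h N, WW J k (SB L) (e z) * LL J' 1 RB l (e z) := by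
    rw [sum_comm, ← sum_sub_distrib]
    apply sum_congr rfl
    intro z _
    rw [mul_sub, mul_sum]
  rw [h4]
  have h5 : ∑ l ∈ range J', ∑ z ∈ OmY L r m h N, WW J k (SB L) (e z) * LL J' 1 RB l (e z) ≤
      ∑ l ∈ range J', (((N : ℝ) ^ 2 * beta L) * (WW J k (SB L) (gY k) * LL J' 1 RB l (gY k)) + R) := by
    apply sum_le_sum
    intro l hl
    linarith [(abs_le.1 (h2 l (mem_range.1 hl))).2]
  rw [sum_add_distrib, sum_const, card_range, nsmul_eq_mul, ← mul_sum, ← mul_sum] at h5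
  have h6 := (abs_le.1 h1).1
  have h7 : 0 < VV J (SB L) (gY k) ∧ VV J (SB L) (gY k) ≤ WW J k (SB L) (gY k) := by
    refine ⟨(dens J k (SB L) (gY k) ?_ ?_).1, (WW_ge J k (SB L) (gY k) ?_).2⟩
    · intro i _ p hp
      have hp' := (mem_SB hp).2.2
      have a1 := gY3 hk1 hk hp'.2 hp'.1
      exact ⟨a1.1, a1.2.1.trans (g_half hk hp'.2).2⟩
    · intro i _
      have := SB_mass L i k (by positivity) (gY k) (by
        intro p hp
        have hp' := (mem_SB hp).2.2
        exact (gY3 hk1 hk hp'.2 hp'.1).2.1)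
      have h0 : (0 : ℝ) ≤ k := by positivity
      linarith
    · intro i _ p hp
      have hp' := (mem_SB hp).2.2
      have a1 := gY3 hk1 hk hp'.2 hp'.1
      exact ⟨a1.1, by linarith [(g_half hk hp'.2).2]⟩
  have h8 : 0 < VV J' RB (gY k) ∧ 1 / 2 * VV J' RB (gY k) ≤
      WW J' 1 RB (gY k) - ∑ l ∈ range J', LL J' 1 RB l (gY k) := by
    have hp4 : ∀ i, ∀ p ∈ RB i, 4 ≤ p := by
      intro i p hp
      have h0 := mem_RB hp
      have := h0.2.1.two_le
      have := h0.2.2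
      by_contra hc
      have : p < 4 := by omega
      interval_cases p <;> omega
    have := dens J' 1 RB (gY k) ?_ ?_
    · exact ⟨this.1, this.2.2⟩
    · intro i _ p hp
      have a1 := gY1 (k := k) (hp4 i p hp) (mem_RB hp).2.2
      exact ⟨a1.1, a1.2.1⟩
    · intro i _
      calc ∑ p ∈ RB i, gY k p ≤ ∑ p ∈ RB i, 2 * (1 / (p : ℝ)) := by
            apply sum_le_sum; intro p hp; rw [mul_one_div]
            exact (gY1 (k := k) (hp4 i p hp) (mem_RB hp).2.2).2.2.1
        _ ≤ ∑ p ∈ Bk i, 2 * (1 / (p : ℝ)) :=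
            sum_le_sum_of_subset_of_nonneg (filter_subset _ _) (fun _ _ _ => by positivity)
        _ = 2 * ∑ p ∈ Bk i, (1 / (p : ℝ)) := by rw [mul_sum]
        _ ≤ 2 * 4 := by gcongr; exact sum_Bk_le i
        _ = _ := by norm_num
  have hb : 0 ≤ (N : ℝ) ^ 2 * beta L := by
    apply mul_nonneg (by positivity)
    exact prod_nonneg (fun p _ => by positivity)
  have h9 : (N : ℝ) ^ 2 * beta L * (V1 J L k * (1 / 2 * VR J' k)) ≤
      (N : ℝ) ^ 2 * beta L * (WW J k (SB L) (gY k) *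
        (WW J' 1 RB (gY k) - ∑ l ∈ range J', LL J' 1 RB l (gY k))) := by
    apply mul_le_mul_of_nonneg_left _ hb
    apply mul_le_mul h7.2 h8.2 _ (h7.1.le.trans h7.2)
    have := h8.1
    positivity
  have h10 : (N : ℝ) ^ 2 * beta L * (WW J k (SB L) (gY k) *
        (WW J' 1 RB (gY k) - ∑ l ∈ range J', LL J' 1 RB l (gY k))) =
      (N : ℝ) ^ 2 * beta L * (WW J k (SB L) (gY k) * WW J' 1 RB (gY k)) -
      (N : ℝ) ^ 2 * beta L * (WW J k (SB L) (gY k) * ∑ l ∈ range J', LL J' 1 RB l (gY k)) := by ring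
  rw [h10] at h9
  linarith

end VS

open Finset Filter Topology
namespace VS

lemma mem_blocks (p J : ℕ) (h2 : 2 < p) (h : p ≤ 2 ^ 2 ^ J) :
    ∃ i, i < J ∧ p ≤ 2 ^ 2 ^ (i + 1) ∧ 2 ^ 2 ^ i < p := by
  induction J with
  | zero => simp at h; omega
  | succ J ih =>
    by_cases hp : p ≤ 2 ^ 2 ^ J
    · obtain ⟨i, hi, h3⟩ := ih hp
      exact ⟨i, by omega, h3⟩
    · exact ⟨J, by omega, h, by omega⟩

lemma beta_eq (L : ℕ) : beta L = (1 / (P0 L : ℝ)) * ∏ p ∈ Q 3 L, (1 + 1 / (p : ℝ)) := by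
  unfold beta P0
  push_cast
  rw [one_div, ← prod_inv_distrib, ← prod_mul_distrib]
  apply prod_congr rfl
  intro p hp
  have : (p : ℝ) ≠ 0 := by exact_mod_cast (mem_Q.1 hp).2.1.ne_zero
  field_simp

lemma V1_eq (J L : ℕ) (H : Finset ℕ) (hk1 : 1 ≤ H.card) (hk : 2 * H.card ≤ L + 1) :
    V1 J L H.card = V0 J L H * ∏ p ∈ (range J).biUnion (SB L), (1 + 1 / (p : ℝ)) := by
  unfold V1 V0 VV
  rw [prod_biUnion (fun i _ j _ h => SB_disj L i j h), ← prod_mul_distrib]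
  apply prod_congr rfl
  intro i _
  rw [← prod_mul_distrib]
  apply prod_congr rfl
  intro p hp
  have hp' := (mem_SB hp).2.2
  exact (gY3 hk1 hk hp'.2 hp'.1).2.2

lemma RB_four {i p : ℕ} (hp : p ∈ RB i) : 4 ≤ p := by
  have h0 := mem_RB hp
  have := h0.2.1.two_le
  have := h0.2.2
  by_contra hc
  have : p < 4 := by omega
  interval_cases p <;> omega

lemma VR_ge (J k : ℕ) : (∏ p ∈ Q 1 (2 ^ 2 ^ J), (1 - 1 / (p : ℝ))) ^ 2 ≤ VR J k := by
  have e : VR J k = (∏ p ∈ (range J).biUnion RB, (1 - 1 / (p : ℝ))) ^ 2 := by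
    unfold VR VV
    rw [prod_biUnion (fun i _ j _ h => RB_disj i j h), ← prod_pow]
    apply prod_congr rfl
    intro i _
    rw [← prod_pow]
    apply prod_congr rfl
    intro p hp
    exact (gY1 (RB_four hp) (mem_RB hp).2.2).2.2.2
  rw [e]
  have hf : ∀ p ∈ Q 1 (2 ^ 2 ^ J), 0 ≤ 1 - 1 / (p : ℝ) ∧ 1 - 1 / (p : ℝ) ≤ 1 := by
    intro p hp
    have := Q_inv hp
    constructor <;> linarith
  apply pow_le_pow_left₀ (prod_nonneg (fun p hp => (hf p hp).1))
  apply prod_le_prod_of_subset_of_le_one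
  · intro p hp
    obtain ⟨i, hi, h⟩ := mem_biUnion.1 hp
    have h1 := mem_RB h
    have h2 := mem_Bk.1 h1.1
    rw [mem_Q]
    refine ⟨h2.1.1.trans ?_, h1.2⟩
    have : i + 1 ≤ J := by have := mem_range.1 hi; omega
    gcongr <;> norm_num
  · intro p hp; exact (hf p hp).1
  · intro p hp _; exact (hf p hp).2

lemma prod_bound : ∃ c : ℝ, 0 < c ∧ ∀ (J J' L : ℕ) (H : Finset ℕ), 1 ≤ H.card → 2 * H.card ≤ L + 1 →
    c * (V0 J L H / P0 L) * (Real.sqrt (2 ^ J) / Real.sqrt (2 ^ J')) ≤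
    beta L * (V1 J L H.card * (1 / 2 * VR J' H.card)) * ∑ m ∈ M1 (2 ^ 2 ^ J'), (1 : ℝ) / m := by
  obtain ⟨C, hC1, hC⟩ := mertens4
  obtain ⟨c, hc0, hc⟩ := sum_M1
  have hC0 : 0 < C := by linarith
  refine ⟨c / (2 * C ^ 3), by positivity, ?_⟩
  intro J J' L H hk1 hk
  have hv2 : ∀ J : ℕ, 2 ≤ 2 ^ 2 ^ J := fun J => by
    calc 2 = 2 ^ 1 := by norm_num
      _ ≤ 2 ^ 2 ^ J := Nat.pow_le_pow_right (by norm_num) Nat.one_le_two_pow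
  have hlog : ∀ J : ℕ, Real.sqrt (Real.log ((2 ^ 2 ^ J : ℕ) : ℝ)) = Real.sqrt (2 ^ J) * Real.sqrt (Real.log 2) := by
    intro J
    push_cast
    rw [Real.log_pow, ← Real.sqrt_mul (by positivity)]
    push_cast; rfl
  have hl2 : 0 < Real.sqrt (Real.log 2) := Real.sqrt_pos.2 (Real.log_pos (by norm_num))
  obtain ⟨_, _, hz⟩ := hC (2 ^ 2 ^ J) (hv2 J)
  obtain ⟨hv, _, _⟩ := hC (2 ^ 2 ^ J') (hv2 J')
  have hM := hc (2 ^ 2 ^ J') (hv2 J')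
  have hVR := VR_ge J' H.card
  rw [hlog] at hz hv hM
  set s := Real.sqrt (2 ^ J) with hs
  set s' := Real.sqrt (2 ^ J') with hs'
  set l := Real.sqrt (Real.log 2)
  have hs0 : 0 < s := Real.sqrt_pos.2 (by positivity)
  have hs'0 : 0 < s' := Real.sqrt_pos.2 (by positivity)
  set π := ∏ p ∈ Q 1 (2 ^ 2 ^ J'), (1 - 1 / (p : ℝ)) with hπ
  set sm := ∑ m ∈ M1 (2 ^ 2 ^ J'), (1 : ℝ) / m with hsm
  set Pz := ∏ p ∈ Q 3 (2 ^ 2 ^ J), (1 + 1 / (p : ℝ)) with hPz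
  have hV0 : 0 ≤ V0 J L H := by
    unfold V0 VV
    apply prod_nonneg; intro i _; apply prod_nonneg; intro p hp
    have := (g_half hk (mem_SB hp).2.2.2).2
    linarith
  have hP : Pz ≤ (∏ p ∈ Q 3 L, (1 + 1 / (p : ℝ))) * ∏ p ∈ (range J).biUnion (SB L), (1 + 1 / (p : ℝ)) := by
    rw [← prod_union]
    · apply prod_le_prod_of_subset_of_one_le
      · intro p hp
        rw [mem_Q] at hp
        rw [mem_union]
        by_cases hpL : p ≤ L
        · left; exact mem_Q.2 ⟨hpL, hp.2⟩
        · right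
          obtain ⟨i, hi, h1, h2⟩ := mem_blocks p J (by have := hp.2.1.two_le; have := hp.2.2; omega) hp.1
          rw [mem_biUnion]
          refine ⟨i, mem_range.2 hi, ?_⟩
          unfold SB
          rw [mem_filter, mem_Bk]
          exact ⟨⟨⟨h1, hp.2.1⟩, h2⟩, hp.2.2, by omega⟩
      · intro p _; positivity
      · intro p _ _
        have : 0 ≤ 1 / (p : ℝ) := by positivity
        linarith
    · rw [disjoint_left]
      intro p hp hp'
      obtain ⟨i, _, hi⟩ := mem_biUnion.1 hp'
      have := mem_SB hi
      have := mem_Q.1 hp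
      omega
  rw [beta_eq, V1_eq J L H hk1 hk]
  have hP0 : (0 : ℝ) < P0 L := by exact_mod_cast P0_pos L
  have hsm0 : 0 ≤ sm := sum_nonneg (fun _ _ => by positivity)
  set P1 := ∏ p ∈ Q 3 L, (1 + 1 / (p : ℝ))
  set P2 := ∏ p ∈ (range J).biUnion (SB L), (1 + 1 / (p : ℝ))
  have hπ0 : 1 / (C * (s' * l)) ≤ π := by
    rw [div_le_iff₀ (by positivity)]; linarith
  have h1 : c / (C ^ 2 * (s' * l)) ≤ VR J' H.card * sm := by
    calc c / (C ^ 2 * (s' * l)) = (1 / (C * (s' * l))) ^ 2 * (c * (s' * l)) := by field_simp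
      _ ≤ π ^ 2 * sm := by gcongr
      _ ≤ _ := by gcongr
  have h2 : s * l / C ≤ P1 * P2 := by
    rw [div_le_iff₀ hC0]
    calc s * l ≤ C * Pz := hz
      _ ≤ C * (P1 * P2) := by gcongr
      _ = _ := by ring
  calc c / (2 * C ^ 3) * (V0 J L H / P0 L) * (s / s')
      = (V0 J L H / P0 L) * (1 / 2) * ((s * l / C) * (c / (C ^ 2 * (s' * l)))) := by field_simp
    _ ≤ (V0 J L H / P0 L) * (1 / 2) * ((P1 * P2) * (VR J' H.card * sm)) := by gcongr
    _ = _ := by ring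

end VS

open Finset Filter Topology
namespace VS

lemma WW_congr (J κ : ℕ) (S : ℕ → Finset ℕ) (e e' : ℕ → ℝ)
    (h : ∀ i, i < J → ∀ p ∈ S i, e p = e' p) : WW J κ S e = WW J κ S e' := by
  unfold WW UU es
  apply prod_congr rfl
  intro i hi
  apply sum_congr rfl
  intro j _
  congr 1
  apply sum_congr rfl
  intro T hT
  apply prod_congr rfl
  intro p hp
  exact h i (mem_range.1 hi) p ((mem_powersetCard.1 hT).1 hp)

/-- sums of two squares -/
def SS (n : ℕ) : Prop := 0 < n ∧ ∃ a b : ℕ, n = a ^ 2 + b ^ 2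

lemma SS_M1 {v m : ℕ} (hm : m ∈ M1 v) (a b : ℕ) (h0 : 0 < m * (a ^ 2 + b ^ 2)) :
    SS (m * (a ^ 2 + b ^ 2)) := by
  refine ⟨h0, ?_⟩
  rw [mem_M1] at hm
  have h1 : ∃ x y : ℕ, m = x ^ 2 + y ^ 2 := by
    rw [Nat.eq_sq_add_sq_iff]
    intro q hq hq3
    have h2 := hm.2 q (Nat.prime_of_mem_primeFactors hq) (Nat.dvd_of_mem_primeFactors hq)
    omega
  obtain ⟨x, y, hxy⟩ := h1
  obtain ⟨s, t, hst⟩ := Nat.sq_add_sq_mul hxy (rfl : a ^ 2 + b ^ 2 = a ^ 2 + b ^ 2)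
  exact ⟨s, t, hst⟩

def NN (X m : ℕ) : ℕ := Nat.sqrt (X / (100 * m))

lemma NN_le {X m : ℕ} (hm : 1 ≤ m) : NN X m ^ 2 * (100 * m) ≤ X := by
  unfold NN
  have h1 := Nat.sqrt_le' (X / (100 * m))
  calc _ ≤ X / (100 * m) * (100 * m) := Nat.mul_le_mul_right _ h1
    _ ≤ X := Nat.div_mul_le_self _ _

lemma NN_ge {X m : ℕ} (hm : 1 ≤ m) (h : 1000000 * m ≤ X) : X ≤ 103 * (m * NN X m ^ 2) := by
  have h1 := Nat.lt_succ_sqrt' (X / (100 * m))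
  have h2 : X < (NN X m + 1) ^ 2 * (100 * m) := (Nat.div_lt_iff_lt_mul (by omega)).1 h1
  have h3 : 100 ≤ NN X m := by
    unfold NN
    rw [Nat.le_sqrt', Nat.le_div_iff_mul_le (by omega)]
    omega
  have h4 : 100 * (NN X m + 1) ^ 2 ≤ 103 * NN X m ^ 2 := by nlinarith
  nlinarith

lemma range_n {X m a b h L : ℕ} (hm : 1 ≤ m) (hX : 1000000 * m ≤ X) (hL : 100 * L ≤ X) (hh1 : 1 ≤ h)
    (hh : h ≤ L) (ha : 11 * NN X m ≤ a) (ha' : a < 11 * NN X m + NN X m) (hb : b < NN X m) :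
    X + h ≤ m * (a ^ 2 + b ^ 2) ∧ m * (a ^ 2 + b ^ 2) < X + X / 2 + h := by
  have h1 := NN_le (X := X) hm
  have h2 := NN_ge hm hX
  set N := NN X m
  have h3 : 121 * N ^ 2 ≤ a ^ 2 + b ^ 2 := by nlinarith
  have h4 : a ^ 2 + b ^ 2 ≤ 145 * N ^ 2 := by
    have : a ≤ 12 * N := by omega
    nlinarith
  have h5 := Nat.mul_le_mul_left m h3
  have h6 := Nat.mul_le_mul_left m h4
  have e1 : m * (121 * N ^ 2) = 121 * (m * N ^ 2) := by ring
  have e2 : m * (145 * N ^ 2) = 145 * (m * N ^ 2) := by ring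
  have e3 : N ^ 2 * (100 * m) = 100 * (m * N ^ 2) := by ring
  rw [e1] at h5
  rw [e2] at h6
  rw [e3] at h1
  constructor
  · omega
  · omega

lemma fY_eX {L : ℕ} {H : Finset ℕ} {r : ℕ → ℕ} {m h p a b x : ℕ} (hp3 : p % 4 = 3) (hpL : L < p)
    (hx : x + h = m * (a ^ 2 + b ^ 2)) : fY L H r m h p a b = eX H x p := by
  have hmu : mu m p = m := by unfold mu; rw [if_neg (by omega)]
  have hCl : Cl L H r h p = H.image (fun h' : ℕ => (h : ZMod p) - (h' : ZMod p)) := by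
    unfold Cl; rw [if_neg (by omega), if_neg (by omega)]
  have hx' : (m : ZMod p) * ((a : ZMod p) ^ 2 + (b : ZMod p) ^ 2) = x + h := by
    exact_mod_cast (congrArg (Nat.cast : ℕ → ZMod p) hx).symm
  rw [eX_eq, fY, hmu, hCl, hx']
  congr 1
  simp only [mem_image, eq_iff_iff]
  constructor
  · rintro ⟨t, ht, he⟩
    exact ⟨t, ht, by linear_combination he⟩
  · rintro ⟨t, ht, he⟩
    exact ⟨t, ht, by linear_combination he⟩

def good (v : ℕ) (z : ℕ × ℕ) : Prop :=
  ∀ p : ℕ, p.Prime → p % 4 = 1 → p ≤ v → ¬ p ∣ z.1 ^ 2 + z.2 ^ 2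

open Classical in
lemma VV_good (J L : ℕ) (H : Finset ℕ) (r : ℕ → ℕ) (m h : ℕ) (z : ℕ × ℕ) :
    VV J RB (fun p => fY L H r m h p z.1 z.2) ≤ if good (2 ^ 2 ^ J) z then 1 else 0 := by
  have h01 := fun p => fY_01 L H r m h p z.1 z.2
  split_ifs with hg
  · unfold VV
    apply prod_le_one
    · intro i _; apply prod_nonneg; intro p _; linarith [(h01 p).2]
    · intro i _
      apply prod_le_one
      · intro p _; linarith [(h01 p).2]
      · intro p _; linarith [(h01 p).1]
  · unfold good at hg
    push Not at hg
    obtain ⟨p, hp, hp1, hpv, hpd⟩ := hg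
    obtain ⟨i, hi, h1, h2⟩ := mem_blocks p J (by have := hp.two_le; omega) hpv
    unfold VV
    apply le_of_eq
    apply prod_eq_zero (mem_range.2 hi)
    apply prod_eq_zero (i := p)
    · unfold RB
      rw [mem_filter, mem_Bk]
      exact ⟨⟨⟨h1, hp⟩, h2⟩, hp1⟩
    · have hmu : mu m p = 1 := by unfold mu; rw [if_pos hp1]
      have hCl : Cl L H r h p = {0} := by unfold Cl; rw [if_pos hp1]
      have : fY L H r m h p z.1 z.2 = 1 := by
        unfold fY
        rw [hmu, hCl, if_pos]
        rw [mem_singleton, Nat.cast_one, one_mul]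
        exact_mod_cast (ZMod.natCast_eq_zero_iff _ _).2 hpd
      show 1 - fY L H r m h p z.1 z.2 = 0
      rw [this, sub_self]

open Classical in
lemma T_lower (J J' L X B : ℕ) (H : Finset ℕ) (hH : H ⊆ Icc 1 L) (r : ℕ → ℕ) (h : ℕ) (hh : h ∈ H)
    (hL : 100 * L ≤ X) (hX : 1000000 * 2 ^ 2 ^ J' ≤ X) (hB : 2 * X < (2 ^ 2 ^ J') ^ (B + 1)) :
    ∑ m ∈ M1 (2 ^ 2 ^ J'), ∑ z ∈ OmY L r m h (NN X m),
      WW J H.card (SB L) (fun p => fY L H r m h p z.1 z.2) *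
      VV J' RB (fun p => fY L H r m h p z.1 z.2) ≤
    (4 * 2 ^ B) * ∑ x ∈ Om L r X (X / 2), wX J L H x * (if SS (x + h) then 1 else 0) := by
  set v := 2 ^ 2 ^ J' with hv
  have hhI := mem_Icc.1 (hH hh)
  set E := ((M1 v).sigma (fun m => OmY L r m h (NN X m))).filter (fun ζ => good v ζ.2) with hE
  set xi : (Σ _ : ℕ, ℕ × ℕ) → ℕ := fun ζ => ζ.1 * (ζ.2.1 ^ 2 + ζ.2.2 ^ 2) - h with hxi
  have hbasic : ∀ ζ ∈ (M1 v).sigma (fun m => OmY L r m h (NN X m)),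
      xi ζ + h = ζ.1 * (ζ.2.1 ^ 2 + ζ.2.2 ^ 2) ∧ xi ζ ∈ Om L r X (X / 2) := by
    rintro ⟨m, a, b⟩ hζ
    rw [mem_sigma] at hζ
    obtain ⟨hm, hz⟩ := hζ
    simp only at hm hz
    have hm' := mem_M1.1 hm
    unfold OmY at hz
    rw [mem_filter, mem_product, mem_Ico, mem_range] at hz
    obtain ⟨⟨⟨ha, ha'⟩, hb⟩, hz⟩ := hz
    simp only at ha ha' hb hz
    have hmX : 1000000 * m ≤ X := le_trans (Nat.mul_le_mul_left _ hm'.1.2) hX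
    have hr := range_n hm'.1.1 hmX hL hhI.1 hhI.2 ha ha' hb
    have e : xi ⟨m, a, b⟩ + h = m * (a ^ 2 + b ^ 2) := by
      simp only [hxi]; omega
    refine ⟨e, ?_⟩
    unfold Om
    rw [mem_filter, mem_Ico]
    refine ⟨by omega, ?_⟩
    intro p hp
    have h1 := hz p hp
    have h2 := congrArg (Nat.cast : ℕ → ZMod p) e
    push_cast at h2
    rw [h1] at h2
    linear_combination h2
  calc ∑ m ∈ M1 v, ∑ z ∈ OmY L r m h (NN X m),
      WW J H.card (SB L) (fun p => fY L H r m h p z.1 z.2) *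
      VV J' RB (fun p => fY L H r m h p z.1 z.2)
      = ∑ ζ ∈ (M1 v).sigma (fun m => OmY L r m h (NN X m)),
        WW J H.card (SB L) (fun p => fY L H r ζ.1 h p ζ.2.1 ζ.2.2) *
        VV J' RB (fun p => fY L H r ζ.1 h p ζ.2.1 ζ.2.2) := by rw [sum_sigma]
    _ ≤ ∑ ζ ∈ (M1 v).sigma (fun m => OmY L r m h (NN X m)), (if good v ζ.2 then wX J L H (xi ζ) else 0) := by
        apply sum_le_sum
        intro ζ hζ
        have h1 : WW J H.card (SB L) (fun p => fY L H r ζ.1 h p ζ.2.1 ζ.2.2) = wX J L H (xi ζ) := by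
          unfold wX
          apply WW_congr
          intro i _ p hp
          have hp' := (mem_SB hp).2.2
          exact fY_eX hp'.1 hp'.2 (hbasic ζ hζ).1
        rw [h1]
        have h2 := VV_good J' L H r ζ.1 h ζ.2
        have h3 := wX_nonneg J L H (xi ζ)
        calc _ ≤ wX J L H (xi ζ) * (if good v ζ.2 then 1 else 0) := mul_le_mul_of_nonneg_left h2 h3
          _ = _ := by split_ifs <;> simp
    _ = ∑ ζ ∈ E, wX J L H (xi ζ) := by rw [hE, sum_filter]
    _ = ∑ x ∈ Om L r X (X / 2), ∑ ζ ∈ E.filter (fun ζ => xi ζ = x), wX J L H (xi ζ) := by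
        rw [sum_fiberwise_of_maps_to]
        intro ζ hζ
        exact (hbasic ζ (mem_filter.1 hζ).1).2
    _ ≤ ∑ x ∈ Om L r X (X / 2), (4 * 2 ^ B) * (wX J L H x * (if SS (x + h) then 1 else 0)) := by
        apply sum_le_sum
        intro x hx
        have hw := wX_nonneg J L H x
        have e1 : ∑ ζ ∈ E.filter (fun ζ => xi ζ = x), wX J L H (xi ζ) =
            ((E.filter (fun ζ => xi ζ = x)).card : ℝ) * wX J L H x := by
          rw [← nsmul_eq_mul, ← sum_const]
          apply sum_congr rfl
          intro ζ hζ
          rw [(mem_filter.1 hζ).2]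
        rw [e1]
        rcases (E.filter (fun ζ => xi ζ = x)).eq_empty_or_nonempty with h0 | ⟨ζ0, hζ0⟩
        · rw [h0]
          simp only [card_empty, Nat.cast_zero, zero_mul]
          split_ifs <;> positivity
        · have hSS : SS (x + h) := by
            rw [mem_filter, hE, mem_filter] at hζ0
            have h1 := (hbasic ζ0 hζ0.1.1).1
            rw [hζ0.2] at h1
            rw [h1]
            apply SS_M1 (mem_sigma.1 hζ0.1.1).1
            rw [← h1]; omega
          rw [if_pos hSS, mul_one]
          apply mul_le_mul_of_nonneg_right _ hw
          obtain ⟨j, hj1, hj2⟩ := mult v (x + h) (by omega)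
            ((E.filter (fun ζ => xi ζ = x)).image (fun ζ => (ζ.1, ζ.2.1, ζ.2.2))) (by
              intro z hz
              obtain ⟨ζ, hζ, rfl⟩ := mem_image.1 hz
              rw [mem_filter, hE, mem_filter] at hζ
              refine ⟨(mem_sigma.1 hζ.1.1).1, ?_, hζ.1.2⟩
              rw [← (hbasic ζ hζ.1.1).1, hζ.2])
          rw [card_image_of_injective] at hj1
          · have hxX := (mem_Ico.1 (mem_filter.1 hx).1).2
            have hjB : j ≤ B := by
              by_contra hc
              have hv1 : 1 ≤ v := Nat.one_le_two_pow
              have h5 : v ^ (B + 1) ≤ v ^ j := Nat.pow_le_pow_right hv1 (by omega)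
              omega
            have h6 : (2 : ℕ) ^ j ≤ 2 ^ B := Nat.pow_le_pow_right (by norm_num) hjB
            have h7 : (E.filter (fun ζ => xi ζ = x)).card ≤ 4 * 2 ^ B := by omega
            exact_mod_cast h7
          · rintro ⟨m, a, b⟩ ⟨m', a', b'⟩ heq
            simp only [Prod.mk.injEq] at heq
            obtain ⟨rfl, rfl, rfl⟩ := heq
            rfl
    _ = _ := by rw [mul_sum]

end VS

open Finset Filter Topology
namespace VS

lemma num1 (t s j D P : ℝ) (ht : 1 ≤ t) (hs : t ^ 3000 ≤ s) (hj0 : 0 ≤ j) (hj : j ≤ t) (hD0 : 0 ≤ D)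
    (hD : D ≤ t ^ 972) (hP0 : 0 ≤ P) (hP : P ≤ t ^ 2) :
    t * (j * (D * (2 * s * (P * D) + (P * D) ^ 2))) ≤ 3 * s * t ^ 2922 := by
  have h1 : t ^ 974 ≤ s := (pow_le_pow_right₀ ht (by norm_num)).trans hs
  have hs0 : 0 ≤ s := (by positivity : (0 : ℝ) ≤ t ^ 974).trans h1
  have ht0 : 0 ≤ t := by linarith
  have h2 : P * D ≤ t ^ 974 := by
    calc P * D ≤ t ^ 2 * t ^ 972 := by gcongr
      _ = t ^ 974 := by ring
  have h2' : 0 ≤ P * D := by positivity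
  have h3 : 2 * s * (P * D) + (P * D) ^ 2 ≤ 3 * s * t ^ 974 := by
    have a1 : 2 * s * (P * D) ≤ 2 * s * t ^ 974 := by gcongr
    have a2 : (P * D) ^ 2 ≤ s * t ^ 974 := by
      rw [sq]
      exact mul_le_mul (h2.trans h1) h2 h2' hs0
    linarith
  calc t * (j * (D * (2 * s * (P * D) + (P * D) ^ 2))) ≤ t * (t * (t ^ 972 * (3 * s * t ^ 974))) := by gcongr
    _ = 3 * s * t ^ 1948 := by ring
    _ ≤ _ := by
      have := pow_le_pow_right₀ ht (by norm_num : 1948 ≤ 2922)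
      gcongr <;> norm_num

lemma V0_ge (J L : ℕ) (H : Finset ℕ) (hk : 2 * H.card ≤ L + 1) :
    Real.exp (-(8 * (H.card * J))) ≤ V0 J L H := by
  unfold V0 VV
  have h1 : ∀ i ∈ range J, Real.exp (-(8 * H.card)) ≤ ∏ p ∈ SB L i, (1 - (H.card : ℝ) / p) := by
    intro i _
    have h2 : ∀ p ∈ SB L i, Real.exp (-2 * ((H.card : ℝ) / p)) ≤ 1 - (H.card : ℝ) / p := by
      intro p hp
      have := g_half hk (mem_SB hp).2.2.2
      exact one_sub_ge_exp _ this.1 this.2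
    refine le_trans ?_ (Finset.prod_le_prod (fun p _ => (Real.exp_pos _).le) h2)
    rw [← Real.exp_sum, ← mul_sum, Real.exp_le_exp]
    have := SB_mass L i H.card (by positivity) _ (fun p _ => le_rfl)
    linarith
  calc Real.exp (-(8 * (H.card * J))) = ∏ i ∈ range J, Real.exp (-(8 * (H.card : ℝ))) := by
        rw [prod_const, card_range, ← Real.exp_nat_mul]; congr 1; ring
    _ ≤ _ := Finset.prod_le_prod (fun _ _ => (Real.exp_pos _).le) h1

lemma err_sum (J J' L X : ℕ) (H : Finset ℕ) (hH : H ⊆ Icc 1 L) (hk : 2 * H.card ≤ L + 1) (r : ℕ → ℕ)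
    (hr : ∀ p ∈ Q 3 L, ∀ h ∈ H, ¬ p ∣ r p + h) (h : ℕ) (hh : h ∈ H)
    (hX : 1000000 * 2 ^ 2 ^ J' ≤ X) (D : ℕ) (hD : D = DS J H.card * DS J' 1)
    (s : ℝ) (hs0 : 0 ≤ s) (hs : s ^ 2 = X) :
    (X : ℝ) / 103 * (beta L * (V1 J L H.card * (1 / 2 * VR J' H.card)) * ∑ m ∈ M1 (2 ^ 2 ^ J'), (1 : ℝ) / m)
     - ((2 ^ 2 ^ J' : ℕ) : ℝ) * ((J' + 1) * (D * (2 * s * (P0 L * D) + (P0 L * D) ^ 2))) ≤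
    ∑ m ∈ M1 (2 ^ 2 ^ J'), ∑ z ∈ OmY L r m h (NN X m),
      WW J H.card (SB L) (fun p => fY L H r m h p z.1 z.2) *
      VV J' RB (fun p => fY L H r m h p z.1 z.2) := by
  set v := 2 ^ 2 ^ J' with hv
  set G := beta L * (V1 J L H.card * (1 / 2 * VR J' H.card)) with hG
  set R : ℝ := (J' + 1) * (D * (2 * s * (P0 L * D) + (P0 L * D) ^ 2)) with hR
  have hR0 : 0 ≤ R := by positivity
  have hk1 : 1 ≤ H.card := card_pos.2 ⟨h, hh⟩
  have hG0 : 0 ≤ G := by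
    have a1 : 0 ≤ beta L := prod_nonneg (fun p _ => by positivity)
    have a2 : 0 ≤ V1 J L H.card := by
      rw [V1_eq J L H hk1 hk]
      apply mul_nonneg ((Real.exp_pos _).le.trans (V0_ge J L H hk))
      exact prod_nonneg (fun p _ => by positivity)
    have a3 : 0 ≤ VR J' H.card := le_trans (sq_nonneg _) (VR_ge J' H.card)
    positivity
  have hcard : ((M1 v).card : ℝ) ≤ v := by
    have : M1 v ⊆ Icc 1 v := by
      intro m hm; have := mem_M1.1 hm; exact mem_Icc.2 this.1
    have := card_le_card this
    rw [Nat.card_Icc] at this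
    exact_mod_cast (by omega : (M1 v).card ≤ v)
  have key : ∀ m ∈ M1 v, (X : ℝ) / 103 * G * (1 / m) - R ≤ ∑ z ∈ OmY L r m h (NN X m),
      WW J H.card (SB L) (fun p => fY L H r m h p z.1 z.2) *
      VV J' RB (fun p => fY L H r m h p z.1 z.2) := by
    intro m hm
    have hm' := mem_M1.1 hm
    have h1 := lower_Y J J' L H hH hk r hr m h (NN X m) hh (by
      intro p hp hp3 hd
      have := hm'.2 p hp hd
      omega) D hD
    refine le_trans ?_ h1
    have hm0 : (0 : ℝ) < m := by exact_mod_cast (by omega : 0 < m)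
    have h2 : (X : ℝ) ≤ 103 * (m * (NN X m : ℝ) ^ 2) := by
      exact_mod_cast NN_ge hm'.1.1 (le_trans (Nat.mul_le_mul_left _ hm'.1.2) hX)
    have h3 : (NN X m : ℝ) ≤ s := by
      apply le_of_sq_le_sq _ hs0
      rw [hs]
      have h4 := NN_le (X := X) hm'.1.1
      have : NN X m ^ 2 ≤ X := by nlinarith [Nat.zero_le (NN X m ^ 2)]
      exact_mod_cast this
    have h5 : (X : ℝ) / 103 * (1 / m) ≤ (NN X m : ℝ) ^ 2 := by
      rw [mul_one_div, div_div, div_le_iff₀ (by positivity)]; linarith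
    have h6 : (X : ℝ) / 103 * G * (1 / m) ≤ (NN X m : ℝ) ^ 2 * G := by
      calc _ = (X : ℝ) / 103 * (1 / m) * G := by ring
        _ ≤ _ := by gcongr
    have h7 : (J' + 1 : ℝ) * (D * (2 * (NN X m : ℝ) * (P0 L * D) + (P0 L * D) ^ 2)) ≤ R := by
      rw [hR]; gcongr
    have h8 : (NN X m : ℝ) ^ 2 * beta L * (V1 J L H.card * (1 / 2 * VR J' H.card)) = (NN X m : ℝ) ^ 2 * G := by
      rw [hG]; ring
    rw [h8]
    linarith
  refine le_trans ?_ (sum_le_sum key)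
  rw [sum_sub_distrib, sum_const, nsmul_eq_mul, ← mul_sum]
  have : ((M1 v).card : ℝ) * R ≤ v * R := by gcongr
  linarith

end VS

open Finset Filter Topology
namespace VS

lemma num2 (t s c V P q : ℝ) (hc : 0 < c) (ht : 1 ≤ t) (htc : 1236 / c ≤ t) (hs : t ^ 3000 ≤ s)
    (hV : 1 ≤ V * t ^ 16) (hP0 : 0 < P) (hP : P ≤ t ^ 2) (hq0 : 0 < q) (hq : q ≤ t) :
    3 * s * t ^ 2922 ≤ (s ^ 2 * (c / 206) * (V / P) / q) / 2 := by
  have ht0 : 0 < t := by linarith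
  have hs0 : 0 < s := lt_of_lt_of_le (by positivity) hs
  have h1 : 1 / t ^ 16 ≤ V := by rw [div_le_iff₀ (by positivity)]; exact hV
  have hV0 : 0 ≤ V := (by positivity : (0 : ℝ) ≤ 1 / t ^ 16).trans h1
  have h2 : 1 / t ^ 19 ≤ V / P / q := by
    have e : (1 : ℝ) / t ^ 19 = 1 / t ^ 16 / t ^ 2 / t := by field_simp
    rw [e]
    gcongr
  have h3 : t ^ 2942 ≤ s := (pow_le_pow_right₀ ht (by norm_num)).trans hs
  have h4 : 1236 ≤ t * c := by rwa [div_le_iff₀ hc] at htc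
  calc 3 * s * t ^ 2922 = s * (t ^ 2941) * 1236 / 206 / 2 / t ^ 19 := by field_simp; ring
    _ ≤ s * (t ^ 2941) * (t * c) / 206 / 2 / t ^ 19 := by gcongr
    _ = s * t ^ 2942 * (c / 206) / 2 * (1 / t ^ 19) := by ring
    _ ≤ s * s * (c / 206) / 2 * (V / P / q) := by gcongr
    _ = _ := by ring

lemma num3 (t X V P E : ℝ) (ht : 1 ≤ t) (hX : t ^ 6000 ≤ X)
    (hV : 1 ≤ V * t ^ 16) (hP0 : 0 < P) (hP : P ≤ t ^ 2) (hE : E ≤ t ^ 1946) : E ≤ X * (V / P) := by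
  have ht0 : 0 < t := by linarith
  have h1 : 1 / t ^ 16 ≤ V := by rw [div_le_iff₀ (by positivity)]; exact hV
  have hV0 : 0 ≤ V := (by positivity : (0 : ℝ) ≤ 1 / t ^ 16).trans h1
  have h2 : 1 / t ^ 18 ≤ V / P := by
    have e : (1 : ℝ) / t ^ 18 = 1 / t ^ 16 / t ^ 2 := by field_simp
    rw [e]
    gcongr
  have h3 : t ^ 1964 ≤ X := (pow_le_pow_right₀ ht (by norm_num)).trans hX
  have hX0 : 0 ≤ X := (by positivity : (0 : ℝ) ≤ t ^ 1964).trans h3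
  calc E ≤ t ^ 1946 := hE
    _ = t ^ 1964 * (1 / t ^ 18) := by field_simp
    _ ≤ X * (V / P) := by gcongr

lemma DS_S (J Y k : ℕ) (hk : 1 ≤ k) (hJ : 2 ^ J * k ≤ Y) : DS J k ≤ (2 ^ Y) ^ 486 := by
  unfold DS
  rw [← pow_mul]
  apply Nat.pow_le_pow_right (by norm_num)
  have h1 : 2 ^ (J + 1) * (k + 2) ≤ 6 * Y := by
    rw [pow_succ]
    have : 2 ^ J * (k + 2) ≤ 2 ^ J * (3 * k) := Nat.mul_le_mul_left _ (by omega)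
    nlinarith
  omega

lemma num4 (t D P : ℝ) (ht : 1 ≤ t) (hD0 : 0 ≤ D) (hD : D ≤ t ^ 486) (hP0 : 0 ≤ P) (hP : P ≤ t ^ 2) :
    D * (P * D) ≤ t ^ 1946 := by
  have ht0 : 0 ≤ t := by linarith
  calc D * (P * D) ≤ t ^ 486 * (t ^ 2 * t ^ 486) := by gcongr
    _ = t ^ 974 := by ring
    _ ≤ t ^ 1946 := pow_le_pow_right₀ ht (by norm_num)

lemma num5 (t a b : ℝ) (ht : 1 ≤ t) (ha : 0 ≤ a) (hb : 0 ≤ b) (h1 : a ≤ t ^ 486) (h2 : b ≤ t ^ 486) :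
    a * b ≤ t ^ 972 := by
  have ht0 : 0 ≤ t := by linarith
  calc a * b ≤ t ^ 486 * t ^ 486 := by gcongr
    _ = t ^ 972 := by ring

lemma num6 (t X s : ℝ) (h : t ^ 6000 ≤ X) (hs : s = Real.sqrt X) : t ^ 3000 ≤ s := by
  rw [hs]
  apply Real.le_sqrt_of_sq_le
  calc (t ^ 3000) ^ 2 = t ^ 6000 := by ring
    _ ≤ X := h

lemma cast_pow_le (v X n : ℕ) (h : v ^ n ≤ X) : (v : ℝ) ^ n ≤ X := by exact_mod_cast h
lemma cast_le_pow (v X n : ℕ) (h : X ≤ v ^ n) : (X : ℝ) ≤ (v : ℝ) ^ n := by exact_mod_cast h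

set_option maxHeartbeats 1000000 in
open Classical in
lemma core1 (B : ℕ) : ∃ c1 : ℝ, 0 < c1 ∧ ∃ t0 : ℝ, ∀ (J J' L X : ℕ) (H : Finset ℕ) (r : ℕ → ℕ),
    H ⊆ Icc 1 L → 2 * H.card ≤ L + 1 → 1 ≤ H.card → (∀ p ∈ Q 3 L, ∀ h ∈ H, ¬ p ∣ r p + h) →
    t0 ≤ 2 ^ J' → L * (J' + 1) ≤ 2 ^ J' → 2 ^ J * H.card ≤ 2 ^ J' → 2 ^ J' < 2 ^ (J + 1) * H.card →
    (2 ^ 2 ^ J') ^ 6000 ≤ X → 2 * X < (2 ^ 2 ^ J') ^ (B + 1) →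
    (∀ h ∈ H, c1 * X * (V0 J L H / P0 L) / Real.sqrt H.card ≤
      ∑ x ∈ Om L r X (X / 2), wX J L H x * (if SS (x + h) then 1 else 0)) ∧
    ∑ x ∈ Om L r X (X / 2), wX J L H x ≤ 2 * X * (V0 J L H / P0 L) := by
  obtain ⟨c, hc0, hc⟩ := prod_bound
  refine ⟨c / (412 * (4 * 2 ^ B)), by positivity, max 1000000 (1236 / c), ?_⟩
  intro J J' L X H r hH hk hk1 hr ht0 hLJ hJ1 hJ2 hX1 hX2
  obtain ⟨Y, hY⟩ : ∃ Y, Y = 2 ^ J' := ⟨_, rfl⟩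
  obtain ⟨v, hv⟩ : ∃ v, v = 2 ^ 2 ^ J' := ⟨_, rfl⟩
  have hvY : v = 2 ^ Y := by rw [hv, hY]
  obtain ⟨t, ht⟩ : ∃ t : ℝ, t = v := ⟨_, rfl⟩
  rw [← hv] at hX1
  rw [← hY] at hLJ hJ1 hJ2
  have hYv : Y ≤ v := by rw [hvY]; exact Nat.lt_two_pow_self.le
  have hYt : (Y : ℝ) ≤ t := by rw [ht]; exact_mod_cast hYv
  have ht0' : max 1000000 (1236 / c) ≤ (Y : ℝ) := by rw [hY]; push_cast; exact ht0
  have htc : 1236 / c ≤ t := ((le_max_right _ _).trans ht0').trans hYt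
  have ht6 : 1000000 ≤ t := ((le_max_left _ _).trans ht0').trans hYt
  have ht1 : 1 ≤ t := by linarith
  have hv6 : 1000000 ≤ v := by rw [ht] at ht6; exact_mod_cast ht6
  have hvX : v ^ 2 ≤ X := (Nat.pow_le_pow_right (by omega) (by norm_num : 2 ≤ 6000)).trans hX1
  have hXv : 1000000 * v ≤ X := by nlinarith
  have hLY : L ≤ Y := by nlinarith
  have hLX : 100 * L ≤ X := by omega
  have hJJ : J ≤ J' := by
    have : 2 ^ J ≤ 2 ^ J' := by rw [← hY]; nlinarith [Nat.one_le_two_pow (n := J)]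
    exact (Nat.pow_le_pow_iff_right (by norm_num)).1 this
  set k := H.card with hkd
  have hkL : k ≤ L := by omega
  have hP0 : (0 : ℝ) < P0 L := by exact_mod_cast P0_pos L
  have hP : (P0 L : ℝ) ≤ t ^ 2 := by
    have : P0 L ≤ v ^ 2 := by
      refine (P0_le L).trans ?_
      calc 4 ^ L = (2 ^ L) ^ 2 := by rw [← pow_mul, mul_comm, pow_mul]; norm_num
        _ ≤ (2 ^ Y) ^ 2 := by gcongr; norm_num
        _ = v ^ 2 := by rw [hvY]
    rw [ht]
    exact cast_le_pow _ _ _ this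
  have hV : 1 ≤ V0 J L H * t ^ 16 := by
    have h1 := V0_ge J L H hk
    have h2 : Real.exp (8 * (k * J)) ≤ t ^ 16 := by
      have h3 : k * J ≤ Y := by nlinarith
      have h3' : (k : ℝ) * J ≤ Y := by exact_mod_cast h3
      calc Real.exp (8 * (k * J)) ≤ Real.exp (8 * Y) := by gcongr
        _ = (Real.exp 1) ^ (8 * Y) := by rw [← Real.exp_nat_mul]; push_cast; ring_nf
        _ ≤ 4 ^ (8 * Y) := by
            have := Real.exp_one_lt_d9
            gcongr; linarith
        _ = t ^ 16 := by
            rw [ht, hvY]; push_cast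
            rw [← pow_mul, show (4 : ℝ) = 2 ^ 2 by norm_num, ← pow_mul]; congr 1; ring
    have h4 : Real.exp (-(8 * (k * J))) * Real.exp (8 * (k * J)) = 1 := by
      rw [← Real.exp_add]; simp
    rw [← h4]
    exact mul_le_mul h1 h2 (Real.exp_pos _).le ((Real.exp_pos _).le.trans h1)
  have hV0 : 0 < V0 J L H := lt_of_lt_of_le (Real.exp_pos _) (V0_ge J L H hk)
  have hX1' : t ^ 6000 ≤ (X : ℝ) := by rw [ht]; exact cast_pow_le _ _ _ hX1
  have hDS := DS_S J Y k hk1 hJ1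
  have hDS' := DS_S J' Y 1 le_rfl (by rw [hY]; omega)
  rw [← hvY] at hDS hDS'
  have hDSt : (DS J k : ℝ) ≤ t ^ 486 := by rw [ht]; exact cast_le_pow _ _ _ hDS
  have hDSt' : (DS J' 1 : ℝ) ≤ t ^ 486 := by rw [ht]; exact cast_le_pow _ _ _ hDS'
  have hXv' : 1000000 * 2 ^ 2 ^ J' ≤ X := by rw [← hv]; exact hXv
  constructor
  · intro h hh
    have hB := T_lower J J' L X B H hH r h hh hLX hXv' hX2
    obtain ⟨s, hs⟩ : ∃ s, s = Real.sqrt X := ⟨_, rfl⟩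
    have hs2 : s ^ 2 = X := by rw [hs]; exact Real.sq_sqrt (by positivity)
    have hs3 : t ^ 3000 ≤ s := num6 t X s hX1' hs
    have hE := err_sum J J' L X H hH hk r hr h hh hXv' _ rfl s (by rw [hs]; exact Real.sqrt_nonneg _) hs2
    rw [← hv, ← ht] at hE
    obtain ⟨D, hD⟩ : ∃ D, D = DS J H.card * DS J' 1 := ⟨_, rfl⟩
    rw [← hD] at hE
    have hDt : (D : ℝ) ≤ t ^ 972 := by
      rw [hD]; push_cast
      exact num5 _ _ _ ht1 (by positivity) (by positivity) hDSt hDSt'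
    have hJt : (J' + 1 : ℝ) ≤ t := by
      have : J' + 1 ≤ Y := by rw [hY]; exact Nat.lt_two_pow_self
      have : J' + 1 ≤ v := this.trans hYv
      rw [ht]
      exact_mod_cast this
    have hn1 := num1 t s (J' + 1) D (P0 L) ht1 hs3 (by positivity) hJt (by positivity) hDt hP0.le hP
    have hk1' : (1 : ℝ) ≤ k := by exact_mod_cast hk1
    have hkt : (k : ℝ) ≤ t := by rw [ht]; exact_mod_cast (hkL.trans hLY).trans hYv
    obtain ⟨q, hq⟩ : ∃ q, q = Real.sqrt k := ⟨_, rfl⟩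
    rw [← hq]
    have hq0 : 0 < q := by rw [hq]; exact Real.sqrt_pos.2 (by linarith)
    have hqt : q ≤ t := by
      refine le_trans ?_ hkt
      rw [hq]
      exact Real.sqrt_le_iff.2 ⟨by linarith, by nlinarith⟩
    have hn2 := num2 t s c (V0 J L H) (P0 L) q hc0 ht1 htc hs3 hV hP0 hP hq0 hqt
    have hpb := hc J J' L H hk1 hk
    have hrat : 1 / (2 * q) ≤ Real.sqrt (2 ^ J) / Real.sqrt (2 ^ J') := by
      rw [div_le_div_iff₀ (by positivity) (Real.sqrt_pos.2 (by positivity)), one_mul]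
      apply Real.sqrt_le_iff.2
      refine ⟨by positivity, ?_⟩
      rw [mul_pow, mul_pow, Real.sq_sqrt (by positivity), hq, Real.sq_sqrt (by positivity)]
      have h5 : ((2 : ℝ) ^ J') < 2 ^ (J + 1) * k := by rw [hY] at hJ2; exact_mod_cast hJ2
      rw [pow_succ] at h5
      have : (0 : ℝ) ≤ 2 ^ J * k := by positivity
      linarith
    rw [← hv] at hB hpb
    have hVP : 0 < V0 J L H / P0 L := by positivity
    have hmain : s ^ 2 * (c / 206) * (V0 J L H / P0 L) / q ≤ (X : ℝ) / 103 *
        (beta L * (V1 J L H.card * (1 / 2 * VR J' H.card)) * ∑ m ∈ M1 v, (1 : ℝ) / m) := by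
      calc s ^ 2 * (c / 206) * (V0 J L H / P0 L) / q
          = (X : ℝ) / 103 * (c * (V0 J L H / P0 L) * (1 / (2 * q))) := by rw [hs2]; field_simp; try ring
        _ ≤ (X : ℝ) / 103 * (c * (V0 J L H / P0 L) * (Real.sqrt (2 ^ J) / Real.sqrt (2 ^ J'))) := by gcongr
        _ ≤ _ := by gcongr
    have hfin : s ^ 2 * (c / 206) * (V0 J L H / P0 L) / q / 2 ≤ (4 * 2 ^ B) *
        ∑ x ∈ Om L r X (X / 2), wX J L H x * (if SS (x + h) then 1 else 0) := by
      linarith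
    have e : c / (412 * (4 * 2 ^ B)) * X * (V0 J L H / P0 L) / q =
        (s ^ 2 * (c / 206) * (V0 J L H / P0 L) / q / 2) / (4 * 2 ^ B) := by
      rw [hs2]; field_simp; try ring
    rw [e, div_le_iff₀ (by positivity)]
    linarith
  · have hW := upperW J L H hH hk r X (X / 2)
    have hE : (DS J H.card : ℝ) * ((P0 L : ℝ) * DS J H.card) ≤ t ^ 1946 := by
      exact num4 _ _ _ ht1 (by positivity) hDSt (by positivity) hP
    have hn := num3 t X (V0 J L H) (P0 L) _ ht1 hX1' hV hP0 hP hE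
    have h2 : ((X / 2 : ℕ) : ℝ) ≤ X / 2 := by
      have := Nat.cast_div_le (α := ℝ) (m := X) (n := 2)
      exact_mod_cast this
    have h3 : ((X / 2 : ℕ) : ℝ) / (P0 L : ℝ) * (2 * V0 J L H) ≤ X * (V0 J L H / P0 L) := by
      calc ((X / 2 : ℕ) : ℝ) / (P0 L : ℝ) * (2 * V0 J L H) ≤ (X / 2) / (P0 L : ℝ) * (2 * V0 J L H) := by gcongr
        _ = _ := by ring
    linarith

end VS

open Finset Filter Topology
namespace VS

open Classical in
lemma count_abs (Ω H : Finset ℕ) (w : ℕ → ℝ) (P : ℕ → Prop) (c G M : ℝ) (hc : 0 < c) (hG : 0 < G)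
    (hk : 1 ≤ H.card) (hw : ∀ x ∈ Ω, 0 ≤ w x ∧ w x ≤ M)
    (h1 : ∀ h ∈ H, c * G / Real.sqrt H.card ≤ ∑ x ∈ Ω, w x * (if P (x + h) then 1 else 0))
    (h2 : ∑ x ∈ Ω, w x ≤ 2 * G) :
    c / 2 * G ≤ H.card * M *
      ((Ω.filter (fun x => c / 4 * Real.sqrt H.card ≤ ((H.filter (fun h => P (x + h))).card : ℝ))).card : ℝ) := by
  have hk1 : (1 : ℝ) ≤ H.card := by exact_mod_cast hk
  obtain ⟨q, hq⟩ : ∃ q, q = Real.sqrt H.card := ⟨_, rfl⟩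
  have hq2 : q * q = H.card := by rw [hq]; exact Real.mul_self_sqrt (by positivity)
  have hq1 : 1 ≤ q := by rw [hq]; exact Real.one_le_sqrt.2 hk1
  rw [← hq] at h1 ⊢
  obtain ⟨r, hr⟩ : ∃ r : ℕ → ℝ, r = fun x => ((H.filter (fun h => P (x + h))).card : ℝ) := ⟨_, rfl⟩
  have hr' : ∀ x, r x = ∑ h ∈ H, (if P (x + h) then (1 : ℝ) else 0) := by
    intro x; rw [hr]; simp
  have hrk : ∀ x, r x ≤ H.card := by
    intro x; rw [hr]
    have := card_filter_le H (fun h => P (x + h))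
    exact Nat.cast_le.2 this
  have hr0 : ∀ x, 0 ≤ r x := by intro x; rw [hr]; positivity
  have hM0 : ∀ x ∈ Ω, 0 ≤ M := fun x hx => (hw x hx).1.trans (hw x hx).2
  have hsum : c * G * q ≤ ∑ x ∈ Ω, w x * r x := by
    calc c * G * q = ∑ h ∈ H, c * G / q := by
          rw [sum_const, nsmul_eq_mul, ← hq2]; field_simp
      _ ≤ ∑ h ∈ H, ∑ x ∈ Ω, w x * (if P (x + h) then 1 else 0) := sum_le_sum h1
      _ = ∑ x ∈ Ω, w x * r x := by
          rw [sum_comm]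
          apply sum_congr rfl
          intro x _
          rw [hr', mul_sum]
  have e : (Ω.filter (fun x => c / 4 * q ≤ ((H.filter (fun h => P (x + h))).card : ℝ))) =
      Ω.filter (fun x => c / 4 * q ≤ r x) := by rw [hr]
  rw [e]
  have hpt : ∀ x ∈ Ω, w x * r x ≤ c / 4 * q * w x + (if c / 4 * q ≤ r x then H.card * M else 0) := by
    intro x hx
    have a := hw x hx
    split_ifs with h
    · have : w x * r x ≤ M * H.card := mul_le_mul a.2 (hrk x) (hr0 x) (hM0 x hx)
      have : 0 ≤ c / 4 * q * w x := mul_nonneg (by positivity) a.1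
      linarith
    · push Not at h
      nlinarith [a.1]
  have hsum2 := sum_le_sum hpt
  rw [sum_add_distrib, ← mul_sum, ← sum_filter, sum_const, nsmul_eq_mul] at hsum2
  have h3 : c / 4 * q * ∑ x ∈ Ω, w x ≤ c / 4 * q * (2 * G) := by gcongr
  have h4 : c / 2 * G ≤ c / 2 * G * q := by nlinarith [mul_pos hc hG]
  linarith

lemma card_pd (S : Finset ℕ) (hS : ∀ p ∈ S, p.Prime) (n M : ℕ) (hn : 0 < n) (hM : n < 2 ^ M) :
    (S.filter (fun p => p ∣ n)).card ≤ M := by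
  have h1 : S.filter (fun p => p ∣ n) ⊆ n.primeFactors := by
    intro p hp
    rw [mem_filter] at hp
    exact Nat.mem_primeFactors.2 ⟨hS p hp.1, hp.2, by omega⟩
  refine (card_le_card h1).trans ?_
  have h2 : 2 ^ n.primeFactors.card ≤ n := by
    calc 2 ^ n.primeFactors.card = ∏ p ∈ n.primeFactors, 2 := by rw [prod_const]
      _ ≤ ∏ p ∈ n.primeFactors, p := prod_le_prod' (fun p hp => (Nat.prime_of_mem_primeFactors hp).two_le)
      _ ≤ n := Nat.le_of_dvd hn (Nat.prod_primeFactors_dvd n)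
  exact ((Nat.pow_lt_pow_iff_right (by norm_num)).1 (h2.trans_lt hM)).le

lemma eX_sum (H S : Finset ℕ) (hS : ∀ p ∈ S, p.Prime) (x M : ℕ) (h0 : ∀ h ∈ H, 0 < h)
    (hM : ∀ h ∈ H, x + h < 2 ^ M) : ∑ p ∈ S, eX H x p ≤ H.card * M := by
  classical
  have h1 : ∀ p ∈ S, eX H x p ≤ ∑ h ∈ H, (if p ∣ x + h then (1 : ℝ) else 0) := by
    intro p _
    unfold eX
    have h00 : ∀ h ∈ H, (0 : ℝ) ≤ (if p ∣ x + h then (1 : ℝ) else 0) := by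
      intro h _; split_ifs <;> norm_num
    split_ifs with h
    · obtain ⟨h, hh, hd⟩ := h
      refine le_trans ?_ (single_le_sum h00 hh)
      simp [hd]
    · exact sum_nonneg h00
  refine (sum_le_sum h1).trans ?_
  rw [sum_comm]
  calc ∑ h ∈ H, ∑ p ∈ S, (if p ∣ x + h then (1 : ℝ) else 0) ≤ ∑ h ∈ H, (M : ℝ) := by
        apply sum_le_sum
        intro h hh
        rw [← sum_filter, sum_const, nsmul_eq_mul, mul_one]
        have := h0 h hh
        exact_mod_cast card_pd S hS (x + h) M (by omega) (hM h hh)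
    _ = _ := by rw [sum_const, nsmul_eq_mul]

set_option maxHeartbeats 1000000 in
open Classical in
lemma core2 (B : ℕ) : ∃ c2 : ℝ, 0 < c2 ∧ ∃ t0 : ℝ, ∀ (J J' L X : ℕ) (H : Finset ℕ) (r : ℕ → ℕ),
    H ⊆ Icc 1 L → 2 * H.card ≤ L + 1 → 1 ≤ H.card → (∀ p ∈ Q 3 L, ∀ h ∈ H, ¬ p ∣ r p + h) →
    t0 ≤ 2 ^ J' → L * (J' + 1) ≤ 2 ^ J' → 2 ^ J * H.card ≤ 2 ^ J' → 2 ^ J' < 2 ^ (J + 1) * H.card →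
    (2 ^ 2 ^ J') ^ 6000 ≤ X → 2 * X < (2 ^ 2 ^ J') ^ (B + 1) →
    c2 * X ≤ 2 ^ (80 * (B + 3) * (L * (J' + 1) ^ 3)) *
      (((Ico X (X + X / 2)).filter
        (fun x => c2 * Real.sqrt H.card ≤ ((H.filter (fun h => SS (x + h))).card : ℝ))).card : ℝ) := by
  obtain ⟨c, hc0, t0, hc⟩ := core1 B
  refine ⟨c / 4, by positivity, t0, ?_⟩
  intro J J' L X H r hH hk hk1 hr ht0 hLJ hJ1 hJ2 hX1 hX2
  obtain ⟨hA, hB⟩ := hc J J' L X H r hH hk hk1 hr ht0 hLJ hJ1 hJ2 hX1 hX2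
  obtain ⟨Y, hY⟩ : ∃ Y, Y = 2 ^ J' := ⟨_, rfl⟩
  rw [← hY] at hLJ hJ1 hJ2 hX1 hX2
  have hV := V0_ge J L H hk
  have hV0 : 0 < V0 J L H := lt_of_lt_of_le (Real.exp_pos _) hV
  have hP0 : (0 : ℝ) < P0 L := by exact_mod_cast P0_pos L
  have hJJ : J ≤ J' := by
    have : 2 ^ J ≤ 2 ^ J' := by rw [← hY]; nlinarith
    exact (Nat.pow_le_pow_iff_right (by norm_num)).1 this
  obtain ⟨k, hkd⟩ : ∃ k, k = H.card := ⟨_, rfl⟩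
  have hkL : k ≤ L := by omega
  have hLY : L ≤ Y := by nlinarith
  have hYX : 2 * Y < X := by
    have h1 : Y < 2 ^ Y := Nat.lt_two_pow_self
    have h2 : (2 ^ Y) ^ 2 ≤ (2 ^ Y) ^ 6000 := Nat.pow_le_pow_right (by positivity) (by norm_num : 2 ≤ 6000)
    have h3 : 2 ≤ 2 ^ Y := by
      have : 1 ≤ Y := by omega
      calc 2 = 2 ^ 1 := rfl
        _ ≤ 2 ^ Y := Nat.pow_le_pow_right (by norm_num) this
    have h4 : 2 * Y < (2 ^ Y) ^ 2 := by nlinarith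
    exact h4.trans_le (h2.trans hX1)
  have hX0 : (0 : ℝ) < X := by exact_mod_cast (by omega : 0 < X)
  rw [← pow_mul] at hX2
  have hmax : ∀ x ∈ Om L r X (X / 2), 0 ≤ wX J L H x ∧
      wX J L H x ≤ (1 + k * ((Y * (B + 1) : ℕ) : ℝ)) ^ (80 * J * (k + J)) := by
    intro x hx
    refine ⟨wX_nonneg _ _ _ _, ?_⟩
    unfold wX
    rw [hkd]
    apply WW_max
    · positivity
    · intro i _ p _; exact eX_01 H x p
    · intro i _
      apply eX_sum
      · intro p hp; exact (mem_SB hp).2.1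
      · intro h hh; have := mem_Icc.1 (hH hh); omega
      · intro h hh
        have := mem_Icc.1 (hH hh)
        have hx' := mem_Ico.1 (mem_filter.1 hx).1
        omega
  have hG : 0 < (X : ℝ) * (V0 J L H / P0 L) := by positivity
  have hcount := count_abs (Om L r X (X / 2)) H (wX J L H) SS c (X * (V0 J L H / P0 L)) _ hc0 hG hk1 hmax
    (fun h hh => by have := hA h hh; rwa [mul_assoc c] at this) (by linarith)
  have hsub : ((Om L r X (X / 2)).filter (fun x => c / 4 * Real.sqrt H.card ≤
      ((H.filter (fun h => SS (x + h))).card : ℝ))).card ≤ ((Ico X (X + X / 2)).filter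
        (fun x => c / 4 * Real.sqrt H.card ≤ ((H.filter (fun h => SS (x + h))).card : ℝ))).card := by
    apply card_le_card
    apply filter_subset_filter
    exact filter_subset _ _
  obtain ⟨g, hg⟩ : ∃ g, g = ((Om L r X (X / 2)).filter (fun x => c / 4 * Real.sqrt H.card ≤
      ((H.filter (fun h => SS (x + h))).card : ℝ))).card := ⟨_, rfl⟩
  obtain ⟨g', hg'⟩ : ∃ g', g' = ((Ico X (X + X / 2)).filter
        (fun x => c / 4 * Real.sqrt H.card ≤ ((H.filter (fun h => SS (x + h))).card : ℝ))).card := ⟨_, rfl⟩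
  rw [← hg, ← hg'] at hsub
  rw [← hg, ← hkd] at hcount
  rw [← hg']
  -- numerics
  rw [← hkd] at hk1 hJ1 hJ2 hk
  have hL1 : 1 ≤ L := by omega
  have b1 : (1 + k * ((Y * (B + 1) : ℕ) : ℝ)) ≤ 2 ^ ((B + 2) * (J' + 1)) := by
    have h1 : 1 + k * (Y * (B + 1)) ≤ 2 ^ ((B + 2) * (J' + 1)) := by
      have a1 : B + 1 ≤ 2 ^ B := Nat.lt_two_pow_self
      have a2 : 1 ≤ k * (Y * (B + 1)) := by
        have : 1 ≤ Y := by omega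
        exact Nat.mul_pos hk1 (Nat.mul_pos this (by omega))
      calc 1 + k * (Y * (B + 1)) ≤ 2 * (k * (Y * (B + 1))) := by omega
        _ ≤ 2 * (Y * (Y * 2 ^ B)) := by gcongr; omega
        _ = 2 ^ (1 + J' + J' + B) := by rw [hY]; ring
        _ ≤ _ := Nat.pow_le_pow_right (by norm_num) (by nlinarith)
    exact_mod_cast h1
  obtain ⟨T, hT⟩ : ∃ T, T = L * (J' + 1) ^ 3 := ⟨_, rfl⟩
  have hT1 : L * (J' + 1) ≤ T := by
    rw [hT]; apply Nat.mul_le_mul_left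
    calc J' + 1 = (J' + 1) ^ 1 := by ring
      _ ≤ (J' + 1) ^ 3 := Nat.pow_le_pow_right (by omega) (by norm_num)
  have hT2 : J * (k + J) * (J' + 1) ≤ T := by
    have a1 : k + J ≤ L * (J' + 1) := by nlinarith
    calc J * (k + J) * (J' + 1) ≤ (J' + 1) * (L * (J' + 1)) * (J' + 1) := by gcongr; omega
      _ = T := by rw [hT]; ring
  have b2 : (1 + k * ((Y * (B + 1) : ℕ) : ℝ)) ^ (80 * J * (k + J)) ≤ 2 ^ (80 * (B + 2) * T) := by
    calc (1 + k * ((Y * (B + 1) : ℕ) : ℝ)) ^ (80 * J * (k + J)) ≤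
        (2 ^ ((B + 2) * (J' + 1))) ^ (80 * J * (k + J)) := by gcongr
      _ = 2 ^ (80 * (B + 2) * (J * (k + J) * (J' + 1))) := by rw [← pow_mul]; congr 1; ring
      _ ≤ _ := pow_le_pow_right₀ (by norm_num) (Nat.mul_le_mul_left _ hT2)
  have b3 : (k : ℝ) ≤ 2 ^ T := by
    have : k ≤ 2 ^ T := by
      have : k ≤ T := by nlinarith
      exact this.trans Nat.lt_two_pow_self.le
    exact_mod_cast this
  have b4 : (P0 L : ℝ) ≤ 2 ^ (2 * T) := by
    have : P0 L ≤ 2 ^ (2 * T) := by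
      refine (P0_le L).trans ?_
      rw [pow_mul]
      exact Nat.pow_le_pow_right (by norm_num) (by nlinarith)
    exact_mod_cast this
  have b5 : 1 ≤ V0 J L H * 2 ^ (16 * T) := by
    have h2 : Real.exp (8 * (k * J)) ≤ 2 ^ (16 * T) := by
      have h3 : k * J ≤ T := by nlinarith
      have h3' : (k : ℝ) * J ≤ T := by exact_mod_cast h3
      calc Real.exp (8 * (k * J)) ≤ Real.exp (8 * T) := by gcongr
        _ = (Real.exp 1) ^ (8 * T) := by rw [← Real.exp_nat_mul]; push_cast; ring_nf
        _ ≤ 4 ^ (8 * T) := by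
            have := Real.exp_one_lt_d9
            gcongr; linarith
        _ = 2 ^ (16 * T) := by
            rw [show (4 : ℝ) = 2 ^ 2 by norm_num, ← pow_mul]; congr 1; ring
    have h4 : Real.exp (-(8 * (k * J))) * Real.exp (8 * (k * J)) = 1 := by
      rw [← Real.exp_add]; simp
    rw [← hkd] at hV
    rw [← h4]
    exact mul_le_mul hV h2 (Real.exp_pos _).le ((Real.exp_pos _).le.trans hV)
  rw [← hT]
  have hgg : (g : ℝ) ≤ g' := by exact_mod_cast hsub
  obtain ⟨W, hW⟩ : ∃ W, W = (1 + k * ((Y * (B + 1) : ℕ) : ℝ)) ^ (80 * J * (k + J)) := ⟨_, rfl⟩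
  rw [← hW] at hcount b2
  have hW0 : 0 ≤ W := by rw [hW]; positivity
  obtain ⟨V, hVd⟩ : ∃ V, V = V0 J L H := ⟨_, rfl⟩
  obtain ⟨P, hPd⟩ : ∃ P : ℝ, P = P0 L := ⟨_, rfl⟩
  rw [← hVd] at hcount b5 hV0
  rw [← hPd] at hcount
  rw [← hPd] at b4 hP0
  calc c / 4 * X ≤ c / 2 * X := by gcongr; norm_num
    _ = c / 2 * X * 1 := by ring
    _ ≤ c / 2 * X * (V * 2 ^ (16 * T)) := by gcongr
    _ = c / 2 * (X * (V / P)) * (P * 2 ^ (16 * T)) := by field_simp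
    _ ≤ (k * W * g) * (P * 2 ^ (16 * T)) := by gcongr
    _ ≤ (2 ^ T * 2 ^ (80 * (B + 2) * T) * g') * (2 ^ (2 * T) * 2 ^ (16 * T)) := by gcongr
    _ = 2 ^ (T + 80 * (B + 2) * T + 2 * T + 16 * T) * g' := by rw [pow_add, pow_add, pow_add]; ring
    _ ≤ 2 ^ (80 * (B + 3) * T) * g' := by
        gcongr
        · norm_num
        · nlinarith

end VS

open Finset Filter Topology
namespace VS

lemma pickJ (A n : ℕ) (hA : 1 ≤ A) (h : 2 ^ A ≤ n) : ∃ J' : ℕ, (2 ^ 2 ^ J') ^ A ≤ n ∧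
    2 * n < (2 ^ 2 ^ J') ^ (2 * A + 1) ∧ (A : ℝ) * 2 ^ J' * Real.log 2 ≤ Real.log n ∧
    Real.log n ≤ 2 * A * 2 ^ J' * Real.log 2 := by
  have hn : n ≠ 0 := by
    have : 0 < 2 ^ A := by positivity
    omega
  obtain ⟨M, hM⟩ : ∃ M, M = Nat.log 2 n := ⟨_, rfl⟩
  have h1 : 2 ^ M ≤ n := by rw [hM]; exact Nat.pow_log_le_self 2 hn
  have h2 : n < 2 ^ (M + 1) := by rw [hM]; exact Nat.lt_pow_succ_log_self (by norm_num) n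
  have hAM : A ≤ M := by
    have := (Nat.pow_lt_pow_iff_right (a := 2) (by norm_num)).1 (h.trans_lt h2)
    omega
  have h3 : 2 ^ Nat.log 2 (M / A) ≤ M / A := Nat.pow_log_le_self 2 (Nat.div_pos hAM hA).ne'
  have h4 : M / A < 2 ^ (Nat.log 2 (M / A) + 1) := Nat.lt_pow_succ_log_self (by norm_num) _
  obtain ⟨J', hJ⟩ : ∃ J', J' = Nat.log 2 (M / A) := ⟨_, rfl⟩
  rw [← hJ] at h3 h4
  obtain ⟨Y, hY⟩ : ∃ Y, Y = 2 ^ J' := ⟨_, rfl⟩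
  rw [pow_succ] at h4
  rw [← hY] at h3 h4
  have h5 : Y * A ≤ M := (Nat.le_div_iff_mul_le hA).1 h3
  have h6 : M < Y * 2 * A := (Nat.div_lt_iff_lt_mul hA).1 h4
  have h7 : (2 ^ Y) ^ A ≤ n := by
    rw [← pow_mul]; exact (Nat.pow_le_pow_right (by norm_num) h5).trans h1
  have h8 : n < (2 ^ Y) ^ (2 * A) := by
    rw [← pow_mul]; exact h2.trans_le (Nat.pow_le_pow_right (by norm_num) (by rw [← mul_assoc]; omega))
  refine ⟨J', by rw [← hY]; exact h7, ?_, ?_, ?_⟩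
  · rw [← hY, pow_succ]
    have : 2 ≤ 2 ^ Y := by
      have : 1 ≤ Y := by rw [hY]; exact Nat.one_le_two_pow
      calc 2 = 2 ^ 1 := rfl
        _ ≤ 2 ^ Y := Nat.pow_le_pow_right (by norm_num) this
    nlinarith
  · have : ((2 : ℝ) ^ Y) ^ A ≤ n := by exact_mod_cast h7
    have := Real.log_le_log (by positivity) this
    rw [Real.log_pow, Real.log_pow, hY] at this
    push_cast at this
    linarith
  · have : (n : ℝ) ≤ ((2 : ℝ) ^ Y) ^ (2 * A) := by exact_mod_cast h8.le
    have := Real.log_le_log (by exact_mod_cast Nat.pos_of_ne_zero hn) this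
    rw [Real.log_pow, Real.log_pow, hY] at this
    push_cast at this
    linarith

lemma pickJ2 (Y k : ℕ) (hk : 1 ≤ k) (hkY : k ≤ Y) : ∃ J, 2 ^ J * k ≤ Y ∧ Y < 2 ^ (J + 1) * k := by
  refine ⟨Nat.log 2 (Y / k), ?_, ?_⟩
  · exact (Nat.le_div_iff_mul_le hk).1 (Nat.pow_log_le_self 2 (Nat.div_pos hkY hk).ne')
  · exact (Nat.div_lt_iff_lt_mul hk).1 (Nat.lt_pow_succ_log_self (by norm_num) _)

lemma pickH : ∃ c3 : ℝ, 0 < c3 ∧ ∀ (y : ℝ) (L : ℕ), 2 ≤ y → L = ⌊y⌋₊ → ∃ (H : Finset ℕ) (r : ℕ → ℕ),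
    H ⊆ Icc 1 L ∧ 2 * H.card ≤ L + 1 ∧ 1 ≤ H.card ∧ (∀ p ∈ Q 3 L, ∀ h ∈ H, ¬ p ∣ r p + h) ∧
    c3 * (y ^ ((1 : ℝ) / 2) * Real.log y ^ (-(1 : ℝ) / 4)) ≤ Real.sqrt H.card := by
  obtain ⟨C, hC1, hC⟩ := mertens4
  refine ⟨1 / (2 * Real.sqrt C), by positivity, ?_⟩
  intro y L hy hL
  have hLy : (L : ℝ) ≤ y := by rw [hL]; exact Nat.floor_le (by linarith)
  have hyL : y < L + 1 := by rw [hL]; exact Nat.lt_floor_add_one y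
  have hL2 : 2 ≤ L := by rw [hL]; exact Nat.le_floor (by exact_mod_cast hy)
  have hL2' : (2 : ℝ) ≤ L := by exact_mod_cast hL2
  obtain ⟨H, hH, r, hr, hcard⟩ := greedy ((L + 1) / 2) (Q 3 L) (fun p hp => (mem_Q.1 hp).2.1.two_le)
  have hm := (hC L hL2).2.1
  have hly : 0 < Real.log y := Real.log_pos (by linarith)
  have hlL : Real.log L ≤ Real.log y := Real.log_le_log (by linarith) hLy
  obtain ⟨Pi, hPi⟩ : ∃ Pi, Pi = ∏ p ∈ Q 3 L, (1 - 1 / (p : ℝ)) := ⟨_, rfl⟩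
  rw [← hPi] at hm hcard
  have hPi0 : 0 ≤ Pi := by
    rw [hPi]
    apply prod_nonneg
    intro p hp
    have : (2 : ℝ) ≤ p := by exact_mod_cast (mem_Q.1 hp).2.1.two_le
    have : 1 / (p : ℝ) ≤ 1 := by rw [div_le_one (by linarith)]; linarith
    linarith
  have hsq : 0 < Real.sqrt (Real.log y) := Real.sqrt_pos.2 hly
  have hm2 : 1 ≤ C * Real.sqrt (Real.log y) * Pi := hm.trans (by gcongr)
  have hfl : (L : ℝ) / 2 ≤ ((L + 1) / 2 : ℕ) := by
    have : L ≤ 2 * ((L + 1) / 2) := by omega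
    have : (L : ℝ) ≤ 2 * ((L + 1) / 2 : ℕ) := by exact_mod_cast this
    linarith
  have hk : y ≤ 4 * C * H.card * Real.sqrt (Real.log y) := by
    calc y ≤ 4 * (L / 2) * 1 := by linarith
      _ ≤ 4 * ((L + 1) / 2 : ℕ) * (C * Real.sqrt (Real.log y) * Pi) := by gcongr
      _ = 4 * C * ((((L + 1) / 2 : ℕ) : ℝ) * Pi) * Real.sqrt (Real.log y) := by ring
      _ ≤ _ := by gcongr
  refine ⟨H, r, ?_, ?_, ?_, hr, ?_⟩
  · exact hH.trans (Icc_subset_Icc le_rfl (by omega))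
  · have := card_le_card hH
    rw [Nat.card_Icc] at this
    omega
  · by_contra h0
    have : H.card = 0 := by omega
    rw [this] at hk
    simp at hk
    linarith
  · apply Real.le_sqrt_of_sq_le
    have e1 : (y ^ ((1 : ℝ) / 2)) ^ 2 = y := by
      rw [← Real.sqrt_eq_rpow, Real.sq_sqrt (by linarith)]
    have e2 : (Real.log y ^ (-(1 : ℝ) / 4)) ^ 2 = 1 / Real.sqrt (Real.log y) := by
      rw [← Real.rpow_natCast, ← Real.rpow_mul hly.le, Real.sqrt_eq_rpow, one_div (Real.log y ^ _),
        ← Real.rpow_neg hly.le]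
      congr 1; norm_num
    rw [mul_pow, mul_pow, e1, e2, div_pow, mul_pow, Real.sq_sqrt (by linarith)]
    rw [mul_one_div, div_mul_div_comm, div_le_iff₀ (by positivity)]
    linarith

end VS

open Finset Filter Topology
namespace VS

open Classical in
lemma Scount_diff (x : ℕ) (y : ℝ) (L : ℕ) (hy : 0 ≤ y) (hL : L = ⌊y⌋₊) (H : Finset ℕ) (hH : H ⊆ Icc 1 L) :
    ((H.filter (fun h => SS (x + h))).card : ℝ) ≤ (Scount ((x : ℝ) + y) : ℝ) - (Scount (x : ℝ) : ℝ) := by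
  have hLy : (L : ℝ) ≤ y := by rw [hL]; exact Nat.floor_le hy
  have hfin : ∀ z : ℝ, {n : ℕ | (n : ℝ) ≤ z ∧ IsSumTwoSquares n}.Finite := by
    intro z
    apply (Set.finite_Iic ⌊z⌋₊).subset
    intro n hn
    exact Nat.le_floor hn.1
  obtain ⟨I, hI⟩ : ∃ I : Finset ℕ, I = (H.filter (fun h => SS (x + h))).image (fun h => x + h) := ⟨_, rfl⟩
  have hIc : I.card = (H.filter (fun h => SS (x + h))).card := by
    rw [hI]; exact card_image_of_injective _ (add_right_injective x)
  have hIm : ∀ n ∈ I, x < n ∧ (n : ℝ) ≤ x + y ∧ IsSumTwoSquares n := by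
    intro n hn
    rw [hI, mem_image] at hn
    obtain ⟨h, hh, rfl⟩ := hn
    rw [mem_filter] at hh
    have := mem_Icc.1 (hH hh.1)
    refine ⟨by omega, ?_, hh.2⟩
    push_cast
    have : (h : ℝ) ≤ L := by exact_mod_cast this.2
    linarith
  have hu : {n : ℕ | (n : ℝ) ≤ (x : ℝ) ∧ IsSumTwoSquares n} ∪ (I : Set ℕ) ⊆
      {n : ℕ | (n : ℝ) ≤ (x : ℝ) + y ∧ IsSumTwoSquares n} := by
    rintro n (hn | hn)
    · exact ⟨by linarith [hn.1], hn.2⟩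
    · exact (hIm n hn).2
  have hd : Disjoint {n : ℕ | (n : ℝ) ≤ (x : ℝ) ∧ IsSumTwoSquares n} (I : Set ℕ) := by
    rw [Set.disjoint_left]
    intro n hn hn'
    have h1 := (hIm n hn').1
    have h2 : n ≤ x := by exact_mod_cast hn.1
    omega
  have h3 := Set.ncard_le_ncard hu (hfin _)
  rw [Set.ncard_union_eq hd (hfin _) I.finite_toSet, Set.ncard_coe_finset, hIc] at h3
  have h4 : (Scount (x : ℝ) : ℝ) + ((H.filter (fun h => SS (x + h))).card : ℝ) ≤ Scount ((x : ℝ) + y) := by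
    unfold Scount
    exact_mod_cast h3
  linarith

/-- numerics in the variable `u = (log X)^(1/10)` -/
lemma numu (K C u : ℝ) (hK : 0 ≤ K) (hC : 0 ≤ C) (hu : 1 + K + C ≤ u) : C + K * u ^ 5 ≤ u ^ 9 := by
  have hu1 : 1 ≤ u := by linarith
  have h5 : 1 ≤ u ^ 5 := one_le_pow₀ hu1
  calc C + K * u ^ 5 ≤ C * u ^ 5 + K * u ^ 5 := by nlinarith
    _ = (C + K) * u ^ 5 := by ring
    _ ≤ u * u ^ 5 := by gcongr; linarith
    _ = u ^ 6 := by ring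
    _ ≤ u ^ 9 := pow_le_pow_right₀ hu1 (by norm_num)

lemma ev_u (a : ℝ) : ∃ X0 : ℝ, ∀ X : ℝ, X0 ≤ X → a ≤ Real.log X ^ ((1 : ℝ) / 10) ∧
    Real.log (Real.log X) ≤ Real.log X ^ ((1 : ℝ) / 10) ∧ 1 ≤ Real.log (Real.log X) ∧ a ≤ X := by
  have h1 : Tendsto (fun X : ℝ => Real.log X ^ ((1 : ℝ) / 10)) atTop atTop :=
    (tendsto_rpow_atTop (by norm_num)).comp Real.tendsto_log_atTop
  have h2 : ∀ᶠ l : ℝ in atTop, Real.log l ≤ l ^ ((1 : ℝ) / 10) := by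
    have := (isLittleO_log_rpow_atTop (by norm_num : (0 : ℝ) < 1 / 10)).bound (by norm_num : (0 : ℝ) < 1)
    filter_upwards [this, eventually_ge_atTop 1] with l hl hl1
    rw [one_mul, Real.norm_eq_abs, Real.norm_eq_abs, abs_of_nonneg (by positivity : (0:ℝ) ≤ l ^ ((1 : ℝ) / 10))] at hl
    exact (le_abs_self _).trans hl
  have h3 : ∀ᶠ X : ℝ in atTop, Real.log (Real.log X) ≤ Real.log X ^ ((1 : ℝ) / 10) :=
    Real.tendsto_log_atTop.eventually h2
  have h4 : ∀ᶠ X : ℝ in atTop, 1 ≤ Real.log (Real.log X) :=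
    (Real.tendsto_log_atTop.comp Real.tendsto_log_atTop).eventually (eventually_ge_atTop 1)
  have h5 := ((h1.eventually (eventually_ge_atTop a)).and (h3.and (h4.and (eventually_ge_atTop a))))
  obtain ⟨X0, hX0⟩ := eventually_atTop.1 h5
  exact ⟨X0, hX0⟩

set_option maxHeartbeats 1000000 in
lemma final_num (c2 : ℝ) (hc2 : 0 < c2) (t0 : ℝ) (E A : ℕ) (hA : 4 ≤ A) :
    ∃ a : ℝ, ∀ (X l u y Y : ℝ) (L j : ℕ), a ≤ u → l = Real.log X → u ^ 10 = l → 1 ≤ Real.log l → Real.log l ≤ u →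
      2 ≤ X → (L : ℝ) ≤ u ^ 2 → Y = 2 ^ j →
      A * Y * Real.log 2 ≤ Real.log (2 * X) → Real.log X ≤ 2 * A * Y * Real.log 2 →
      t0 ≤ Y ∧ (L : ℝ) * (j + 1) ≤ Y ∧
      X ^ (1 - 1 / Real.log l) * 2 ^ (E * (L * (j + 1) ^ 3)) ≤ c2 * X := by
  refine ⟨1 + 27 * E + |Real.log c2| + |t0| * (2 * A) + 3 * (2 * A), ?_⟩
  intro X l u y Y L j hau hl hul hll hlu hX hL hY h1 h2
  have hA' : (4 : ℝ) ≤ A := by exact_mod_cast hA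
  have e0 : (0 : ℝ) ≤ E := by positivity
  have e1 := abs_nonneg (Real.log c2)
  have e2 : 0 ≤ |t0| * (2 * A) := by positivity
  have hu1 : 1 ≤ u := by linarith
  have hu0 : 0 < u := by linarith
  have hl2 := Real.log_two_lt_d9
  have hl2' := Real.log_two_gt_d9
  have hY0 : 0 < Y := by rw [hY]; positivity
  have hlog2X : Real.log (2 * X) ≤ 2 * l := by
    rw [Real.log_mul (by norm_num) (by linarith), hl]
    have := Real.log_le_log (by norm_num) hX
    linarith
  have hYl : Y ≤ l := by
    have : 4 * Y * (1 / 2) ≤ A * Y * Real.log 2 := by gcongr; linarith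
    linarith
  have hlY : l ≤ 2 * A * Y := by
    have : 2 * A * Y * Real.log 2 ≤ 2 * A * Y * 1 := by gcongr; linarith
    rw [hl]; linarith
  have hj : (j : ℝ) + 1 ≤ 3 * u := by
    have := Real.log_le_log hY0 hYl
    rw [hY, Real.log_pow] at this
    have h0 : (0 : ℝ) ≤ j := by positivity
    have : (j : ℝ) * (1 / 2) ≤ j * Real.log 2 := by gcongr; linarith
    linarith
  have hu10 : u * u ^ 3 ≤ l := by
    rw [← hul]
    calc u * u ^ 3 = u ^ 4 := by ring
      _ ≤ u ^ 10 := pow_le_pow_right₀ hu1 (by norm_num)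
  have hu10' : u ≤ l := by
    have : 1 ≤ u ^ 3 := one_le_pow₀ hu1
    nlinarith
  refine ⟨?_, ?_, ?_⟩
  · have : t0 * (2 * A) ≤ Y * (2 * A) := by
      have : t0 * (2 * A) ≤ |t0| * (2 * A) := by gcongr; exact le_abs_self _
      linarith
    exact le_of_mul_le_mul_right this (by linarith)
  · have h3 : (L : ℝ) * (j + 1) ≤ 3 * u ^ 3 := by
      calc (L : ℝ) * (j + 1) ≤ u ^ 2 * (3 * u) := by gcongr
        _ = _ := by ring
    have h4 : 3 * u ^ 3 * (2 * A) ≤ Y * (2 * A) := by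
      calc 3 * u ^ 3 * (2 * A) = (3 * (2 * A)) * u ^ 3 := by ring
        _ ≤ u * u ^ 3 := by gcongr; linarith
        _ ≤ l := hu10
        _ ≤ _ := by linarith
    exact h3.trans (le_of_mul_le_mul_right h4 (by linarith))
  · have hX0 : 0 < X := by linarith
    have hT : ((E * (L * (j + 1) ^ 3) : ℕ) : ℝ) ≤ 27 * E * u ^ 5 := by
      push_cast
      calc (E : ℝ) * (L * (j + 1) ^ 3) ≤ E * (u ^ 2 * (3 * u) ^ 3) := by gcongr
        _ = _ := by ring
    have hn := numu (27 * E) |Real.log c2| u (by positivity) (abs_nonneg _) (by linarith)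
    have hdiv : u ^ 9 ≤ l / Real.log l := by
      rw [le_div_iff₀ (by linarith), ← hul]
      calc u ^ 9 * Real.log (u ^ 10) ≤ u ^ 9 * u := by rw [hul]; gcongr
        _ = u ^ 10 := by ring
    have e3 : X ^ (1 - 1 / Real.log l) = Real.exp (l - l / Real.log l) := by
      rw [Real.rpow_def_of_pos hX0, ← hl]; congr 1; ring
    have e4 : (2 : ℝ) ^ (E * (L * (j + 1) ^ 3)) = Real.exp (((E * (L * (j + 1) ^ 3) : ℕ) : ℝ) * Real.log 2) := by
      rw [Real.exp_nat_mul, Real.exp_log (by norm_num)]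
    have e5 : c2 * X = Real.exp (Real.log c2 + l) := by
      rw [Real.exp_add, Real.exp_log hc2, hl, Real.exp_log hX0]
    rw [e3, e4, e5, ← Real.exp_add, Real.exp_le_exp]
    have hn0 : (0 : ℝ) ≤ ((E * (L * (j + 1) ^ 3) : ℕ) : ℝ) := by positivity
    have h6 : ((E * (L * (j + 1) ^ 3) : ℕ) : ℝ) * Real.log 2 ≤ ((E * (L * (j + 1) ^ 3) : ℕ) : ℝ) * 1 := by
      gcongr; linarith
    have h7 := neg_abs_le (Real.log c2)
    linarith

end VS

set_option maxHeartbeats 1000000 in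
theorem sums_of_two_squares_in_very_short_intervals :
    ∃ c : ℝ, 0 < c ∧ ∃ X0 : ℝ, ∀ X : ℝ, X0 ≤ X →
      ∀ y : ℝ, 2 ≤ y → y ≤ Real.log X ^ ((1 : ℝ) / 5) →
        X ^ (1 - 1 / Real.log (Real.log X)) ≤
          (({x : ℕ | X ≤ (x : ℝ) ∧ (x : ℝ) ≤ 2 * X ∧
            c * y ^ ((1 : ℝ) / 2) * Real.log y ^ (-(1 : ℝ) / 4) ≤
              (Scount ((x : ℝ) + y) : ℝ) - (Scount (x : ℝ) : ℝ)}).ncard : ℝ) := by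
  classical
  obtain ⟨A, hA⟩ : ∃ A : ℕ, A = 6000 := ⟨_, rfl⟩
  obtain ⟨c2, hc2, t0, hcore⟩ := VS.core2 (2 * A)
  obtain ⟨c3, hc3, hpick⟩ := VS.pickH
  obtain ⟨a, ha⟩ := VS.final_num c2 hc2 t0 (80 * (2 * A + 3)) A (by omega)
  obtain ⟨X0, hX0⟩ := VS.ev_u (max a (max 4 (((2 ^ A : ℕ) : ℝ))))
  refine ⟨c2 * c3, by positivity, X0, ?_⟩
  intro X hX y hy hyX
  obtain ⟨hu, hlu, hll, haX⟩ := hX0 X hX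
  have hX4 : 4 ≤ X := ((le_max_left _ _).trans (le_max_right _ _)).trans haX
  have hX2A : ((2 ^ A : ℕ) : ℝ) ≤ X := ((le_max_right _ _).trans (le_max_right _ _)).trans haX
  have hau := (le_max_left _ _).trans hu
  have hl0 : 0 < Real.log X := Real.log_pos (by linarith)
  obtain ⟨u, hud⟩ : ∃ u, u = Real.log X ^ ((1 : ℝ) / 10) := ⟨_, rfl⟩
  rw [← hud] at hlu hau
  have hu10 : u ^ 10 = Real.log X := by
    rw [hud, ← Real.rpow_natCast, ← Real.rpow_mul hl0.le]; norm_num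
  have hu2 : u ^ 2 = Real.log X ^ ((1 : ℝ) / 5) := by
    rw [hud, ← Real.rpow_natCast, ← Real.rpow_mul hl0.le]; norm_num
  obtain ⟨L, hL⟩ : ∃ L, L = ⌊y⌋₊ := ⟨_, rfl⟩
  obtain ⟨n, hn⟩ : ∃ n, n = ⌈X⌉₊ := ⟨_, rfl⟩
  have hXn : X ≤ n := by rw [hn]; exact Nat.le_ceil X
  have hnX : (n : ℝ) < X + 1 := by rw [hn]; exact Nat.ceil_lt_add_one (by linarith)
  have hAn : 2 ^ A ≤ n := by
    have : ((2 ^ A : ℕ) : ℝ) ≤ n := hX2A.trans hXn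
    exact Nat.cast_le.1 this
  have hLy : (L : ℝ) ≤ u ^ 2 := by
    rw [hu2]; refine le_trans ?_ hyX; rw [hL]; exact Nat.floor_le (by linarith)
  obtain ⟨J', hJ1, hJ2, hJ3, hJ4⟩ := VS.pickJ A n (by omega) hAn
  have hlog1 : Real.log X ≤ Real.log n := Real.log_le_log (by linarith) hXn
  have hlog2 : Real.log n ≤ Real.log (2 * X) := Real.log_le_log (by linarith) (by linarith)
  obtain ⟨g1, g2, g3⟩ := ha X (Real.log X) u y (2 ^ J') L J' hau rfl hu10 hll hlu (by linarith) hLy rfl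
    (hJ3.trans hlog2) (hlog1.trans hJ4)
  have g2' : L * (J' + 1) ≤ 2 ^ J' := by exact_mod_cast g2
  obtain ⟨H, r, hH, hk2, hk1, hr, hsq⟩ := hpick y L hy hL
  have hkY : H.card ≤ 2 ^ J' := by nlinarith
  obtain ⟨J, hJa, hJb⟩ := VS.pickJ2 (2 ^ J') H.card hk1 hkY
  have hmain := hcore J J' L n H r hH hk2 hk1 hr g1 g2' hJa hJb (by rw [← hA]; exact hJ1) hJ2
  have hsub : (((Finset.Ico n (n + n / 2)).filter (fun x => c2 * Real.sqrt H.card ≤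
      ((H.filter (fun h => VS.SS (x + h))).card : ℝ)) : Finset ℕ) : Set ℕ) ⊆ {x : ℕ | X ≤ (x : ℝ) ∧ (x : ℝ) ≤ 2 * X ∧
            c2 * c3 * y ^ ((1 : ℝ) / 2) * Real.log y ^ (-(1 : ℝ) / 4) ≤
              (Scount ((x : ℝ) + y) : ℝ) - (Scount (x : ℝ) : ℝ)} := by
    intro x hx
    rw [Finset.mem_coe, Finset.mem_filter, Finset.mem_Ico] at hx
    obtain ⟨⟨hx1, hx2⟩, hx3⟩ := hx
    refine ⟨hXn.trans (by exact_mod_cast hx1), ?_, ?_⟩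
    · have : 2 * x + 1 ≤ 3 * n := by omega
      have : 2 * (x : ℝ) + 1 ≤ 3 * n := by exact_mod_cast this
      linarith
    · refine le_trans ?_ (hx3.trans (VS.Scount_diff x y L (by linarith) hL H hH))
      calc c2 * c3 * y ^ ((1 : ℝ) / 2) * Real.log y ^ (-(1 : ℝ) / 4)
          = c2 * (c3 * (y ^ ((1 : ℝ) / 2) * Real.log y ^ (-(1 : ℝ) / 4))) := by ring
        _ ≤ _ := by gcongr
  have hfin : {x : ℕ | X ≤ (x : ℝ) ∧ (x : ℝ) ≤ 2 * X ∧
            c2 * c3 * y ^ ((1 : ℝ) / 2) * Real.log y ^ (-(1 : ℝ) / 4) ≤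
              (Scount ((x : ℝ) + y) : ℝ) - (Scount (x : ℝ) : ℝ)}.Finite := by
    apply (Set.finite_Iic ⌊2 * X⌋₊).subset
    intro x hx
    exact Nat.le_floor hx.2.1
  have hcard := Set.ncard_le_ncard hsub hfin
  rw [Set.ncard_coe_finset] at hcard
  have hcard' := (Nat.cast_le (α := ℝ)).2 hcard
  refine le_trans ?_ hcard'
  have hpow : (0 : ℝ) < 2 ^ (80 * (2 * A + 3) * (L * (J' + 1) ^ 3)) := by positivity
  have : c2 * X ≤ c2 * n := by gcongr
  refine le_of_mul_le_mul_right ?_ hpow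
  refine g3.trans (this.trans (hmain.trans (le_of_eq ?_)))
  rw [mul_comm]
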